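/- arXiv:2411.16844 — 11 statements merged into one kernel-verified Lean document; each statement's English description precedes it below -/
import Mathlib

section
/- There exists a countable partial order P such that every antichain of P is finite, yet P has no spine; that is, there is no chain C in P together with a partition of P into antichains such that C meets every antichain of the partition. (This disproves the Aharoni–Korman conjecture.) -/
/-- A chain `C` is a spine of a poset (w.r.t. the order relation `r`) if there is a
partition of the whole poset into antichains such that `C` meets every antichain
of the partition. -/
def IsSpine {α : Type*} (r : α → α → Prop) (C : Set α) : Prop :=
  ∃ 𝒜 : Set (Set α),
    (∀ A ∈ 𝒜, IsAntichain r A) ∧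
    (∀ x : α, ∃! A, A ∈ 𝒜 ∧ x ∈ A) ∧
    (∀ A ∈ 𝒜, (A ∩ C).Nonempty)

/-- A point of the counterexample: a level together with a position in the grid `ℕ × ℕ`. -/
@[ext]
structure GridPoint where
  level : ℕ
  x : ℕ
  y : ℕ

namespace GridPoint

/-- Within a level the order is the product order. A level lies entirely below the levels whose
index is smaller by at least two, and partly below the level whose index is smaller by one. -/
instance : PartialOrder GridPoint where
  le a b := b.level + 2 ≤ a.level ∨ (a.level = b.level ∧ a.x ≤ b.x ∧ a.y ≤ b.y) ∨
    (a.level = b.level + 1 ∧ (min a.x a.y < min b.x b.y ∨ a.x + a.y ≤ 2 * (b.x + b.y)))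
  le_refl a := by omega
  le_trans a b c := by omega
  le_antisymm a b h₁ h₂ := by
    apply GridPoint.ext <;> omega

theorem le_def {a b : GridPoint} :
    a ≤ b ↔ b.level + 2 ≤ a.level ∨ (a.level = b.level ∧ a.x ≤ b.x ∧ a.y ≤ b.y) ∨
      (a.level = b.level + 1 ∧
        (min a.x a.y < min b.x b.y ∨ a.x + a.y ≤ 2 * (b.x + b.y))) :=
  Iff.rfl

instance : Countable GridPoint :=
  Function.Injective.countable (f := fun a : GridPoint => (a.level, a.x, a.y)) fun a b h => by
    simp only [Prod.mk.injEq] at h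
    exact GridPoint.ext h.1 h.2.1 h.2.2

theorem finite_of_level_of_isAntichain {A : Set GridPoint} (hA : IsAntichain (· ≤ ·) A) (n : ℕ) :
    {a ∈ A | a.level = n}.Finite := by
  have hinj : Set.InjOn (fun a : GridPoint => (a.x, a.y)) {a ∈ A | a.level = n} := by
    rintro a ⟨-, ha⟩ b ⟨-, hb⟩ h
    simp only [Prod.mk.injEq] at h
    exact GridPoint.ext (ha.trans hb.symm) h.1 h.2
  refine Set.Finite.of_finite_image ?_ hinj
  have hanti : IsAntichain (· ≤ ·)
      ((fun a : GridPoint => (a.x, a.y)) '' {a ∈ A | a.level = n}) := by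
    rintro _ ⟨a, ⟨haA, ha⟩, rfl⟩ _ ⟨b, ⟨hbA, hb⟩, rfl⟩ hne hle
    have hab : a ≤ b := le_def.2 (Or.inr (Or.inl ⟨ha.trans hb.symm, hle.1, hle.2⟩))
    exact hne (by rw [hA.eq haA hbA hab])
  exact hanti.finite_of_partiallyWellOrderedOn (Set.isPWO_of_wellQuasiOrderedLE _)

theorem finite_of_isAntichain {A : Set GridPoint} (hA : IsAntichain (· ≤ ·) A) : A.Finite := by
  rcases A.eq_empty_or_nonempty with rfl | ⟨a, ha⟩
  · exact Set.finite_empty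
  refine ((Set.finite_lt_nat (a.level + 2)).biUnion
    fun n _ => finite_of_level_of_isAntichain hA n).subset fun b hb => ?_
  simp only [Set.mem_iUnion, Set.mem_ofPred_eq, exists_prop]
  refine ⟨b.level, ?_, hb, rfl⟩
  by_contra hlt
  have hba : b ≤ a := le_def.2 (by omega)
  have := hA.eq hb ha hba
  subst this
  omega

/-- A retraction of the poset onto a chain `C` all of whose fibres are antichains. -/
structure IsSpinalMap (C : Set GridPoint) (f : GridPoint → GridPoint) : Prop where
  isChain : IsChain (· ≤ ·) C
  mem (a : GridPoint) : f a ∈ C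
  eq_self {c : GridPoint} : c ∈ C → f c = c
  eq_of_le {a b : GridPoint} : a ≤ b → f a = f b → a = b

theorem exists_isSpinalMap {C : Set GridPoint} (hC : IsChain (· ≤ ·) C)
    (h : IsSpine (· ≤ ·) C) : ∃ f, IsSpinalMap C f := by
  obtain ⟨𝒜, hanti, hpart, hmeet⟩ := h
  choose A hA huniq using hpart
  have hne (a : GridPoint) : ∃ c, c ∈ A a ∧ c ∈ C := hmeet _ (hA a).1
  choose f hfA hfC using hne
  refine ⟨f, hC, hfC, fun {c} hc => ?_, fun {a b} hab hf => ?_⟩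
  · rcases hC.total (hfC c) hc with h | h
    · exact (hanti _ (hA c).1).eq (hfA c) (hA c).2 h
    · exact ((hanti _ (hA c).1).eq (hA c).2 (hfA c) h).symm
  · have h₁ := huniq (f a) _ ⟨(hA a).1, hfA a⟩
    have h₂ := huniq (f a) _ ⟨(hA b).1, hf ▸ hfA b⟩
    have hb : b ∈ A a := by
      rw [h₁, ← h₂]
      exact (hA b).2
    exact (hanti _ (hA a).1).eq (hA a).2 hb hab

namespace IsSpinalMap

variable {C : Set GridPoint} {f : GridPoint → GridPoint}

theorem apply_apply (hf : IsSpinalMap C f) (a : GridPoint) : f (f a) = f a :=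
  hf.eq_self (hf.mem a)

theorem eq_of_le_apply (hf : IsSpinalMap C f) {a : GridPoint} (h : a ≤ f a) : a = f a :=
  hf.eq_of_le h (hf.apply_apply a).symm

theorem eq_of_apply_le (hf : IsSpinalMap C f) {a : GridPoint} (h : f a ≤ a) : f a = a :=
  hf.eq_of_le h (hf.apply_apply a)

theorem level_apply (hf : IsSpinalMap C f) (a : GridPoint) :
    (f a).level = a.level ∨ (f a).level + 1 = a.level ∨ (f a).level = a.level + 1 := by
  by_contra h
  rcases Nat.lt_or_ge (f a).level a.level with hlt | hge
  · have := hf.eq_of_le_apply (a := a) (le_def.2 (by omega))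
    have := congrArg level this
    omega
  · have := hf.eq_of_apply_le (a := a) (le_def.2 (by omega))
    have := congrArg level this
    omega

theorem eq_of_add_eq (hf : IsSpinalMap C f) {c d : GridPoint} (hc : c ∈ C) (hd : d ∈ C)
    (hl : c.level = d.level) (h : c.x + c.y = d.x + d.y) : c = d := by
  rcases hf.isChain.total hc hd with hcd | hcd <;> rw [le_def] at hcd <;>
    apply GridPoint.ext <;> omega

/-- A chain meeting a level has bounded minimum coordinate on the level just below. -/
theorem min_le_of_mem (hf : IsSpinalMap C f) {a b : GridPoint} (ha : a ∈ C) (hb : b ∈ C)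
    (hl : a.level = b.level + 1) : min a.x a.y ≤ 2 * (b.x + b.y) := by
  rcases hf.isChain.total ha hb with h | h <;> rw [le_def] at h <;> omega

theorem min_lt_of_mem (hf : IsSpinalMap C f) {a b : GridPoint} (ha : a ∈ C) (hb : b ∈ C)
    (hl : a.level = b.level + 1) (h : 2 * (b.x + b.y) < a.x + a.y) :
    min a.x a.y < min b.x b.y := by
  rcases hf.isChain.total ha hb with h | h <;> rw [le_def] at h <;> omega

theorem finite_fibre (hf : IsSpinalMap C f) (d : GridPoint) : {a | f a = d}.Finite :=
  finite_of_isAntichain fun _ ha _ hb hne hab =>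
    hne (hf.eq_of_le hab (Eq.trans ha (Eq.symm hb)))

/-- The level just above cannot absorb almost all of a quadrant: a chain contains only about half
as many candidate images as a ray in the quadrant has points. -/
theorem exists_min_ge_apply_notMem (hf : IsSpinalMap C f) (n M : ℕ) (T : Finset GridPoint) :
    ∃ a : GridPoint, a.level = n ∧ M ≤ min a.x a.y ∧ f a ∉ T ∧ (f a).level + 1 ≠ n := by
  classical
  by_contra! hcon
  have key (j : ℕ) (hj : f ⟨n, M, M + j⟩ ∉ T) : (f ⟨n, M, M + j⟩).level + 1 = n :=
    hcon ⟨n, M, M + j⟩ rfl (by simp) hj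
  have hinj : Function.Injective fun j => f ⟨n, M, M + j⟩ := by
    intro i j hij
    have hle {k l : ℕ} (h : k ≤ l) : (⟨n, M, M + k⟩ : GridPoint) ≤ ⟨n, M, M + l⟩ :=
      le_def.2 (Or.inr (Or.inl ⟨rfl, le_rfl, Nat.add_le_add_left h M⟩))
    rcases le_total i j with h | h
    · simpa using congrArg y (hf.eq_of_le (hle h) hij)
    · simpa using (congrArg y (hf.eq_of_le (hle h) hij.symm)).symm
  set s := 2 * (T.card + M) + 2 with hs
  have h₁ : ((Finset.range s).filter fun j => f ⟨n, M, M + j⟩ ∈ T).card ≤ T.card :=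
    Finset.card_le_card_of_injOn _ (fun j hj => (Finset.mem_filter.1 hj).2) hinj.injOn
  have h₂ : ((Finset.range s).filter fun j => f ⟨n, M, M + j⟩ ∉ T).card ≤
      (Finset.range (T.card + 2 * M + 1)).card := by
    refine Finset.card_le_card_of_injOn
      (fun j => (f ⟨n, M, M + j⟩).x + (f ⟨n, M, M + j⟩).y) ?_ ?_
    · intro j hj
      simp only [Finset.coe_filter, Finset.mem_range, Set.mem_ofPred_eq] at hj
      have hl := key j hj.2
      simp only [Finset.coe_range, Set.mem_Iio]
      by_contra hge
      have := congrArg level (hf.eq_of_le_apply (a := ⟨n, M, M + j⟩)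
        (le_def.2 (Or.inr (Or.inr ⟨hl.symm, Or.inr (by dsimp only; omega)⟩))))
      dsimp only at this
      omega
    · intro i hi j hj hij
      simp only [Finset.coe_filter, Finset.mem_range, Set.mem_ofPred_eq] at hi hj
      have hi' := key i hi.2
      have hj' := key j hj.2
      exact hinj (hf.eq_of_add_eq (hf.mem _) (hf.mem _) (by dsimp only; omega) hij)
  have h₃ := Finset.card_filter_add_card_filter_not (s := Finset.range s)
    (fun j => f ⟨n, M, M + j⟩ ∈ T)
  simp only [Finset.card_range] at h₂ h₃
  omega

/-- If a quadrant of a level is mapped into that level and contains a cofinal part of the chain,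
then every chain element above a point `c` of the chain in this quadrant is the image of a point on
the vertical ray above `c`. -/
theorem exists_apply_eq_of_le (hf : IsSpinalMap C f) {M : ℕ} {c d : GridPoint}
    (hquad : ∀ a : GridPoint, a.level = c.level → M ≤ min a.x a.y → (f a).level = c.level)
    (hunb : ∀ N, ∃ e ∈ C, e.level = c.level ∧ N ≤ min e.x e.y)
    (hc : c ∈ C) (hcM : M ≤ min c.x c.y) (hd : d ∈ C) (hdl : d.level = c.level) (hcd : c ≤ d) :
    ∃ a : GridPoint, a.level = c.level ∧ a.x = c.x ∧ f a = d := by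
  classical
  obtain ⟨B, hB⟩ := ((hf.finite_fibre d).image y).bddAbove
  replace hB (a : GridPoint) (ha : f a = d) : a.y ≤ B := hB ⟨a, ha, rfl⟩
  obtain ⟨e, he, hel, hemin⟩ := hunb (B + c.x + c.y + d.x + d.y + 1)
  obtain ⟨I, hI⟩ : ∃ I, e.x = c.x + I := ⟨e.x - c.x, by omega⟩
  obtain ⟨J, hJ⟩ : ∃ J, e.y = c.y + J := ⟨e.y - c.y, by omega⟩
  let p (t : ℕ) : GridPoint := ⟨c.level, c.x + (t - J), c.y + min t J⟩
  have hp {s t : ℕ} (h : s ≤ t) : p s ≤ p t :=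
    le_def.2 (Or.inr (Or.inl ⟨rfl, by dsimp only [p]; omega, by dsimp only [p]; omega⟩))
  have hp_inj {s t : ℕ} (h : f (p s) = f (p t)) : s = t := by
    have hst : p s = p t := by
      rcases le_total s t with h' | h'
      · exact hf.eq_of_le (hp h') h
      · exact (hf.eq_of_le (hp h') h.symm).symm
    have hx := congrArg x hst
    have hy := congrArg y hst
    dsimp only [p] at hx hy
    omega
  have hlev (t : ℕ) : (f (p t)).level = c.level := by
    refine hquad _ rfl ?_
    dsimp only [p]
    omega
  have hrank : ∀ t ∈ Finset.range (I + J + 1),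
      (f (p t)).x + (f (p t)).y ∈ Finset.Icc (c.x + c.y) (e.x + e.y) := by
    intro t ht
    rw [Finset.mem_range] at ht
    have hct : c ≤ p t :=
      le_def.2 (Or.inr (Or.inl ⟨rfl, by dsimp only [p]; omega, by dsimp only [p]; omega⟩))
    have hte : p t ≤ e :=
      le_def.2 (Or.inr (Or.inl ⟨hel.symm, by dsimp only [p]; omega, by dsimp only [p]; omega⟩))
    have h₁ : c ≤ f (p t) := by
      rcases hf.isChain.total hc (hf.mem (p t)) with h | h
      · exact h
      · exact hct.trans (hf.eq_of_apply_le (h.trans hct)).ge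
    have h₂ : f (p t) ≤ e := by
      rcases hf.isChain.total (hf.mem (p t)) he with h | h
      · exact h
      · exact (hf.eq_of_le_apply (hte.trans h)).ge.trans hte
    have := hlev t
    rw [le_def] at h₁ h₂
    rw [Finset.mem_Icc]
    omega
  have hsurj : (Finset.range (I + J + 1)).image (fun t => (f (p t)).x + (f (p t)).y) =
      Finset.Icc (c.x + c.y) (e.x + e.y) := by
    refine Finset.eq_of_subset_of_card_le (Finset.image_subset_iff.2 hrank) ?_
    rw [Finset.card_image_of_injective _ fun s t h => hp_inj
      (hf.eq_of_add_eq (hf.mem _) (hf.mem _) ((hlev s).trans (hlev t).symm) h)]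
    simp only [Nat.card_Icc, Finset.card_range]
    omega
  have hdmem : d.x + d.y ∈ Finset.Icc (c.x + c.y) (e.x + e.y) := by
    rw [le_def] at hcd
    rw [Finset.mem_Icc]
    omega
  rw [← hsurj, Finset.mem_image] at hdmem
  obtain ⟨t, -, ht⟩ := hdmem
  have hfd : f (p t) = d := hf.eq_of_add_eq (hf.mem _) hd ((hlev t).trans hdl.symm) ht
  refine ⟨p t, rfl, ?_, hfd⟩
  have := hB _ hfd
  dsimp only [p] at this ⊢
  omega

theorem finite_add_le (hf : IsSpinalMap C f) (n N : ℕ) :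
    {a ∈ C | a.level = n ∧ a.x + a.y ≤ N}.Finite := by
  refine Set.Finite.of_finite_image (f := fun a => a.x + a.y)
    ((Set.finite_le_nat N).subset ?_) ?_
  · rintro _ ⟨a, ha, rfl⟩
    exact ha.2.2
  · rintro a ⟨ha, hal, -⟩ b ⟨hb, hbl, -⟩ h
    exact hf.eq_of_add_eq ha hb (hal.trans hbl.symm) h

/-- Points of consecutive levels with the same image are incomparable, which bounds the minimum
coordinate of the upper one. -/
theorem min_le_of_apply_eq (hf : IsSpinalMap C f) {a b : GridPoint} (hab : f a = f b)
    (hl : b.level = a.level + 1) : min a.x a.y ≤ min b.x b.y := by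
  by_contra h
  have hba : b ≤ a := le_def.2 (by omega)
  have := congrArg level (hf.eq_of_le hba hab.symm)
  omega

theorem infinite_level (hf : IsSpinalMap C f) (n : ℕ) : {a ∈ C | a.level = n}.Infinite := by
  classical
  intro hfin
  have hunb (N : ℕ) : ∃ e ∈ C, e.level = n + 1 ∧ N ≤ min e.x e.y := by
    by_contra! hbdd
    obtain ⟨a, hal, haM, haT, ha⟩ := hf.exists_min_ge_apply_notMem n N hfin.toFinset
    rw [Set.Finite.mem_toFinset] at haT
    have hlev : (f a).level = n + 1 := by
      rcases hf.level_apply a with h | h | h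
      · exact absurd ⟨hf.mem a, h.trans hal⟩ haT
      · omega
      · omega
    have := hf.min_le_of_apply_eq (hf.apply_apply a).symm (by omega)
    have := hbdd _ (hf.mem a) hlev
    omega
  have hempty (b : GridPoint) (hb : b ∈ C) : b.level ≠ n := by
    intro hbl
    obtain ⟨e, he, hel, hemin⟩ := hunb (2 * (b.x + b.y) + 1)
    have := hf.min_le_of_mem he hb (by omega)
    omega
  obtain ⟨b, hb, hbl, -⟩ := hunb 0
  obtain ⟨c, hc, hcl, hcmin⟩ := hunb (2 * (b.x + b.y) + 1)
  have hquad (a : GridPoint) (hal : a.level = c.level)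
      (ha : 2 * (b.x + b.y) + 1 ≤ min a.x a.y) : (f a).level = c.level := by
    have hne := hempty _ (hf.mem a)
    rcases hf.level_apply a with h | h | h
    · omega
    · omega
    · have h₁ := hf.min_le_of_apply_eq (hf.apply_apply a).symm h
      have h₂ := hf.min_le_of_mem (hf.mem a) hb (by omega)
      omega
  obtain ⟨a, hal, haM, haT, ha⟩ := hf.exists_min_ge_apply_notMem n (c.x + 1)
    (hf.finite_add_le (n + 1) (c.x + c.y)).toFinset
  rw [Set.Finite.mem_toFinset] at haT
  have hne := hempty _ (hf.mem a)
  have hlev : (f a).level = n + 1 := by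
    have := hf.level_apply a
    omega
  have hcd : c ≤ f a := by
    rcases hf.isChain.total hc (hf.mem a) with h | h
    · exact h
    · refine absurd ⟨hf.mem a, hlev, ?_⟩ haT
      rw [le_def] at h
      omega
  obtain ⟨a', hal', hax', hfa'⟩ := hf.exists_apply_eq_of_le hquad
    (by simpa only [hcl] using hunb) hc hcmin (hf.mem a) (hlev.trans hcl.symm) hcd
  have := hf.min_le_of_apply_eq hfa'.symm (by omega)
  omega

end IsSpinalMap

theorem not_isSpinalMap (C : Set GridPoint) (f : GridPoint → GridPoint) : ¬ IsSpinalMap C f := by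
  intro hf
  have hdescent : ∀ k, ∀ b ∈ C, min b.x b.y ≠ k := by
    intro k
    induction k using Nat.strong_induction_on with
    | _ k ih =>
      rintro b hb rfl
      obtain ⟨a, ⟨ha, hal⟩, hnot⟩ := (hf.infinite_level (b.level + 1)).exists_notMem_finite
        (hf.finite_add_le (b.level + 1) (2 * (b.x + b.y)))
      have hlt : 2 * (b.x + b.y) < a.x + a.y := by
        by_contra h
        exact hnot ⟨ha, hal, by omega⟩
      exact ih _ (hf.min_lt_of_mem ha hb hal hlt) a ha rfl
  exact hdescent _ _ (hf.mem ⟨0, 0, 0⟩) rfl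

end GridPoint

/-- There exists a countable partial order in which every antichain is finite,
yet which has no spine. -/
theorem exists_countable_FAC_poset_without_spine :
    ∃ (α : Type) (inst : PartialOrder α), Countable α ∧
      (∀ A : Set α, IsAntichain inst.le A → A.Finite) ∧
      ¬ ∃ C : Set α, IsChain inst.le C ∧ IsSpine inst.le C := by
  refine ⟨GridPoint, inferInstance, inferInstance,
    fun A hA => GridPoint.finite_of_isAntichain hA, ?_⟩
  rintro ⟨C, hC, hspine⟩
  obtain ⟨f, hf⟩ := GridPoint.exists_isSpinalMap hC hspine
  exact GridPoint.not_isSpinalMap C f hf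
end

section
/- The poset P5 has no infinite antichain: every set of pairwise incomparable elements of P5 is finite. -/
/-- The order relation of the poset `P5` on `ℕ × ℕ × ℕ`.  Writing a point as
`(x, y, n)`, we have `(x, y, n) ≤ (u, v, m)` iff `n ≥ m + 2`, or `n = m` with
`x ≤ u` and `y ≤ v`, or `n = m + 1` with `min x y + 1 ≤ min u v`, or `n = m + 1`
with `x + y ≤ 2 * (u + v)`. -/
def P5le : ℕ × ℕ × ℕ → ℕ × ℕ × ℕ → Prop := fun p q =>
  q.2.2 + 2 ≤ p.2.2 ∨
  (p.2.2 = q.2.2 ∧ p.1 ≤ q.1 ∧ p.2.1 ≤ q.2.1) ∨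
  (p.2.2 = q.2.2 + 1 ∧ min p.1 p.2.1 + 1 ≤ min q.1 q.2.1) ∨
  (p.2.2 = q.2.2 + 1 ∧ p.1 + p.2.1 ≤ 2 * (q.1 + q.2.1))

/-- Each level of a `P5le`-antichain is a finite set of pairs. -/
theorem P5le_antichain_level_finite {A : Set (ℕ × ℕ × ℕ)} (hA : IsAntichain P5le A) (n : ℕ) :
    {q : ℕ × ℕ | (q.1, q.2, n) ∈ A}.Finite := by
  refine WellQuasiOrderedLE.finite_of_isAntichain fun p hp q hq hne hle => ?_
  refine hA hp hq (fun h => hne ?_) ?_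
  · simp only [Prod.mk.injEq, and_true] at h
    exact Prod.ext h.1 h.2
  · exact Or.inr (Or.inl ⟨rfl, hle.1, hle.2⟩)

/-- The poset `P5` has no infinite antichain. -/
theorem P5_no_infinite_antichain :
    ∀ A : Set (ℕ × ℕ × ℕ), IsAntichain P5le A → A.Finite := by
  intro A hA
  obtain rfl | ⟨p, hp⟩ := A.eq_empty_or_nonempty
  · exact Set.finite_empty
  have hbound : ∀ q ∈ A, q.2.2 ≤ p.2.2 + 1 := by
    intro q hq
    by_contra! h
    have hle : P5le q p := Or.inl (by omega)
    exact hA hq hp (fun e => by subst e; omega) hle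
  refine ((Set.finite_Iic (p.2.2 + 1)).biUnion fun n _ =>
    (P5le_antichain_level_finite hA n).image fun q => (q.1, q.2, n)).subset fun q hq => ?_
  exact Set.mem_biUnion (hbound q hq) ⟨(q.1, q.2.1), hq, rfl⟩
end

section
/- The poset P5 is scattered: there is no subset of P5 that is order-isomorphic to the rationals ℚ; equivalently, there is no strictly order-preserving map from ℚ into P5. -/
/-- The strict version of the `P5` order. -/
def P5lt : ℕ × ℕ × ℕ → ℕ × ℕ × ℕ → Prop := fun p q => P5le p q ∧ ¬ P5le q p

theorem P5le.level_le {p q : ℕ × ℕ × ℕ} (h : P5le p q) : q.2.2 ≤ p.2.2 := by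
  unfold P5le at h
  omega

theorem P5lt.sum_lt {p q : ℕ × ℕ × ℕ} (h : P5lt p q) (hl : p.2.2 = q.2.2) :
    p.1 + p.2.1 < q.1 + q.2.1 := by
  unfold P5lt P5le at h
  omega

/-- The poset `P5` is scattered: there is no strictly order-preserving map
from `ℚ` into `P5`. -/
theorem P5_scattered :
    ¬ ∃ f : ℚ → ℕ × ℕ × ℕ, ∀ a b : ℚ, a < b → P5lt (f a) (f b) := by
  rintro ⟨f, hf⟩
  -- Beyond a point of minimal level the level is constant.
  obtain ⟨a, -, ha⟩ := (measure fun c => (f c).2.2).wf.has_min Set.univ Set.univ_nonempty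
  have level_eq (b : ℚ) (hb : a < b) : (f b).2.2 = (f a).2.2 :=
    le_antisymm (hf a b hb).1.level_le (not_lt.1 (ha b trivial))
  -- Beyond that point the coordinate sum strictly increases, yet it attains a minimum.
  obtain ⟨b, hb, hmin⟩ := (measure fun c => (f c).1 + (f c).2.1).wf.has_min (Set.Ioi a)
    ⟨a + 1, lt_add_one a⟩
  obtain ⟨c, hac, hcb⟩ := exists_between (Set.mem_Ioi.1 hb)
  exact hmin c hac ((hf c b hcb).sum_lt ((level_eq c hac).trans (level_eq b hb).symm))
end

section
/- For every chain C in the poset P5, there exists an integer n ≥ 1 such that the intersection C ∩ L_n is finite, where L_n = {(x,y,n) : x,y ∈ ℕ} is the n-th level of P5. -/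
/-- The `n`-th level of `P5`: the set of points `(x, y, n)` with `x, y ∈ ℕ`. -/
def P5level (n : ℕ) : Set (ℕ × ℕ × ℕ) := {p | p.2.2 = n}

/-- A subset of a level of `P5` with infinitely many points has points of arbitrarily large
coordinate sum. -/
theorem exists_lt_add_of_infinite_inter_P5level {C : Set (ℕ × ℕ × ℕ)} {n : ℕ}
    (h : (C ∩ P5level n).Infinite) (K : ℕ) : ∃ p ∈ C ∩ P5level n, K < p.1 + p.2.1 := by
  by_contra! hK
  refine h ((Set.finite_Iic (K, K, n)).subset fun p hp => ?_)
  have hsum := hK p hp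
  have hn : p.2.2 = n := hp.2
  exact ⟨show p.1 ≤ K by omega, show p.2.1 ≤ K by omega, hn.le⟩

/-- If a chain of `P5` meets level `n + 1` in an infinite set, then the minima of its points on
level `n + 1` lie strictly below the minima of its points on level `n`. -/
theorem IsChain.min_lt_min_of_P5level {C : Set (ℕ × ℕ × ℕ)} (hC : IsChain P5le C) {n : ℕ}
    (h : (C ∩ P5level (n + 1)).Infinite) {p q : ℕ × ℕ × ℕ}
    (hp : p ∈ C ∩ P5level (n + 1)) (hq : q ∈ C ∩ P5level n) :
    min p.1 p.2.1 < min q.1 q.2.1 := by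
  obtain ⟨r, hr, hlt⟩ :=
    exists_lt_add_of_infinite_inter_P5level h (2 * (q.1 + q.2.1) + (p.1 + p.2.1))
  have hpn : p.2.2 = n + 1 := hp.2
  have hqn : q.2.2 = n := hq.2
  have hrn : r.2.2 = n + 1 := hr.2
  have hpr : p ≠ r := by rintro rfl; omega
  have hrq : r ≠ q := by rintro rfl; omega
  have hpr' := hC hp.1 hr.1 hpr
  have hrq' := hC hr.1 hq.1 hrq
  simp only [P5le] at hpr' hrq'
  omega

/-- For every chain `C` of `P5`, there is an `n ≥ 1` such that `C` meets the
`n`-th level of `P5` in a finite set. -/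
theorem P5_chain_sparse_level :
    ∀ C : Set (ℕ × ℕ × ℕ), IsChain P5le C →
      ∃ n : ℕ, 1 ≤ n ∧ (C ∩ P5level n).Finite := by
  intro C hC
  by_contra! hinf
  replace hinf (n : ℕ) : (C ∩ P5level (n + 1)).Infinite := hinf (n + 1) (by omega)
  choose q hq using fun n => (hinf n).nonempty
  have hanti : StrictAnti fun n => min (q n).1 (q n).2.1 :=
    strictAnti_nat_of_succ_lt fun n =>
      hC.min_lt_min_of_P5level (hinf (n + 1)) (hq (n + 1)) (hq n)
  exact not_strictAnti_of_wellFoundedLT _ hanti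
end

section
/- Let P be a countable partial order with no infinite antichain that contains a chain order-isomorphic to ℚ. Then P has an η-strongly maximal chain: an η-maximal chain C such that for every η-maximal chain D, if there is an η-replacement from C to D then D = C. -/
/-- A subset of a poset has order type `η` if (with its induced order) it is
order-isomorphic to `ℚ`. -/
def EtaType {α : Type*} [PartialOrder α] (C : Set α) : Prop :=
  Nonempty (C ≃o ℚ)

/-- A chain `C` is `η`-maximal if it has order type `η` and the only chain of
order type `η` containing `C` is `C` itself. -/
def EtaMaximal {α : Type*} [PartialOrder α] (C : Set α) : Prop :=
  IsChain (· ≤ ·) C ∧ EtaType C ∧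
    ∀ D : Set α, IsChain (· ≤ ·) D → EtaType D → C ⊆ D → D = C

/-- `f` witnesses an `η`-replacement from the `η`-maximal chain `C` to the
`η`-maximal chain `C'`: it assigns to every `x ∈ C` an interval `f x` of the
chain `C'` such that
(i) the intervals assigned to distinct points are disjoint, and respect the order;
(ii) each `f x` is either the singleton `{x}` or contains a set of order type `η`;
(iii) for `x, y ∈ C` and `z ∈ f y`, `x < y` implies `x < z` and `y < x` implies
`z < x`. -/
def EtaReplacement {α : Type*} [PartialOrder α] (C C' : Set α) (f : α → Set α) :
    Prop :=
  (∀ x ∈ C, f x ⊆ C') ∧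
  (∀ x ∈ C, ∀ w ∈ C', ∀ y ∈ f x, ∀ z ∈ f x, y ≤ w → w ≤ z → w ∈ f x) ∧
  (∀ x ∈ C, ∀ y ∈ C, x ≠ y → Disjoint (f x) (f y)) ∧
  (∀ x ∈ C, ∀ y ∈ C, x < y → ∀ a ∈ f x, ∀ b ∈ f y, a < b) ∧
  (∀ x ∈ C, f x = {x} ∨ ∃ S ⊆ f x, EtaType S) ∧
  (∀ x ∈ C, ∀ y ∈ C, ∀ z ∈ f y, (x < y → x < z) ∧ (y < x → z < x))

/-- `C ⪯η C'`: there is an `η`-replacement from `C` to `C'`. -/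
def EtaPrec {α : Type*} [PartialOrder α] (C C' : Set α) : Prop :=
  ∃ f : α → Set α, EtaReplacement C C' f

/-- A nonempty dense chain without endpoints. -/
structure IsDenseChain {α : Type*} [PartialOrder α] (C : Set α) : Prop where
  nonempty : C.Nonempty
  total : ∀ a ∈ C, ∀ b ∈ C, a < b ∨ a = b ∨ b < a
  dense : ∀ a ∈ C, ∀ b ∈ C, a < b → ∃ c ∈ C, a < c ∧ c < b
  noMax : ∀ a ∈ C, ∃ b ∈ C, a < b
  noMin : ∀ a ∈ C, ∃ b ∈ C, b < a

/-- The elements of `X` having the same position as `x` relative to the other elements of `C`. -/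
def gap {α : Type*} [PartialOrder α] (X C : Set α) (x : α) : Set α :=
  {p | p ∈ X ∧ (∀ c ∈ C, c < x → c < p) ∧ ∀ c ∈ C, x < c → p < c}

/-- `X` contains a dense chain, i.e. it is not scattered. -/
def HasDenseChain {α : Type*} [PartialOrder α] (X : Set α) : Prop :=
  ∃ S ⊆ X, IsDenseChain S

/-- `C` is maximal among the dense chains contained in `X`. -/
structure IsMaxDenseChain {α : Type*} [PartialOrder α] (X C : Set α) : Prop where
  subset : C ⊆ X
  isDenseChain : IsDenseChain C
  eq_of_subset : ∀ D ⊆ X, IsDenseChain D → C ⊆ D → D = C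

/-- `X` contains a maximal dense chain all of whose gaps in `X` are scattered. -/
def HasTightChain {α : Type*} [PartialOrder α] (X : Set α) : Prop :=
  ∃ S, IsMaxDenseChain X S ∧ ∀ x ∈ S, ¬ HasDenseChain (gap X S x)

section DenseChains

variable {α : Type*} [PartialOrder α] {X C D E S T : Set α} {x y e : α}

theorem HasDenseChain.mono (h : S ⊆ T) (hS : HasDenseChain S) : HasDenseChain T := by
  obtain ⟨U, hU, hU'⟩ := hS
  exact ⟨U, hU.trans h, hU'⟩

theorem mem_gap_self (hx : x ∈ X) : x ∈ gap X C x :=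
  ⟨hx, fun _ _ h => h, fun _ _ h => h⟩

theorem gap_subset : gap X C x ⊆ X := fun _ h => h.1

theorem etaType_iff_isDenseChain [Countable α] : EtaType C ↔ IsDenseChain C := by
  constructor
  · rintro ⟨f⟩
    have key : ∀ q r : ℚ, q < r → (f.symm q : α) < f.symm r := fun q r h =>
      f.symm.lt_iff_lt.2 h
    have surj : ∀ a ∈ C, ∃ q : ℚ, (f.symm q : α) = a := fun a ha =>
      ⟨f ⟨a, ha⟩, by simp⟩
    have lt : ∀ q r : ℚ, (f.symm q : α) < f.symm r → q < r := fun q r h =>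
      f.symm.lt_iff_lt.1 h
    refine ⟨⟨_, (f.symm 0).2⟩, ?_, ?_, ?_, ?_⟩
    · intro a ha b hb
      obtain ⟨q, rfl⟩ := surj a ha
      obtain ⟨r, rfl⟩ := surj b hb
      rcases lt_trichotomy q r with h | rfl | h
      · exact Or.inl (key _ _ h)
      · exact Or.inr (Or.inl rfl)
      · exact Or.inr (Or.inr (key _ _ h))
    · intro a ha b hb hab
      obtain ⟨q, rfl⟩ := surj a ha
      obtain ⟨r, rfl⟩ := surj b hb
      obtain ⟨s, h1, h2⟩ := exists_between (lt _ _ hab)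
      exact ⟨_, (f.symm s).2, key _ _ h1, key _ _ h2⟩
    · intro a ha
      obtain ⟨q, rfl⟩ := surj a ha
      obtain ⟨s, h⟩ := exists_gt q
      exact ⟨_, (f.symm s).2, key _ _ h⟩
    · intro a ha
      obtain ⟨q, rfl⟩ := surj a ha
      obtain ⟨s, h⟩ := exists_lt q
      exact ⟨_, (f.symm s).2, key _ _ h⟩
  · intro h
    classical
    let _ : LinearOrder C :=
      { (inferInstance : PartialOrder C) with
        le_total := fun a b => by
          rcases h.total a a.2 b b.2 with h | h | h
          · exact Or.inl h.le
          · exact Or.inl h.le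
          · exact Or.inr h.le
        toDecidableLE := Classical.decRel _ }
    have : Nonempty C := h.nonempty.to_subtype
    have : DenselyOrdered C := ⟨fun a b hab => by
      obtain ⟨c, hc, h1, h2⟩ := h.dense a a.2 b b.2 hab
      exact ⟨⟨c, hc⟩, h1, h2⟩⟩
    have : NoMaxOrder C := ⟨fun a => by
      obtain ⟨c, hc, h1⟩ := h.noMax a a.2
      exact ⟨⟨c, hc⟩, h1⟩⟩
    have : NoMinOrder C := ⟨fun a => by
      obtain ⟨c, hc, h1⟩ := h.noMin a a.2
      exact ⟨⟨c, hc⟩, h1⟩⟩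
    exact Order.iso_of_countable_dense C ℚ

theorem IsDenseChain.isChain (h : IsDenseChain C) : IsChain (· ≤ ·) C := by
  intro a ha b hb _
  rcases h.total a ha b hb with h | h | h
  · exact Or.inl h.le
  · exact Or.inl h.le
  · exact Or.inr h.le

theorem etaMaximal_iff_isMaxDenseChain [Countable α] :
    EtaMaximal C ↔ IsMaxDenseChain Set.univ C := by
  constructor
  · rintro ⟨_, h2, h3⟩
    exact ⟨Set.subset_univ _, etaType_iff_isDenseChain.1 h2, fun D _ hD hCD =>
      h3 D hD.isChain (etaType_iff_isDenseChain.2 hD) hCD⟩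
  · rintro ⟨_, h2, h3⟩
    exact ⟨h2.isChain, etaType_iff_isDenseChain.2 h2, fun D _ hD hCD =>
      h3 D (Set.subset_univ _) (etaType_iff_isDenseChain.1 hD) hCD⟩

theorem IsDenseChain.exists_isMaxDenseChain (hS : IsDenseChain S) (hSX : S ⊆ X) :
    ∃ C, S ⊆ C ∧ IsMaxDenseChain X C := by
  obtain ⟨C, hSC, hC⟩ := zorn_subset_nonempty {C : Set α | C ⊆ X ∧ IsDenseChain C} (by
    intro c hc hchain hne
    have pair : ∀ a ∈ ⋃₀ c, ∀ b ∈ ⋃₀ c, ∃ U ∈ c, a ∈ U ∧ b ∈ U := by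
      rintro a ⟨U, hU, ha⟩ b ⟨V, hV, hb⟩
      rcases hchain.total hU hV with h | h
      · exact ⟨V, hV, h ha, hb⟩
      · exact ⟨U, hU, ha, h hb⟩
    refine ⟨⋃₀ c, ⟨Set.sUnion_subset fun U hU => (hc hU).1, ?_⟩,
      fun U hU => Set.subset_sUnion_of_mem hU⟩
    refine ⟨?_, ?_, ?_, ?_, ?_⟩
    · obtain ⟨U, hU⟩ := hne
      obtain ⟨a, ha⟩ := (hc hU).2.nonempty
      exact ⟨a, U, hU, ha⟩
    · intro a ha b hb
      obtain ⟨U, hU, ha, hb⟩ := pair a ha b hb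
      exact (hc hU).2.total a ha b hb
    · intro a ha b hb hab
      obtain ⟨U, hU, ha, hb⟩ := pair a ha b hb
      obtain ⟨d, hd, h⟩ := (hc hU).2.dense a ha b hb hab
      exact ⟨d, ⟨U, hU, hd⟩, h⟩
    · rintro a ⟨U, hU, ha⟩
      obtain ⟨d, hd, h⟩ := (hc hU).2.noMax a ha
      exact ⟨d, ⟨U, hU, hd⟩, h⟩
    · rintro a ⟨U, hU, ha⟩
      obtain ⟨d, hd, h⟩ := (hc hU).2.noMin a ha
      exact ⟨d, ⟨U, hU, hd⟩, h⟩) S ⟨hSX, hS⟩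
  exact ⟨C, hSC, hC.prop.1, hC.prop.2, fun D hD hD' hCD =>
    Set.Subset.antisymm (hC.le_of_ge ⟨hD, hD'⟩ hCD) hCD⟩

/-- Inserting a dense chain into a cut of a dense chain yields a dense chain. -/
theorem IsDenseChain.union (hS : IsDenseChain S) (hT : IsDenseChain T)
    (h : ∀ s ∈ S, (∀ t ∈ T, s < t) ∨ ∀ t ∈ T, t < s) : IsDenseChain (S ∪ T) := by
  refine ⟨hS.nonempty.inl, ?_, ?_, ?_, ?_⟩
  · rintro a (ha | ha) b (hb | hb)
    · exact hS.total a ha b hb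
    · rcases h a ha with h | h
      · exact Or.inl (h b hb)
      · exact Or.inr (Or.inr (h b hb))
    · rcases h b hb with h | h
      · exact Or.inr (Or.inr (h a ha))
      · exact Or.inl (h a ha)
    · exact hT.total a ha b hb
  · rintro a (ha | ha) b (hb | hb) hab
    · obtain ⟨c, hc, h⟩ := hS.dense a ha b hb hab
      exact ⟨c, Or.inl hc, h⟩
    · obtain ⟨c, hc, hcb⟩ := hT.noMin b hb
      rcases h a ha with h | h
      · exact ⟨c, Or.inr hc, h c hc, hcb⟩
      · exact absurd (h b hb) hab.not_gt
    · obtain ⟨c, hc, hac⟩ := hT.noMax a ha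
      rcases h b hb with h | h
      · exact absurd (h a ha) hab.not_gt
      · exact ⟨c, Or.inr hc, hac, h c hc⟩
    · obtain ⟨c, hc, h⟩ := hT.dense a ha b hb hab
      exact ⟨c, Or.inr hc, h⟩
  · rintro a (ha | ha)
    · obtain ⟨c, hc, h⟩ := hS.noMax a ha
      exact ⟨c, Or.inl hc, h⟩
    · obtain ⟨c, hc, h⟩ := hT.noMax a ha
      exact ⟨c, Or.inr hc, h⟩
  · rintro a (ha | ha)
    · obtain ⟨c, hc, h⟩ := hS.noMin a ha
      exact ⟨c, Or.inl hc, h⟩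
    · obtain ⟨c, hc, h⟩ := hT.noMin a ha
      exact ⟨c, Or.inr hc, h⟩

theorem IsDenseChain.above (hS : IsDenseChain S) (hx : x ∈ S) :
    IsDenseChain {u ∈ S | x < u} := by
  refine ⟨hS.noMax x hx, fun a ha b hb => hS.total a ha.1 b hb.1, ?_, ?_, fun a ha => ?_⟩
  · rintro a ⟨ha, hxa⟩ b ⟨hb, _⟩ hab
    obtain ⟨c, hc, h1, h2⟩ := hS.dense a ha b hb hab
    exact ⟨c, ⟨hc, hxa.trans h1⟩, h1, h2⟩
  · rintro a ⟨ha, hxa⟩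
    obtain ⟨c, hc, h⟩ := hS.noMax a ha
    exact ⟨c, ⟨hc, hxa.trans h⟩, h⟩
  · obtain ⟨c, hc, h1, h2⟩ := hS.dense x hx a ha.1 ha.2
    exact ⟨c, ⟨hc, h1⟩, h2⟩

theorem IsDenseChain.below (hS : IsDenseChain S) (hx : x ∈ S) :
    IsDenseChain {u ∈ S | u < x} := by
  refine ⟨hS.noMin x hx, fun a ha b hb => hS.total a ha.1 b hb.1, ?_, fun a ha => ?_, ?_⟩
  · rintro a ⟨ha, _⟩ b ⟨hb, hbx⟩ hab
    obtain ⟨c, hc, h1, h2⟩ := hS.dense a ha b hb hab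
    exact ⟨c, ⟨hc, h2.trans hbx⟩, h1, h2⟩
  · obtain ⟨c, hc, h1, h2⟩ := hS.dense a ha.1 x hx ha.2
    exact ⟨c, ⟨hc, h2⟩, h1⟩
  · rintro a ⟨ha, hax⟩
    obtain ⟨c, hc, h⟩ := hS.noMin a ha
    exact ⟨c, ⟨hc, h.trans hax⟩, h⟩

theorem IsMaxDenseChain.subset_of_cut (hC : IsMaxDenseChain X C) (hT : IsDenseChain T)
    (hTX : T ⊆ X) (h : ∀ s ∈ C, (∀ t ∈ T, s < t) ∨ ∀ t ∈ T, t < s) : T ⊆ C := by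
  rw [← hC.eq_of_subset _ (Set.union_subset hC.subset hTX) (hC.isDenseChain.union hT h)
    Set.subset_union_left]
  exact Set.subset_union_right

/-- Dense chains in the gap of a maximal dense chain at `x` are incomparable with `x`. -/
theorem IsMaxDenseChain.incompRel_of_subset_gap (hC : IsMaxDenseChain X C) (hx : x ∈ C)
    (hT : IsDenseChain T) (hTg : T ⊆ gap X C x) {t : α} (ht : t ∈ T) :
    ¬ x ≤ t ∧ ¬ t ≤ x := by
  constructor
  · intro hxt
    have hsub : {u ∈ T | t < u} ⊆ C := by
      refine hC.subset_of_cut (hT.above ht) (fun u hu => (hTg hu.1).1) fun s hs => ?_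
      rcases hC.isDenseChain.total s hs x hx with h | rfl | h
      · exact Or.inl fun u hu => (hTg hu.1).2.1 s hs h
      · exact Or.inl fun u hu => hxt.trans_lt hu.2
      · exact Or.inr fun u hu => (hTg hu.1).2.2 s hs h
    obtain ⟨u, hu⟩ := (hT.above ht).nonempty
    exact lt_irrefl u ((hTg hu.1).2.2 u (hsub hu) (hxt.trans_lt hu.2))
  · intro htx
    have hsub : {u ∈ T | u < t} ⊆ C := by
      refine hC.subset_of_cut (hT.below ht) (fun u hu => (hTg hu.1).1) fun s hs => ?_
      rcases hC.isDenseChain.total s hs x hx with h | rfl | h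
      · exact Or.inl fun u hu => (hTg hu.1).2.1 s hs h
      · exact Or.inr fun u hu => hu.2.trans_le htx
      · exact Or.inr fun u hu => (hTg hu.1).2.2 s hs h
    obtain ⟨u, hu⟩ := (hT.below ht).nonempty
    exact lt_irrefl u ((hTg hu.1).2.1 u (hsub hu) (hu.2.trans_le htx))

/-- If every element of a dense chain `E` outside the gaps of the maximal dense chain `C` is
comparable with all of `C`, then there is no such element. -/
theorem IsMaxDenseChain.exists_mem_gap (hC : IsMaxDenseChain X C) (hE : IsDenseChain E)
    (hEX : E ⊆ X)
    (hcmp : ∀ f ∈ E, (∀ x ∈ C, f ∉ gap X C x) → ∀ c ∈ C, c < f ∨ f < c) (he : e ∈ E) :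
    ∃ x ∈ C, e ∈ gap X C x := by
  by_contra! hne
  set K : Set α := {f ∈ E | ∀ x ∈ C, f ∉ gap X C x}
  have hcd := hC.isDenseChain
  have up : ∀ f ∈ K, ∀ c ∈ C, f < c → ∃ d ∈ C, f < d ∧ d < c := by
    intro f hf c hc hfc
    by_contra! hno
    refine hf.2 c hc ⟨hEX hf.1, fun d hd hdc => ?_, fun d hd hcd => hfc.trans hcd⟩
    exact (hcmp f hf.1 hf.2 d hd).resolve_right fun h => hno d hd h hdc
  have down : ∀ f ∈ K, ∀ c ∈ C, c < f → ∃ d ∈ C, c < d ∧ d < f := by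
    intro f hf c hc hcf
    by_contra! hno
    refine hf.2 c hc ⟨hEX hf.1, fun d hd hdc => hdc.trans hcf, fun d hd hcd => ?_⟩
    exact (hcmp f hf.1 hf.2 d hd).resolve_left fun h => hno d hd hcd h
  have gapUp : ∀ f ∈ K, ∀ g, f < g → ∀ c ∈ C, g ∈ gap X C c → f < c := by
    intro f hf g hfg c hc hg
    refine (hcmp f hf.1 hf.2 c hc).resolve_left fun h => ?_
    exact hf.2 c hc ⟨hEX hf.1, fun d hd hdc => hdc.trans h,
      fun d hd hcd => hfg.trans (hg.2.2 d hd hcd)⟩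
  have gapDown : ∀ f ∈ K, ∀ g, g < f → ∀ c ∈ C, g ∈ gap X C c → c < f := by
    intro f hf g hgf c hc hg
    refine (hcmp f hf.1 hf.2 c hc).resolve_right fun h => ?_
    exact hf.2 c hc ⟨hEX hf.1, fun d hd hdc => (hg.2.1 d hd hdc).trans hgf,
      fun d hd hcd => h.trans hcd⟩
  have hU : IsDenseChain (C ∪ K) := by
    refine ⟨hcd.nonempty.inl, ?_, ?_, ?_, ?_⟩
    · rintro a (ha | ha) b (hb | hb)
      · exact hcd.total a ha b hb
      · exact (hcmp b hb.1 hb.2 a ha).imp_right Or.inr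
      · exact (hcmp a ha.1 ha.2 b hb).symm.imp_right Or.inr
      · exact hE.total a ha.1 b hb.1
    · rintro a (ha | ha) b (hb | hb) hab
      · obtain ⟨c, hc, h⟩ := hcd.dense a ha b hb hab
        exact ⟨c, Or.inl hc, h⟩
      · obtain ⟨c, hc, h⟩ := down b hb a ha hab
        exact ⟨c, Or.inl hc, h⟩
      · obtain ⟨c, hc, h⟩ := up a ha b hb hab
        exact ⟨c, Or.inl hc, h⟩
      · obtain ⟨g, hg, hag, hgb⟩ := hE.dense a ha.1 b hb.1 hab
        by_cases hgK : ∀ x ∈ C, g ∉ gap X C x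
        · exact ⟨g, Or.inr ⟨hg, hgK⟩, hag, hgb⟩
        · push Not at hgK
          obtain ⟨c, hc, hgc⟩ := hgK
          exact ⟨c, Or.inl hc, gapUp a ha g hag c hc hgc, gapDown b hb g hgb c hc hgc⟩
    · rintro a (ha | ha)
      · obtain ⟨c, hc, h⟩ := hcd.noMax a ha
        exact ⟨c, Or.inl hc, h⟩
      · obtain ⟨g, hg, hag⟩ := hE.noMax a ha.1
        by_cases hgK : ∀ x ∈ C, g ∉ gap X C x
        · exact ⟨g, Or.inr ⟨hg, hgK⟩, hag⟩
        · push Not at hgK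
          obtain ⟨c, hc, hgc⟩ := hgK
          exact ⟨c, Or.inl hc, gapUp a ha g hag c hc hgc⟩
    · rintro a (ha | ha)
      · obtain ⟨c, hc, h⟩ := hcd.noMin a ha
        exact ⟨c, Or.inl hc, h⟩
      · obtain ⟨g, hg, hga⟩ := hE.noMin a ha.1
        by_cases hgK : ∀ x ∈ C, g ∉ gap X C x
        · exact ⟨g, Or.inr ⟨hg, hgK⟩, hga⟩
        · push Not at hgK
          obtain ⟨c, hc, hgc⟩ := hgK
          exact ⟨c, Or.inl hc, gapDown a ha g hga c hc hgc⟩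
  have heq := hC.eq_of_subset _ (Set.union_subset hC.subset fun f hf => hEX hf.1) hU
    Set.subset_union_left
  have heC : e ∈ C := heq ▸ Or.inr ⟨he, hne⟩
  exact hne e heC (mem_gap_self (hEX he))

/-- Replacing the points of a dense chain by points or dense chains in their gaps. -/
theorem IsDenseChain.biUnion (hC : IsDenseChain C) {s : α → Set α}
    (hgap : ∀ x ∈ C, s x ⊆ gap X C x)
    (hs : ∀ x ∈ C, s x = {x} ∨ IsDenseChain (s x)) : IsDenseChain (⋃ x ∈ C, s x) := by
  have hne : ∀ x ∈ C, (s x).Nonempty := fun x hx => by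
    rcases hs x hx with h | h
    · exact h ▸ Set.singleton_nonempty x
    · exact h.nonempty
  have hlt : ∀ x ∈ C, ∀ y ∈ C, x < y → ∀ a ∈ s x, ∀ b ∈ s y, a < b := by
    intro x hx y hy hxy a ha b hb
    obtain ⟨z, hz, hxz, hzy⟩ := hC.dense x hx y hy hxy
    exact ((hgap x hx ha).2.2 z hz hxz).trans ((hgap y hy hb).2.1 z hz hzy)
  have mem : ∀ {a}, a ∈ ⋃ x ∈ C, s x ↔ ∃ x ∈ C, a ∈ s x := by simp
  refine ⟨?_, ?_, ?_, ?_, ?_⟩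
  · obtain ⟨x, hx⟩ := hC.nonempty
    obtain ⟨a, ha⟩ := hne x hx
    exact ⟨a, mem.2 ⟨x, hx, ha⟩⟩
  · intro a ha b hb
    obtain ⟨x, hx, ha⟩ := mem.1 ha
    obtain ⟨y, hy, hb⟩ := mem.1 hb
    rcases hC.total x hx y hy with h | rfl | h
    · exact Or.inl (hlt x hx y hy h a ha b hb)
    · rcases hs x hx with h | h
      · rw [h] at ha hb
        exact Or.inr (Or.inl (ha.trans hb.symm))
      · exact h.total a ha b hb
    · exact Or.inr (Or.inr (hlt y hy x hx h b hb a ha))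
  · intro a ha b hb hab
    obtain ⟨x, hx, ha⟩ := mem.1 ha
    obtain ⟨y, hy, hb⟩ := mem.1 hb
    rcases hC.total x hx y hy with h | rfl | h
    · obtain ⟨z, hz, hxz, hzy⟩ := hC.dense x hx y hy h
      obtain ⟨c, hc⟩ := hne z hz
      exact ⟨c, mem.2 ⟨z, hz, hc⟩, hlt x hx z hz hxz a ha c hc, hlt z hz y hy hzy c hc b hb⟩
    · rcases hs x hx with h | h
      · rw [h] at ha hb
        exact absurd (ha.trans hb.symm) hab.ne
      · obtain ⟨c, hc, h⟩ := h.dense a ha b hb hab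
        exact ⟨c, mem.2 ⟨x, hx, hc⟩, h⟩
    · exact absurd (hlt y hy x hx h b hb a ha) hab.not_gt
  · intro a ha
    obtain ⟨x, hx, ha⟩ := mem.1 ha
    obtain ⟨y, hy, h⟩ := hC.noMax x hx
    obtain ⟨b, hb⟩ := hne y hy
    exact ⟨b, mem.2 ⟨y, hy, hb⟩, hlt x hx y hy h a ha b hb⟩
  · intro a ha
    obtain ⟨x, hx, ha⟩ := mem.1 ha
    obtain ⟨y, hy, h⟩ := hC.noMin x hx
    obtain ⟨b, hb⟩ := hne y hy
    exact ⟨b, mem.2 ⟨y, hy, hb⟩, hlt y hy x hx h b hb a ha⟩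

/-- The gaps of `E` refine those of `C` if `E` meets every gap of `C`. -/
theorem gap_subset_gap (hC : IsDenseChain C) (hx : x ∈ C)
    (hmeet : ∀ c ∈ C, ∃ b ∈ E, b ∈ gap X C c) (he : e ∈ gap X C x) :
    gap X E e ⊆ gap X C x := by
  intro p hp
  refine ⟨hp.1, fun c hc hcx => ?_, fun c hc hxc => ?_⟩
  · obtain ⟨d, hd, hcd, hdx⟩ := hC.dense c hc x hx hcx
    obtain ⟨d', hd', hdd', hdx'⟩ := hC.dense d hd x hx hdx
    obtain ⟨b, hb, hbg⟩ := hmeet d hd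
    have hbe : b < e := (hbg.2.2 d' hd' hdd').trans (he.2.1 d' hd' hdx')
    exact (hbg.2.1 c hc hcd).trans (hp.2.1 b hb hbe)
  · obtain ⟨d, hd, hxd, hdc⟩ := hC.dense x hx c hc hxc
    obtain ⟨d', hd', hxd', hdd'⟩ := hC.dense x hx d hd hxd
    obtain ⟨b, hb, hbg⟩ := hmeet d hd
    have hbe : e < b := (he.2.2 d' hd' hxd').trans (hbg.2.1 d' hd' hdd')
    exact (hp.2.2 b hb hbe).trans (hbg.2.2 c hc hdc)

/-- Tight chains in the non-scattered gaps of a maximal dense chain can be assembled. -/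
theorem IsMaxDenseChain.hasTightChain (hC : IsMaxDenseChain X C)
    (h : ∀ x ∈ C, HasDenseChain (gap X C x) → HasTightChain (gap X C x)) :
    HasTightChain X := by
  classical
  have hcd := hC.isDenseChain
  have hchoice : ∀ x, ∃ s : Set α, x ∈ C → s ⊆ gap X C x ∧
      ((s = {x} ∧ ¬ HasDenseChain (gap X C x)) ∨ (IsMaxDenseChain (gap X C x) s ∧
        ∀ y ∈ s, ¬ HasDenseChain (gap (gap X C x) s y))) := by
    intro x
    by_cases hx : x ∈ C
    · by_cases hb : HasDenseChain (gap X C x)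
      · obtain ⟨s, hs, hs'⟩ := h x hx hb
        exact ⟨s, fun _ => ⟨hs.subset, Or.inr ⟨hs, hs'⟩⟩⟩
      · exact ⟨{x}, fun _ =>
          ⟨Set.singleton_subset_iff.2 (mem_gap_self (hC.subset hx)), Or.inl ⟨rfl, hb⟩⟩⟩
    · exact ⟨∅, fun hx' => absurd hx' hx⟩
  choose s hs using hchoice
  have hgap : ∀ x ∈ C, s x ⊆ gap X C x := fun x hx => (hs x hx).1
  have hU : IsDenseChain (⋃ x ∈ C, s x) := hcd.biUnion hgap fun x hx =>
    (hs x hx).2.imp (fun h => h.1) fun h => h.1.isDenseChain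
  obtain ⟨E, hUE, hE⟩ := hU.exists_isMaxDenseChain
    (Set.iUnion₂_subset fun x hx => (hgap x hx).trans gap_subset)
  have hsE : ∀ x ∈ C, s x ⊆ E := fun x hx => (Set.subset_biUnion_of_mem hx).trans hUE
  have hed := hE.isDenseChain
  have hmeet : ∀ c ∈ C, ∃ b ∈ E, b ∈ s c := by
    intro c hc
    have : (s c).Nonempty := by
      rcases (hs c hc).2 with h | h
      · exact h.1 ▸ Set.singleton_nonempty c
      · exact h.1.isDenseChain.nonempty
    exact this.imp fun b hb => ⟨hsE c hc hb, hb⟩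
  have hcmp : ∀ f ∈ E, (∀ x ∈ C, f ∉ gap X C x) → ∀ c ∈ C, c < f ∨ f < c := by
    intro f hf hfg c hc
    obtain ⟨a, haE, ha⟩ := hmeet c hc
    have hag := hgap c hc ha
    rcases hed.total a haE f hf with haf | rfl | hfa
    · left
      have : ∃ d ∈ C, c < d ∧ ¬ f < d := by
        by_contra! hno
        exact hfg c hc ⟨hE.subset hf, fun d hd hdc => (hag.2.1 d hd hdc).trans haf, hno⟩
      obtain ⟨d, hd, hcd', hfd⟩ := this
      obtain ⟨d', hd', hcd'', hdd⟩ := hcd.dense c hc d hd hcd'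
      obtain ⟨b, hbE, hb⟩ := hmeet d' hd'
      have hbg := hgap d' hd' hb
      have hbd := hbg.2.2 d hd hdd
      rcases hed.total b hbE f hf with hbf | rfl | hfb
      · exact (hbg.2.1 c hc hcd'').trans hbf
      · exact absurd hbd hfd
      · exact absurd (hfb.trans hbd) hfd
    · exact absurd hag (hfg c hc)
    · right
      have : ∃ d ∈ C, d < c ∧ ¬ d < f := by
        by_contra! hno
        exact hfg c hc ⟨hE.subset hf, hno, fun d hd hdc => hfa.trans (hag.2.2 d hd hdc)⟩
      obtain ⟨d, hd, hdc, hfd⟩ := this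
      obtain ⟨d', hd', hdd, hdc'⟩ := hcd.dense d hd c hc hdc
      obtain ⟨b, hbE, hb⟩ := hmeet d' hd'
      have hbg := hgap d' hd' hb
      have hbd := hbg.2.1 d hd hdd
      rcases hed.total b hbE f hf with hbf | rfl | hfb
      · exact absurd (hbd.trans hbf) hfd
      · exact absurd hbd hfd
      · exact hfb.trans (hbg.2.2 c hc hdc')
  refine ⟨E, hE, fun e he => ?_⟩
  obtain ⟨x, hx, hex⟩ := hC.exists_mem_gap hed hE.subset hcmp he
  have hsub : gap X E e ⊆ gap X C x := gap_subset_gap hcd hx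
    (fun c hc => (hmeet c hc).imp fun b hb => ⟨hb.1, hgap c hc hb.2⟩) hex
  rcases (hs x hx).2 with ⟨_, hnb⟩ | ⟨hmax, htight⟩
  · exact fun hb => hnb (hb.mono hsub)
  · rintro ⟨T, hT, hTd⟩
    by_cases hes : e ∈ s x
    · exact htight e hes ⟨T, fun t ht => ⟨hsub (hT ht),
        fun c hc => (hT ht).2.1 c (hsE x hx hc), fun c hc => (hT ht).2.2 c (hsE x hx hc)⟩, hTd⟩
    · have hTs : T ⊆ s x := by
        refine hmax.subset_of_cut hTd (hT.trans hsub) fun c hc => ?_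
        rcases hed.total c (hsE x hx hc) e he with hce | rfl | hec
        · exact Or.inl fun t ht => (hT ht).2.1 c (hsE x hx hc) hce
        · exact absurd hc hes
        · exact Or.inr fun t ht => (hT ht).2.2 c (hsE x hx hc) hec
      obtain ⟨t, ht⟩ := hTd.nonempty
      have htE := hsE x hx (hTs ht)
      rcases hed.total t htE e he with hte | rfl | het
      · exact lt_irrefl t ((hT ht).2.1 t htE hte)
      · exact hes (hTs ht)
      · exact lt_irrefl t ((hT ht).2.2 t htE het)

/-- In a poset without infinite antichains every non-scattered set has a tight chain. -/
theorem HasDenseChain.hasTightChain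
    (hFAC : ∀ A : Set α, IsAntichain (· ≤ ·) A → A.Finite) (hX : HasDenseChain X) :
    HasTightChain X := by
  by_contra hbad
  have step : ∀ Y : {Y : Set α // HasDenseChain Y ∧ ¬ HasTightChain Y},
      ∃ (Z : {Y : Set α // HasDenseChain Y ∧ ¬ HasTightChain Y}) (x : α), Z.1 ⊆ Y.1 ∧
        (∃ C ⊆ Y.1, IsDenseChain C ∧ x ∈ C) ∧
        ∀ T ⊆ Z.1, IsDenseChain T → ∀ t ∈ T, ¬ x ≤ t ∧ ¬ t ≤ x := by
    rintro ⟨Y, ⟨S, hSY, hS⟩, hY⟩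
    obtain ⟨C, _, hC⟩ := hS.exists_isMaxDenseChain hSY
    have : ∃ x ∈ C, HasDenseChain (gap Y C x) ∧ ¬ HasTightChain (gap Y C x) := by
      by_contra! hno
      exact hY (hC.hasTightChain hno)
    obtain ⟨x, hx, hx'⟩ := this
    exact ⟨⟨gap Y C x, hx'⟩, x, gap_subset, ⟨C, hC.subset, hC.isDenseChain, hx⟩,
      fun T hT hTd t ht => hC.incompRel_of_subset_gap hx hTd hT ht⟩
  choose next pt hsub hpt hinc using step
  let Y : ℕ → {Y : Set α // HasDenseChain Y ∧ ¬ HasTightChain Y} :=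
    fun n => next^[n] ⟨X, hX, hbad⟩
  have hYsucc : ∀ n, Y (n + 1) = next (Y n) := fun n => Function.iterate_succ_apply' _ _ _
  have hanti : Antitone fun n => (Y n).1 := antitone_nat_of_succ_le fun n => by
    rw [hYsucc]
    exact hsub _
  have hlt : ∀ m n, m < n → ¬ pt (Y m) ≤ pt (Y n) ∧ ¬ pt (Y n) ≤ pt (Y m) := by
    intro m n hmn
    obtain ⟨C, hCY, hC, hmem⟩ := hpt (Y n)
    refine hinc (Y m) C ?_ hC _ hmem
    rw [← hYsucc]
    exact hCY.trans (hanti hmn)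
  have hne : ∀ m n, m ≠ n → ¬ pt (Y m) ≤ pt (Y n) := fun m n hmn =>
    hmn.lt_or_gt.elim (fun h => (hlt m n h).1) fun h => (hlt n m h).2
  have hinj : Function.Injective fun n => pt (Y n) := fun m n hmn => by
    by_contra h
    exact hne m n h hmn.le
  refine Set.infinite_range_of_injective hinj (hFAC _ ?_)
  rintro _ ⟨m, rfl⟩ _ ⟨n, rfl⟩ hmn
  exact hne m n fun h => hmn (h ▸ rfl)

end DenseChains

/-- A countable partial order with no infinite antichain containing a chain
order-isomorphic to `ℚ` has an `η`-strongly maximal chain. -/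
theorem countable_FAC_has_eta_SMC (α : Type*) [PartialOrder α] [Countable α]
    (hFAC : ∀ A : Set α, IsAntichain (· ≤ ·) A → A.Finite)
    (hη : ∃ C : Set α, IsChain (· ≤ ·) C ∧ EtaType C) :
    ∃ C : Set α, EtaMaximal C ∧ ∀ D : Set α, EtaMaximal D → EtaPrec C D → D = C := by
  obtain ⟨S, _, hS⟩ := hη
  have hbig : HasDenseChain (Set.univ : Set α) :=
    ⟨S, Set.subset_univ S, etaType_iff_isDenseChain.1 hS⟩
  obtain ⟨C, hC, htight⟩ := hbig.hasTightChain hFAC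
  refine ⟨C, etaMaximal_iff_isMaxDenseChain.2 hC, ?_⟩
  rintro D ⟨_, hDt, _⟩ ⟨f, hfD, _, _, _, hor, hrel⟩
  refine hC.eq_of_subset D (Set.subset_univ D) (etaType_iff_isDenseChain.1 hDt) fun x hx => ?_
  rcases hor x hx with h | ⟨T, hTf, hT⟩
  · exact hfD x hx (h ▸ Set.mem_singleton x)
  · refine absurd ⟨T, fun t ht => ⟨Set.mem_univ t, fun c hc => ?_, fun c hc => ?_⟩,
      etaType_iff_isDenseChain.1 hT⟩ (htight x hx)
    · exact (hrel c hc x hx t (hTf ht)).1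
    · exact (hrel c hc x hx t (hTf ht)).2
end

section
/- If P is a countable vacillating partial order with no infinite antichain, then P contains a spine: there is a chain C ⊆ P and a partition of P into antichains such that C meets every antichain of the partition. -/
/-- A chain `C` is contiguous if there is no `x ∈ P \ C` and `y, z ∈ C` with
`y < x < z` such that `C ∪ {x}` is a chain. -/
def ContiguousChain {α : Type*} [PartialOrder α] (C : Set α) : Prop :=
  IsChain (· ≤ ·) C ∧
    ¬ ∃ x ∉ C, ∃ y ∈ C, ∃ z ∈ C, y < x ∧ x < z ∧ IsChain (· ≤ ·) (insert x C)

/-- A poset is vacillating if there is no contiguous chain `C` which can be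
decomposed into pairwise disjoint infinite pieces `Cᵢ` (`i ∈ ℕ`) with union `C`
such that either (a) the pieces are arranged increasingly and each piece
contains no infinite strictly increasing sequence, or (b) the pieces are
arranged decreasingly and each piece contains no infinite strictly decreasing
sequence. -/
def Vacillating (α : Type*) [PartialOrder α] : Prop :=
  ¬ ∃ (C : Set α) (Ci : ℕ → Set α),
      ContiguousChain C ∧
      (∀ i, (Ci i).Infinite) ∧
      (Pairwise (Function.onFun Disjoint Ci)) ∧
      (⋃ i, Ci i) = C ∧
      (((∀ i j, i < j → ∀ x ∈ Ci i, ∀ y ∈ Ci j, x < y) ∧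
          (∀ i, ¬ ∃ g : ℕ → α, StrictMono g ∧ ∀ n, g n ∈ Ci i)) ∨
        ((∀ i j, i < j → ∀ x ∈ Ci i, ∀ y ∈ Ci j, y < x) ∧
          (∀ i, ¬ ∃ g : ℕ → α, StrictAnti g ∧ ∀ n, g n ∈ Ci i)))

section SpineBasics

variable {α : Type*} [PartialOrder α]

/-- Incomparability. -/
def Incomp (x y : α) : Prop := ¬ x ≤ y ∧ ¬ y ≤ x

theorem Incomp.symm {x y : α} (h : Incomp x y) : Incomp y x := ⟨h.2, h.1⟩

theorem eq_or_lt_or_gt_of_not_incomp {x y : α} (h : ¬ Incomp x y) : x = y ∨ x < y ∨ y < x := by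
  unfold Incomp at h
  by_cases h1 : x ≤ y
  · rcases h1.eq_or_lt with h | h <;> simp [h]
  · have h2 : y ≤ x := by tauto
    rcases h2.eq_or_lt with h | h <;> simp [h]

/-- `f` retracts `S` onto a chain of `S`, and its fibres in `S` are antichains. -/
structure SpineOn (S : Set α) (f : α → α) : Prop where
  maps : ∀ x ∈ S, f x ∈ S
  idem : ∀ x ∈ S, f (f x) = f x
  chain : ∀ x ∈ S, ∀ y ∈ S, f x ≤ f y ∨ f y ≤ f x
  ne : ∀ x ∈ S, ∀ y ∈ S, x < y → f x ≠ f y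

theorem SpineOn.eq_or_incomp {S : Set α} {f : α → α} (h : SpineOn S f) {x : α} (hx : x ∈ S) :
    f x = x ∨ Incomp x (f x) := by
  by_contra hc
  push Not at hc
  rcases eq_or_lt_or_gt_of_not_incomp hc.2 with h1 | h1 | h1
  · exact hc.1 h1.symm
  · exact h.ne x hx _ (h.maps x hx) h1 (h.idem x hx).symm
  · exact h.ne _ (h.maps x hx) x hx h1 (h.idem x hx)

theorem SpineOn.dual {S : Set α} {f : α → α} (h : SpineOn S f) {S' : Set αᵒᵈ} (hS : S' = S) :
    SpineOn S' f := by
  subst hS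
  exact ⟨h.maps, h.idem, fun x hx y hy => (h.chain x hx y hy).symm,
    fun x hx y hy hxy => (h.ne y hy x hx hxy).symm⟩

theorem exists_injective_mem_of_infinite {β : Type*} (B : ℕ → Set β) (hB : ∀ n, (B n).Infinite) :
    ∃ g : ℕ → β, Function.Injective g ∧ ∀ n, g n ∈ B n := by
  classical
  choose c hc hc' using fun n (s : Finset β) => (hB n).exists_notMem_finset s
  let S : ℕ → Finset β := fun n => Nat.rec ∅ (fun n s => insert (c n s) s) n
  have hS : ∀ n, S (n + 1) = insert (c n (S n)) (S n) := fun n => rfl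
  have hmono : Monotone S := monotone_nat_of_le_succ fun n => by
    rw [hS]; exact Finset.subset_insert _ _
  refine ⟨fun n => c n (S n), ?_, fun n => hc n _⟩
  refine Function.Injective.of_lt_imp_ne fun m n hmn h => hc' n (S n) ?_
  rw [← h]
  exact hmono (Nat.succ_le_of_lt hmn) (by rw [hS]; exact Finset.mem_insert_self _ _)

/-- Points outside `Q'` that are incomparable to infinitely many fibres of a spine of `Q'` can
be distributed injectively among these fibres. -/
theorem SpineOn.exists_extend [Countable α] {Q' Q : Set α} {f : α → α} (hf : SpineOn Q' f)
    (hQ : Q' ⊆ Q)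
    (hinf : ∀ x ∈ Q, x ∉ Q' →
      {c | c ∈ f '' Q' ∧ ∀ y ∈ Q', f y = c → Incomp x y}.Infinite) :
    ∃ g, SpineOn Q g := by
  classical
  by_cases hex : ∃ x0 ∈ Q, x0 ∉ Q'
  swap
  · push Not at hex
    exact ⟨f, by rwa [(Set.Subset.antisymm hex hQ : Q = Q')]⟩
  obtain ⟨x0, hx0, hx0'⟩ := hex
  obtain ⟨e, he⟩ := exists_injective_nat α
  let A : α → Set α := fun x => {c | c ∈ f '' Q' ∧ ∀ y ∈ Q', f y = c → Incomp x y}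
  let p : ℕ → α := fun n => if h : ∃ x, x ∈ Q ∧ x ∉ Q' ∧ e x = n then h.choose else x0
  have hp : ∀ n, p n ∈ Q ∧ p n ∉ Q' := by
    intro n
    by_cases h : ∃ x, x ∈ Q ∧ x ∉ Q' ∧ e x = n
    · simp only [p, dif_pos h]; exact ⟨h.choose_spec.1, h.choose_spec.2.1⟩
    · simp only [p, dif_neg h]; exact ⟨hx0, hx0'⟩
  have hpe : ∀ x ∈ Q, x ∉ Q' → p (e x) = x := by
    intro x hx hx'
    have h : ∃ z, z ∈ Q ∧ z ∉ Q' ∧ e z = e x := ⟨x, hx, hx', rfl⟩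
    simp only [p, dif_pos h]; exact he h.choose_spec.2.2
  obtain ⟨g, hg, hgA⟩ := exists_injective_mem_of_infinite (fun n => A (p n))
    fun n => hinf _ (hp n).1 (hp n).2
  have hgA' : ∀ x ∈ Q, x ∉ Q' → g (e x) ∈ A x := by
    intro x hx hx'; have := hgA (e x); rwa [hpe x hx hx'] at this
  let F : α → α := fun x => if x ∈ Q' then f x else g (e x)
  have hF1 : ∀ x ∈ Q', F x = f x := fun x hx => if_pos hx
  have hF2 : ∀ x, x ∉ Q' → F x = g (e x) := fun x hx => if_neg hx
  have him : ∀ x ∈ Q, ∃ y ∈ Q', F x = f y := by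
    intro x hx
    by_cases h : x ∈ Q'
    · exact ⟨x, h, hF1 x h⟩
    · obtain ⟨y, hy, hxy⟩ := (hgA' x hx h).1
      exact ⟨y, hy, by rw [hF2 x h, hxy]⟩
  refine ⟨F, fun x hx => ?_, fun x hx => ?_, fun x hx y hy => ?_, fun x hx y hy hxy heq => ?_⟩
  · obtain ⟨y, hy, h⟩ := him x hx
    rw [h]; exact hQ (hf.maps y hy)
  · obtain ⟨y, hy, h⟩ := him x hx
    rw [h, hF1 _ (hf.maps y hy), hf.idem y hy]
  · obtain ⟨x', hx', h⟩ := him x hx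
    obtain ⟨y', hy', h'⟩ := him y hy
    rw [h, h']; exact hf.chain x' hx' y' hy'
  · by_cases h1 : x ∈ Q' <;> by_cases h2 : y ∈ Q'
    · rw [hF1 x h1, hF1 y h2] at heq; exact hf.ne x h1 y h2 hxy heq
    · rw [hF1 x h1, hF2 y h2] at heq
      exact ((hgA' y hy h2).2 x h1 heq).2 hxy.le
    · rw [hF2 x h1, hF1 y h2] at heq
      exact ((hgA' x hx h1).2 y h2 heq.symm).1 hxy.le
    · rw [hF2 x h1, hF2 y h2] at heq
      exact hxy.ne (he (hg heq))

/-- Spines of the classes of a lexicographic decomposition combine to a spine. -/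
theorem exists_spineOn_of_classes (r : Setoid α) {Q : Set α}
    (hcomp : ∀ x ∈ Q, ∀ y ∈ Q, ¬ r x y → x < y ∨ y < x)
    (hcls : ∀ x ∈ Q, ∃ f, SpineOn {y | y ∈ Q ∧ r x y} f) :
    ∃ f, SpineOn Q f ∧ ∀ y ∈ Q, r y (f y) := by
  classical
  let cl : α → Set α := fun x => {y | y ∈ Q ∧ r x y}
  let G : Set α → α → α := fun A => if h : ∃ f, SpineOn A f then h.choose else id
  have hG : ∀ x ∈ Q, SpineOn (cl x) (G (cl x)) := by
    intro x hx
    have h : ∃ f, SpineOn (cl x) f := hcls x hx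
    simp only [G, dif_pos h]; exact h.choose_spec
  have hcl : ∀ x y, r x y → cl x = cl y := by
    intro x y h; ext z
    exact and_congr_right fun _ => ⟨fun h' => r.trans (r.symm h) h', fun h' => r.trans h h'⟩
  have hself : ∀ x ∈ Q, x ∈ cl x := fun x hx => ⟨hx, r.refl x⟩
  have hm : ∀ x ∈ Q, G (cl x) x ∈ cl x := fun x hx => (hG x hx).maps x (hself x hx)
  refine ⟨fun x => G (cl x) x, ⟨fun x hx => (hm x hx).1, fun x hx => ?_, fun x hx y hy => ?_,
    fun x hx y hy hxy => ?_⟩, fun x hx => (hm x hx).2⟩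
  · rw [← hcl _ _ (hm x hx).2]; exact (hG x hx).idem x (hself x hx)
  · by_cases h : r x y
    · simp only [← hcl _ _ h]
      exact (hG x hx).chain x (hself x hx) y ⟨hy, h⟩
    · refine (hcomp _ (hm x hx).1 _ (hm y hy).1 fun h' => h ?_).imp le_of_lt le_of_lt
      exact r.trans (hm x hx).2 (r.trans h' (r.symm (hm y hy).2))
  · by_cases h : r x y
    · simp only [← hcl _ _ h]
      exact (hG x hx).ne x (hself x hx) y ⟨hy, h⟩ hxy
    · intro h'
      refine h (r.trans (hm x hx).2 (r.trans ?_ (r.symm (hm y hy).2)))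
      rw [h']

theorem Set.Finite.exists_spineOn {S : Set α} (hS : S.Finite) : ∃ f, SpineOn S f := by
  classical
  induction hn : S.ncard using Nat.strong_induction_on generalizing S with
  | _ n ih =>
  subst hn
  rcases S.eq_empty_or_nonempty with rfl | hne
  · exact ⟨id, by constructor <;> simp⟩
  let M : Set α := {x | Minimal (· ∈ S) x}
  have hMS : M ⊆ S := fun x hx => hx.1
  obtain ⟨m0, hm0⟩ := hS.exists_minimal hne
  have hlt : (S \ M).ncard < S.ncard :=
    Set.ncard_lt_ncard ⟨Set.sdiff_subset, fun h => (h hm0.1).2 hm0⟩ hS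
  obtain ⟨f, hf⟩ := ih _ hlt (hS.subset Set.sdiff_subset) rfl
  obtain ⟨m, hm, hmf⟩ : ∃ m ∈ M, ∀ x ∈ S \ M, m < f x := by
    rcases (S \ M).eq_empty_or_nonempty with h | h
    · exact ⟨m0, hm0, by simp [h]⟩
    · obtain ⟨c, hc⟩ := ((hS.subset Set.sdiff_subset).image f).exists_minimal (h.image f)
      obtain ⟨⟨z, hz, rfl⟩, hc2⟩ := hc
      have hfz := hf.maps z hz
      obtain ⟨m, hmle, hm⟩ := hS.exists_le_minimal hfz.1
      refine ⟨m, hm, fun x hx => ?_⟩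
      have h1 : m < f z := lt_of_le_of_ne hmle fun h => hfz.2 (h ▸ hm)
      rcases hf.chain x hx z hz with h | h
      · exact h1.trans_le (hc2 ⟨x, hx, rfl⟩ h)
      · exact h1.trans_le h
  have hnl : ∀ x ∈ S, ∀ y ∈ M, ¬ x < y := fun x hx y hy h => h.not_ge (hy.2 hx h.le)
  let F : α → α := fun x => if x ∈ M then m else f x
  have hF1 : ∀ x ∈ M, F x = m := fun x hx => if_pos hx
  have hF2 : ∀ x, x ∉ M → F x = f x := fun x hx => if_neg hx
  refine ⟨F, fun x hx => ?_, fun x hx => ?_, fun x hx y hy => ?_, fun x hx y hy hxy => ?_⟩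
  · by_cases h : x ∈ M
    · rw [hF1 x h]; exact hm.1
    · rw [hF2 x h]; exact (hf.maps x ⟨hx, h⟩).1
  · by_cases h : x ∈ M
    · rw [hF1 x h, hF1 m hm]
    · rw [hF2 x h, hF2 _ (hf.maps x ⟨hx, h⟩).2, hf.idem x ⟨hx, h⟩]
  · by_cases h1 : x ∈ M <;> by_cases h2 : y ∈ M
    · simp [hF1 x h1, hF1 y h2]
    · rw [hF1 x h1, hF2 y h2]; exact .inl (hmf y ⟨hy, h2⟩).le
    · rw [hF2 x h1, hF1 y h2]; exact .inr (hmf x ⟨hx, h1⟩).le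
    · rw [hF2 x h1, hF2 y h2]; exact hf.chain x ⟨hx, h1⟩ y ⟨hy, h2⟩
  · have h2 : y ∉ M := fun h => hnl x hx y h hxy
    rw [hF2 y h2]
    by_cases h1 : x ∈ M
    · rw [hF1 x h1]; exact (hmf y ⟨hy, h2⟩).ne
    · rw [hF2 x h1]; exact hf.ne x ⟨hx, h1⟩ y ⟨hy, h2⟩ hxy

/-- Compactness: if each point is incomparable to only finitely many others, there is a spine. -/
theorem exists_spineOn_of_finite_incomp [Countable α] {Q : Set α}
    (hfin : ∀ x ∈ Q, {y | y ∈ Q ∧ Incomp x y}.Finite) : ∃ f, SpineOn Q f := by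
  classical
  obtain ⟨e, he⟩ := exists_injective_nat α
  have hF : ∀ n, ∃ f, SpineOn {x | x ∈ Q ∧ e x < n} f := fun n =>
    Set.Finite.exists_spineOn <|
      ((Set.finite_lt_nat n).preimage he.injOn).subset fun x hx => hx.2
  choose f hf using hF
  have hev : ∀ x, ∀ᶠ n in (Filter.hyperfilter ℕ : Filter ℕ), e x < n := fun x =>
    (Filter.eventually_gt_atTop (e x)).filter_mono
      (by simpa [Nat.cofinite_eq_atTop] using Filter.hyperfilter_le_cofinite (α := ℕ))
  have hlim : ∀ x, ∃ y, x ∈ Q → ∀ᶠ n in (Filter.hyperfilter ℕ : Filter ℕ), f n x = y := by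
    intro x
    by_cases hx : x ∈ Q
    swap
    · exact ⟨x, fun h => absurd h hx⟩
    have h1 : ∀ᶠ n in (Filter.hyperfilter ℕ : Filter ℕ),
        ∃ y ∈ insert x {y | y ∈ Q ∧ Incomp x y}, f n x = y := by
      filter_upwards [hev x] with n hn
      refine ⟨_, ?_, rfl⟩
      rcases (hf n).eq_or_incomp (x := x) ⟨hx, hn⟩ with h | h
      · exact .inl h
      · exact .inr ⟨((hf n).maps x ⟨hx, hn⟩).1, h⟩
    rw [Ultrafilter.eventually_exists_mem_iff ((hfin x hx).insert x)] at h1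
    obtain ⟨y, -, hy⟩ := h1
    exact ⟨y, fun _ => hy⟩
  choose g hg using hlim
  have hgQ : ∀ x ∈ Q, g x ∈ Q := by
    intro x hx
    obtain ⟨n, h1, h2⟩ := ((hev x).and (hg x hx)).exists
    rw [← h2]; exact ((hf n).maps x ⟨hx, h1⟩).1
  refine ⟨g, hgQ, fun x hx => ?_, fun x hx y hy => ?_, fun x hx y hy hxy => ?_⟩
  · obtain ⟨n, ⟨h1, h2⟩, h3⟩ := (((hev x).and (hg x hx)).and (hg _ (hgQ x hx))).exists
    rw [← h3, ← h2]; exact (hf n).idem x ⟨hx, h1⟩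
  · obtain ⟨n, ⟨⟨h1, h2⟩, h3⟩, h4⟩ :=
      ((((hev x).and (hg x hx)).and (hev y)).and (hg y hy)).exists
    rw [← h2, ← h4]; exact (hf n).chain x ⟨hx, h1⟩ y ⟨hy, h3⟩
  · obtain ⟨n, ⟨⟨h1, h2⟩, h3⟩, h4⟩ :=
      ((((hev x).and (hg x hx)).and (hev y)).and (hg y hy)).exists
    rw [← h2, ← h4]; exact (hf n).ne x ⟨hx, h1⟩ y ⟨hy, h3⟩ hxy

end SpineBasics

section Sequences

variable {β : Type*} [PartialOrder β]

/-- Sequential form of the finite antichain condition. -/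
def FAC (β : Type*) [PartialOrder β] : Prop :=
  ∀ y : ℕ → β, ¬ ∀ i j, i < j → Incomp (y i) (y j)

/-- No nonempty dense relation is contained in the strict order. -/
def Scattered (β : Type*) [PartialOrder β] : Prop :=
  ∀ R : β → β → Prop, (∀ x y, R x y → x < y) → (∀ x y, R x y → ∃ z, R x z ∧ R z y) →
    ∀ x y, ¬ R x y

/-- The hypotheses to which the theorem is reduced. -/
structure Tame (β : Type*) [PartialOrder β] : Prop where
  fac : FAC β
  scattered : Scattered β
  vac : Vacillating β

theorem FAC.dual (h : FAC β) : FAC βᵒᵈ :=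
  fun y hy => h y fun i j hij => (hy i j hij).symm

theorem Scattered.dual (h : Scattered β) : Scattered βᵒᵈ :=
  fun R h1 h2 x y hxy => h (fun a b => R b a) (fun a b hab => h1 b a hab)
    (fun a b hab => by obtain ⟨z, hz, hz'⟩ := h2 b a hab; exact ⟨z, hz', hz⟩) y x hxy

theorem Vacillating.dual (h : Vacillating β) : Vacillating βᵒᵈ := by
  rintro ⟨C, Ci, ⟨hC1, hC2⟩, hinf, hdis, hun, hor⟩
  refine h ⟨C, Ci, ⟨hC1.symm, ?_⟩, hinf, hdis, hun, ?_⟩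
  · rintro ⟨x, hx, y, hy, z, hz, hyx, hxz, hch⟩
    exact hC2 ⟨x, hx, z, hz, y, hy, hxz, hyx, hch.symm⟩
  · rcases hor with ⟨h1, h2⟩ | ⟨h1, h2⟩
    · exact .inr ⟨h1, fun i ⟨g, hg, hg'⟩ => h2 i ⟨g, fun m n hmn => hg hmn, hg'⟩⟩
    · exact .inl ⟨h1, fun i ⟨g, hg, hg'⟩ => h2 i ⟨g, fun m n hmn => hg hmn, hg'⟩⟩

theorem Tame.dual (h : Tame β) : Tame βᵒᵈ := ⟨h.fac.dual, h.scattered.dual, h.vac.dual⟩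

theorem FAC.exists_strictMono_or_antitone (h : FAC β) (y : ℕ → β) :
    ∃ φ : ℕ → ℕ, StrictMono φ ∧ (StrictMono (y ∘ φ) ∨ Antitone (y ∘ φ)) := by
  obtain ⟨g, hg | hg⟩ := exists_increasing_or_nonincreasing_subseq (· < ·) y
  · exact ⟨g, g.strictMono, .inl fun m n hmn => hg m n hmn⟩
  obtain ⟨k, hk | hk⟩ := exists_increasing_or_nonincreasing_subseq (· ≥ ·) (y ∘ g)
  · refine ⟨g ∘ k, g.strictMono.comp k.strictMono, .inr fun m n hmn => ?_⟩
    rcases hmn.eq_or_lt with rfl | hmn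
    · exact le_rfl
    · exact hk m n hmn
  · refine absurd ?_ (h (y ∘ g ∘ k))
    refine fun i j hij => ⟨fun hle => ?_, hk i j hij⟩
    rcases hle.eq_or_lt with h' | h'
    · exact hk i j hij h'.ge
    · exact hg _ _ (k.strictMono hij) h'

/-- The lower set generated by a sequence. -/
def Below (a : ℕ → β) : Set β := {x | ∃ n, x ≤ a n}

/-- The strict upper bounds of a sequence. -/
def Above (a : ℕ → β) : Set β := {x | ∀ n, a n < x}

/-- A sequence in the lower set generated by `a`, neither bounded in it nor cofinal. -/
def Defect (a' a : ℕ → β) : Prop :=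
  StrictMono a' ∧ (∀ n, ∃ m, a' n ≤ a m) ∧ (∀ m, ∃ n, ¬ a' n ≤ a m) ∧ ∃ m, ∀ n, ¬ a m ≤ a' n

theorem Defect.of_shift {a' a : ℕ → β} (ha : StrictMono a) {k : ℕ}
    (h : Defect a' (fun n => a (n + k))) : Defect a' a := by
  obtain ⟨h1, h2, h3, m, h4⟩ := h
  refine ⟨h1, fun n => ?_, fun m => ?_, m + k, h4⟩
  · obtain ⟨m, hm⟩ := h2 n; exact ⟨_, hm⟩
  · obtain ⟨n, hn⟩ := h3 m
    exact ⟨n, fun h => hn (h.trans (ha.monotone (Nat.le_add_right _ _)))⟩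

theorem FAC.exists_strictMono_of_not_le (h : FAC β) {y a : ℕ → β} (ha : StrictMono a)
    (h1 : ∀ n, y n ∈ Below a) (h2 : ∀ n, ¬ y n ≤ a n) :
    ∃ φ : ℕ → ℕ, StrictMono φ ∧ StrictMono (y ∘ φ) := by
  obtain ⟨φ, hφ, h | h⟩ := h.exists_strictMono_or_antitone y
  · exact ⟨φ, hφ, h⟩
  · obtain ⟨m, hm⟩ := h1 (φ 0)
    exact absurd ((h (Nat.zero_le m)).trans (hm.trans (ha.monotone (hφ.id_le m)))) (h2 _)

/-- A strictly decreasing sequence above `u` lying below a strictly increasing one below `v`. -/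
def Bridge (u v : β) : Prop :=
  ∃ d a : ℕ → β, StrictAnti d ∧ StrictMono a ∧ (∀ n, u ≤ d n) ∧ (∀ n, a n ≤ v) ∧ d 0 ≤ a 0

theorem Bridge.lt {u v : β} (h : Bridge u v) : u < v := by
  obtain ⟨d, a, hd, ha, hu, hv, h0⟩ := h
  exact (hu 1).trans_lt ((hd Nat.zero_lt_one).trans_le (h0.trans (hv 0)))

theorem Bridge.mono {u v u' v' : β} (h : Bridge u v) (hu : u' ≤ u) (hv : v ≤ v') :
    Bridge u' v' := by
  obtain ⟨d, a, h1, h2, h3, h4, h0⟩ := h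
  exact ⟨d, a, h1, h2, fun n => hu.trans (h3 n), fun n => (h4 n).trans hv, h0⟩

theorem Bridge.dual {u v : β} (h : Bridge u v) : Bridge (β := βᵒᵈ) v u := by
  obtain ⟨d, a, h1, h2, h3, h4, h0⟩ := h
  exact ⟨a, d, fun m n h => h2 h, fun m n h => h1 h, h4, h3, h0⟩

/-- Strictly increasing sequences in `S`, each below the first term of the previous one. -/
structure Tower (S : Set β) (s : ℕ → ℕ → β) : Prop where
  mono : ∀ k, StrictMono (s k)
  mem : ∀ k n, s k n ∈ S
  lt : ∀ k n, s (k + 1) n < s k 0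

theorem Tower.strictAnti {S : Set β} {s : ℕ → ℕ → β} (h : Tower S s) :
    StrictAnti (fun k => s k 0) :=
  strictAnti_nat_of_succ_lt fun k => h.lt k 0

theorem Tower.lt_of_lt {S : Set β} {s : ℕ → ℕ → β} (h : Tower S s) {k l : ℕ} (hkl : k < l)
    (n : ℕ) : s l n < s k 0 := by
  obtain ⟨l, rfl⟩ : ∃ l', l = l' + 1 := ⟨l - 1, by omega⟩
  exact (h.lt l n).trans_le (h.strictAnti.antitone (Nat.le_of_lt_succ hkl))

theorem Vacillating.exists_bridge (hv : Vacillating β) {S : Set β} {s : ℕ → ℕ → β}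
    (hs : Tower S s) (K : ℕ) : ∃ j ≥ K, Bridge (s (j + 2) 0) (s j 0) := by
  have hchain : IsChain (· ≤ ·) (Set.range fun p : ℕ × ℕ => s p.1 p.2) := by
    rintro _ ⟨⟨k, n⟩, rfl⟩ _ ⟨⟨l, m⟩, rfl⟩ -
    rcases lt_trichotomy k l with h | rfl | h
    · exact .inr ((hs.lt_of_lt h m).le.trans ((hs.mono k).monotone (Nat.zero_le n)))
    · exact ((le_total n m).imp (fun h => (hs.mono k).monotone h) fun h => (hs.mono k).monotone h)
    · exact .inl ((hs.lt_of_lt h n).le.trans ((hs.mono l).monotone (Nat.zero_le m)))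
  obtain ⟨C, hC, hsC⟩ := hchain.exists_maxChain
  have hmem : ∀ k n, s k n ∈ C := fun k n => hsC ⟨(k, n), rfl⟩
  have hanti := hs.strictAnti
  let p : ℕ → β := fun k => s (K + 1 + k) 0
  have hp : StrictAnti p := fun k l h => hanti (by omega)
  let Ci : ℕ → Set β := fun k => {x | x ∈ C ∧ p (k + 1) ≤ x ∧ x < p k}
  have hdec : ∀ i j, i < j → ∀ x ∈ Ci i, ∀ y ∈ Ci j, y < x := fun i j hij x hx y hy =>
    hy.2.2.trans_le ((hp.antitone (Nat.succ_le_of_lt hij)).trans hx.2.1)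
  have hcov : ∀ x ∈ C, x < p 0 → ∀ k, p k ≤ x → x ∈ ⋃ i, Ci i := by
    intro x hx h0 k
    induction k with
    | zero => intro hk; exact absurd h0 hk.not_gt
    | succ k ih =>
      intro hk
      by_cases h : p k ≤ x
      · exact ih h
      · refine Set.mem_iUnion.2 ⟨k, hx, hk, lt_of_le_not_ge ?_ h⟩
        exact (hC.1.total hx (hmem _ 0)).resolve_right h
  have hUp : ∀ x ∈ ⋃ i, Ci i, x ∈ C ∧ x < p 0 ∧ ∃ k, p k ≤ x := by
    intro x hx
    obtain ⟨i, hi⟩ := Set.mem_iUnion.1 hx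
    exact ⟨hi.1, hi.2.2.trans_le (hp.antitone (Nat.zero_le i)), i + 1, hi.2.1⟩
  have hcont : ContiguousChain (⋃ i, Ci i) := by
    refine ⟨hC.1.mono fun x hx => (hUp x hx).1, ?_⟩
    rintro ⟨x, hx, y, hy, z, hz, hyx, hxz, hch⟩
    obtain ⟨-, -, k, hk⟩ := hUp y hy
    have hx0 := hxz.trans (hUp z hz).2.1
    have hxk := hk.trans hyx.le
    have hxC : IsChain (· ≤ ·) (insert x C) := by
      refine hC.1.insert fun c hc hne => ?_
      by_cases hcU : c ∈ ⋃ i, Ci i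
      · exact hch (Set.mem_insert _ _) (Set.mem_insert_of_mem _ hcU) hne
      rcases hC.1.total hc (hmem (K + 1) 0) with h | h
      · rcases h.eq_or_lt with h | h
        · exact .inl (hx0.le.trans h.ge)
        · rcases hC.1.total hc (hmem (K + 1 + k) 0) with h' | h'
          · exact .inr (h'.trans hxk)
          · exact absurd (hcov c hc h k h') hcU
      · exact .inl (hx0.le.trans h)
    have : x ∈ C := by
      rw [hC.2 hxC (Set.subset_insert _ _)]; exact Set.mem_insert _ _
    exact hx (hcov x this hx0 k hxk)
  have : ∃ i, ∃ g : ℕ → β, StrictAnti g ∧ ∀ n, g n ∈ Ci i := by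
    by_contra hcon
    push Not at hcon
    refine hv ⟨_, Ci, hcont, fun i => ?_, ?_, rfl, .inr ⟨hdec, fun i ⟨g, hg, hg'⟩ => ?_⟩⟩
    · refine (Set.infinite_range_of_injective (hs.mono (K + 1 + (i + 1))).injective).mono ?_
      rintro _ ⟨n, rfl⟩
      exact ⟨hmem _ _, (hs.mono _).monotone (Nat.zero_le n), hs.lt_of_lt (by omega) n⟩
    · intro i j hij
      refine Set.disjoint_left.2 fun x hx hx' => ?_
      rcases lt_or_gt_of_ne hij with h | h
      · exact lt_irrefl x (hdec _ _ h x hx x hx')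
      · exact lt_irrefl x (hdec _ _ h x hx' x hx)
    · obtain ⟨n, hn⟩ := hcon i g hg
      exact hn (hg' n)
  obtain ⟨i, g, hg, hgi⟩ := this
  refine ⟨K + i, Nat.le_add_right _ _, g, s (K + 1 + i), hg, hs.mono _, fun n => ?_, fun n => ?_,
    (hgi 0).2.2.le⟩
  · have := (hgi n).2.1
    rwa [show p (i + 1) = s (K + i + 2) 0 by simp only [p]; congr 1; omega] at this
  · exact (hs.lt_of_lt (by omega) n).le

/-- `Defect` for sequences in `S`. -/
def DefectIn (S : Set β) (a' a : ℕ → β) : Prop := Defect a' a ∧ ∀ n, a' n ∈ S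

theorem FAC.exists_tower (hf : FAC β) {S : Set β} (h : ¬ WellFounded (DefectIn S)) :
    ∃ s, Tower S s := by
  rw [wellFounded_iff_isEmpty_descending_chain, not_isEmpty_iff] at h
  obtain ⟨f, hf'⟩ := h
  let b : ℕ → ℕ → β := fun k => f (k + 1)
  have hb : ∀ k, Defect (b (k + 1)) (b k) := fun k => (hf' (k + 1)).1
  have hmono : ∀ k, StrictMono (b k) := fun k => (hf' k).1.1
  have hS : ∀ k n, b k n ∈ S := fun k => (hf' k).2
  have hbel : ∀ k l, k ≤ l → ∀ n, ∃ m, b l n ≤ b k m := by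
    intro k l hkl
    induction l, hkl using Nat.le_induction with
    | base => exact fun n => ⟨n, le_rfl⟩
    | succ l hl ih =>
      intro n
      obtain ⟨m, hm⟩ := (hb l).2.1 n
      obtain ⟨m', hm'⟩ := ih m
      exact ⟨m', hm.trans hm'⟩
  let bd : (ℕ → β) → (ℕ → β) → Prop := fun c c' => ∃ m, ∀ n, c' n ≤ c m
  have : IsTrans _ bd := ⟨fun c c' c'' ⟨m, hm⟩ ⟨m', hm'⟩ => ⟨m, fun n => (hm' n).trans (hm m')⟩⟩
  obtain ⟨g, hg | hg⟩ := exists_increasing_or_nonincreasing_subseq bd b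
  · choose m hm using fun k => hg k (k + 1) (Nat.lt_succ_self k)
    refine ⟨fun k n => b (g k) (m k + 1 + n), fun k i j hij => hmono _ (by omega),
      fun k n => hS _ _, fun k n => ?_⟩
    exact (hm k _).trans_lt (hmono _ (by omega))
  · exfalso
    choose t ht using fun k => (hb (g k)).2.2.2
    have hthr : ∀ k l, k < l → ∀ m ≥ t k, ∀ n, ¬ b (g k) m ≤ b (g l) n := by
      intro k l hkl m hm n hle
      obtain ⟨n', hn'⟩ := hbel (g k + 1) (g l) (g.strictMono hkl) n
      exact ht k n' (((hmono _).monotone hm).trans (hle.trans hn'))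
    have hunb : ∀ k l, k < l → ∀ m, ∃ n, ¬ b (g l) n ≤ b (g k) m := by
      intro k l hkl m
      by_contra hcon
      push Not at hcon
      exact hg k l hkl ⟨m, hcon⟩
    obtain ⟨q, hq, hqr⟩ := exists_seq_of_forall_finset_exists
      (fun p : ℕ × ℕ => t p.1 ≤ p.2)
      (fun p q => p.1 < q.1 ∧ ¬ b (g q.1) q.2 ≤ b (g p.1) p.2) (by
        intro s _
        obtain ⟨l, hl⟩ : ∃ l, ∀ p ∈ s, p.1 < l :=
          ⟨s.sup Prod.fst + 1, fun p hp => Nat.lt_succ_of_le (Finset.le_sup (f := Prod.fst) hp)⟩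
        have : ∀ p : ℕ × ℕ, ∃ n, p ∈ s → ¬ b (g l) n ≤ b (g p.1) p.2 := by
          intro p
          by_cases hp : p ∈ s
          · obtain ⟨n, hn⟩ := hunb p.1 l (hl p hp) p.2
            exact ⟨n, fun _ => hn⟩
          · exact ⟨0, fun h => absurd h hp⟩
        choose n hn using this
        refine ⟨(l, max (t l) (s.sup n)), le_max_left _ _, fun p hp => ⟨hl p hp, fun hle => ?_⟩⟩
        exact hn p hp (((hmono _).monotone
          ((Finset.le_sup (f := n) hp).trans (le_max_right _ _))).trans hle))
    exact hf (fun i => b (g (q i).1) (q i).2) fun i j hij =>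
      ⟨hthr _ _ (hqr i j hij).1 _ (hq i) _, (hqr i j hij).2⟩

/-- The convex set between a decreasing sequence and an increasing one. -/
def Zone (d a : ℕ → β) : Set β := {x | (∃ n, d n ≤ x) ∧ ∃ m, x ≤ a m}

/-- A decreasing and an increasing sequence without defects in their zone. -/
structure MutualPair (Q : Set β) (d a : ℕ → β) : Prop where
  anti : StrictAnti d
  mono : StrictMono a
  dmem : ∀ n, d n ∈ Q
  amem : ∀ n, a n ∈ Q
  le : d 0 ≤ a 0
  adef : ∀ a', (∀ n, a' n ∈ Zone d a) → ¬ Defect a' a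
  ddef : ∀ d', (∀ n, d' n ∈ Zone d a) → ¬ Defect (β := βᵒᵈ) d' d

theorem Tame.not_tower (h : Tame β) {u v : β} (huv : ¬ ∃ w, Bridge u w ∧ Bridge w v)
    {S : Set β} (hS : S ⊆ Set.Icc u v) (s : ℕ → ℕ → β) : ¬ Tower S s := by
  intro hs
  obtain ⟨j, -, hj⟩ := h.vac.exists_bridge hs 0
  obtain ⟨i, hi, hij⟩ := h.vac.exists_bridge hs (j + 2)
  exact huv ⟨s (j + 2) 0, hij.mono (hS (hs.mem _ _)).1 (hs.strictAnti.antitone hi),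
    hj.mono le_rfl (hS (hs.mem _ _)).2⟩

theorem Tame.exists_nice (h : Tame β) {Q : Set β} (hQ : Q.OrdConnected) {a0 : ℕ → β}
    (ha0 : StrictMono a0) (ha0Q : ∀ n, a0 n ∈ Q) :
    (∃ a, StrictMono a ∧ (∀ n, a n ∈ Q) ∧ ∀ a', (∀ n, a' n ∈ Q) → ¬ Defect a' a) ∨
      ∃ d a, MutualPair Q d a := by
  by_cases hb : ∃ u ∈ Q, ∃ v ∈ Q, Bridge u v
  · right
    obtain ⟨u, hu, v, hv, huv, hns⟩ : ∃ u ∈ Q, ∃ v ∈ Q, Bridge u v ∧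
        ¬ ∃ w, Bridge u w ∧ Bridge w v := by
      by_contra hcon
      push Not at hcon
      obtain ⟨u, hu, v, hv, huv⟩ := hb
      refine h.scattered (fun x y => x ∈ Q ∧ y ∈ Q ∧ Bridge x y) (fun x y hxy => hxy.2.2.lt)
        (fun x y ⟨hx, hy, hxy⟩ => ?_) u v ⟨hu, hv, huv⟩
      obtain ⟨w, h1, h2⟩ := hcon x hx y hy hxy
      have hw : w ∈ Q := hQ.out hx hy ⟨h1.lt.le, h2.lt.le⟩
      exact ⟨w, ⟨hx, hw, h1⟩, hw, hy, h2⟩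
    obtain ⟨d, a, hd, ha, hud, hav, hda⟩ := huv
    have hS : Zone d a ⊆ Set.Icc u v := by
      rintro x ⟨⟨n, hn⟩, m, hm⟩
      exact ⟨(hud n).trans hn, hm.trans (hav m)⟩
    have hSQ : Zone d a ⊆ Q := hS.trans (hQ.out hu hv)
    have hwa : WellFounded (DefectIn (Zone d a)) := by
      by_contra hcon
      obtain ⟨s, hs⟩ := h.fac.exists_tower hcon
      exact h.not_tower hns hS s hs
    have hwd : WellFounded (DefectIn (β := βᵒᵈ) (Zone (β := β) d a)) := by
      by_contra hcon
      obtain ⟨s, hs⟩ := h.fac.dual.exists_tower hcon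
      refine h.dual.not_tower (u := v) (v := u) ?_ (fun x hx => ?_) s hs
      · rintro ⟨w, h1, h2⟩
        exact hns ⟨w, h2.dual, h1.dual⟩
      · exact ⟨(hS hx).2, (hS hx).1⟩
    let T : Set ((ℕ → β) × (ℕ → β)) := {p | StrictAnti p.1 ∧ StrictMono p.2 ∧
      (∀ n, p.1 n ∈ Zone d a) ∧ (∀ n, p.2 n ∈ Zone d a) ∧ ∃ n m, p.1 n ≤ p.2 m}
    have hT : T.Nonempty := ⟨(d, a), hd, ha,
      fun n => ⟨⟨n, le_rfl⟩, 0, (hd.antitone (Nat.zero_le n)).trans hda⟩,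
      fun n => ⟨⟨0, hda.trans (ha.monotone (Nat.zero_le n))⟩, n, le_rfl⟩, 0, 0, hda⟩
    obtain ⟨⟨d', a'⟩, ⟨hd', ha', hdZ, haZ, n, m, hnm⟩, hmin⟩ :=
      (hwd.prod_gameAdd hwa).has_min T hT
    simp only at hd' ha' hdZ haZ hnm
    have hsub : Zone (β := β) (fun i => d' (i + n)) (fun i => a' (i + m)) ⊆ Zone d a := by
      rintro x ⟨⟨i, hi⟩, j, hj⟩
      obtain ⟨⟨k, hk⟩, -⟩ := hdZ (i + n)
      obtain ⟨-, l, hl⟩ := haZ (j + m)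
      exact ⟨⟨k, hk.trans hi⟩, l, hj.trans hl⟩
    refine ⟨fun i => d' (i + n), fun i => a' (i + m), fun i j hij => hd' (by omega),
      fun i j hij => ha' (by omega), fun i => hSQ (hdZ _), fun i => hSQ (haZ _),
      by simpa using hnm, fun a'' hz hdef => ?_, fun d'' hz hdef => ?_⟩
    · have hdef' := Defect.of_shift ha' hdef
      obtain ⟨⟨i, hi⟩, -⟩ := hz 0
      exact hmin (d', a'') ⟨hd', hdef'.1, hdZ, fun k => hsub (hz k), _, _, hi⟩
        (Prod.GameAdd.snd ⟨hdef', fun k => hsub (hz k)⟩)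
    · have hdef' := Defect.of_shift (β := βᵒᵈ) (fun i j hij => hd' hij) hdef
      obtain ⟨-, i, hi⟩ := hz 0
      exact hmin (d'', a') ⟨fun i j hij => hdef'.1 hij, ha', fun k => hsub (hz k), haZ, _, _, hi⟩
        (Prod.GameAdd.fst ⟨hdef', fun k => hsub (hz k)⟩)
  · left
    push Not at hb
    have hwa : WellFounded (DefectIn Q) := by
      by_contra hcon
      obtain ⟨s, hs⟩ := h.fac.exists_tower hcon
      obtain ⟨j, -, hj⟩ := h.vac.exists_bridge hs 0
      exact hb _ (hs.mem _ _) _ (hs.mem _ _) hj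
    obtain ⟨a, ⟨ha, haQ⟩, hmin⟩ := hwa.has_min {a | StrictMono a ∧ ∀ n, a n ∈ Q} ⟨a0, ha0, ha0Q⟩
    exact ⟨a, ha, haQ, fun a' ha' hdef => hmin a' ⟨hdef.1, ha'⟩ ⟨hdef, ha'⟩⟩

end Sequences

section Cuts

variable {β τ : Type*} {D U : τ → Set β} {A B : Set τ}

/-- The order of cuts, where `D t` and `U t` are the lower and upper parts of the cut `t`. -/
def CutLE (D U : τ → Set β) (s t : τ) : Prop := D s ⊆ D t ∧ U t ⊆ U s

/-- Some point lies strictly between two cuts. -/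
def CutSep (D U : τ → Set β) (s t : τ) : Prop := ∃ z, z ∈ U s ∧ z ∈ D t

theorem CutLE.dual {s t : τ} (h : CutLE D U s t) : CutLE (β := βᵒᵈ) U D t s := ⟨h.2, h.1⟩

theorem CutSep.dual {s t : τ} (h : CutSep D U s t) : CutSep (β := βᵒᵈ) U D t s :=
  h.imp fun _ hz => hz.symm

/-- The points crossing no cut of `T`. -/
def Uncrossed (D U : τ → Set β) (T : Set τ) : Set β := {x | ∀ t ∈ T, x ∈ D t ∨ x ∈ U t}

theorem uncrossed_dual (D U : τ → Set β) (A B : Set τ) :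
    Uncrossed (β := βᵒᵈ) U D (B ∪ A) = Uncrossed D U (A ∪ B) := by
  ext x
  exact ⟨fun h t ht => (h t ht.symm).symm, fun h t ht => (h t ht.symm).symm⟩

/-- Lying on the same sides of all cuts of `T`. -/
def cutSetoid (D U : τ → Set β) (T : Set τ) : Setoid β where
  r x y := ∀ t ∈ T, (x ∈ D t ↔ y ∈ D t) ∧ (x ∈ U t ↔ y ∈ U t)
  iseqv := ⟨fun _ _ _ => ⟨Iff.rfl, Iff.rfl⟩, fun h t ht => ⟨(h t ht).1.symm, (h t ht).2.symm⟩,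
    fun h h' t ht => ⟨(h t ht).1.trans (h' t ht).1, (h t ht).2.trans (h' t ht).2⟩⟩

/-- The points on the same side as `x0` of all cuts of `T`. -/
def CutCell (D U : τ → Set β) (T : Set τ) (x0 : β) : Set β :=
  {y | ∀ t ∈ T, (x0 ∈ D t → y ∈ D t) ∧ (x0 ∈ U t → y ∈ U t)}

theorem cutCell_dual (D U : τ → Set β) (A B : Set τ) (x0 : β) :
    CutCell (β := βᵒᵈ) U D (B ∪ A) x0 = CutCell D U (A ∪ B) x0 := by
  ext x
  exact ⟨fun h t ht => (h t ht.symm).symm, fun h t ht => (h t ht.symm).symm⟩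

variable [PartialOrder β]

/-- The cut `t` is generated from below by a sequence that has no defects above the cuts of
some subfamily of `T`. -/
def UpCut (D U : τ → Set β) (T : Set τ) (t : τ) : Prop :=
  ∃ a, StrictMono a ∧ D t = Below a ∧ U t = Above a ∧
    ∃ L ⊆ T, (∀ l ∈ L, ∀ n, a n ∈ U l) ∧ ∀ a', (∀ l ∈ L, ∀ n, a' n ∈ U l) → ¬ Defect a' a

/-- A separated family of cuts: those in `A` are generated from below, those in `B` from above. -/
structure CutFamily (D U : τ → Set β) (A B : Set τ) : Prop where
  inj : ∀ s t, CutLE D U s t → CutLE D U t s → s = t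
  up : ∀ t ∈ A, UpCut D U (A ∪ B) t
  down : ∀ t ∈ B, UpCut (β := βᵒᵈ) U D (B ∪ A) t
  total : ∀ s ∈ A ∪ B, ∀ t ∈ A ∪ B, CutLE D U s t ∨ CutLE D U t s
  upSep : ∀ t ∈ A, ∀ s ∈ A ∪ B, CutLE D U s t → s ≠ t → CutSep D U s t
  downSep : ∀ t ∈ B, ∀ s ∈ A ∪ B, CutLE D U t s → s ≠ t → CutSep D U t s

theorem UpCut.mono {T T' : Set τ} {t : τ} (h : UpCut D U T t) (hT : T ⊆ T') : UpCut D U T' t := by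
  obtain ⟨a, h1, h2, h3, L, hL, h4⟩ := h
  exact ⟨a, h1, h2, h3, L, hL.trans hT, h4⟩

theorem CutFamily.dual (h : CutFamily D U A B) : CutFamily (β := βᵒᵈ) U D B A where
  inj s t h1 h2 := h.inj s t h2.dual h1.dual
  up := h.down
  down := h.up
  total s hs t ht := (h.total t ht.symm s hs.symm).imp CutLE.dual CutLE.dual
  upSep t ht s hs h1 h2 := (h.downSep t ht s hs.symm h1.dual h2).dual
  downSep t ht s hs h1 h2 := (h.upSep t ht s hs.symm h1.dual h2).dual

theorem UpCut.lower {T : Set τ} {t : τ} (h : UpCut D U T t) {x y : β} (hxy : x ≤ y)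
    (hy : y ∈ D t) : x ∈ D t := by
  obtain ⟨a, h1, h2, h3, -⟩ := h
  rw [h2] at hy ⊢
  exact hy.imp fun n hn => hxy.trans hn

theorem UpCut.upper {T : Set τ} {t : τ} (h : UpCut D U T t) {x y : β} (hxy : x ≤ y)
    (hx : x ∈ U t) : y ∈ U t := by
  obtain ⟨a, h1, h2, h3, -⟩ := h
  rw [h3] at hx ⊢
  exact fun n => (hx n).trans_le hxy

theorem UpCut.lt {T : Set τ} {t : τ} (h : UpCut D U T t) {x y : β} (hx : x ∈ D t)
    (hy : y ∈ U t) : x < y := by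
  obtain ⟨a, h1, h2, h3, -⟩ := h
  rw [h2] at hx
  rw [h3] at hy
  obtain ⟨n, hn⟩ := hx
  exact hn.trans_lt (hy n)

theorem CutFamily.lower (h : CutFamily D U A B) {t : τ} (ht : t ∈ A ∪ B) {x y : β} (hxy : x ≤ y)
    (hy : y ∈ D t) : x ∈ D t :=
  ht.elim (fun ht => (h.up t ht).lower hxy hy) fun ht => (h.down t ht).upper hxy hy

theorem CutFamily.upper (h : CutFamily D U A B) {t : τ} (ht : t ∈ A ∪ B) {x y : β} (hxy : x ≤ y)
    (hx : x ∈ U t) : y ∈ U t :=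
  ht.elim (fun ht => (h.up t ht).upper hxy hx) fun ht => (h.down t ht).lower hxy hx

theorem CutFamily.lt (h : CutFamily D U A B) {t : τ} (ht : t ∈ A ∪ B) {x y : β} (hx : x ∈ D t)
    (hy : y ∈ U t) : x < y :=
  ht.elim (fun ht => (h.up t ht).lt hx hy) fun ht => (h.down t ht).lt hy hx

theorem CutFamily.lt_or_lt (h : CutFamily D U A B) {x y : β} (hx : x ∈ Uncrossed D U (A ∪ B))
    (hy : y ∈ Uncrossed D U (A ∪ B)) (hxy : ¬ cutSetoid D U (A ∪ B) x y) : x < y ∨ y < x := by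
  have : ∃ t ∈ A ∪ B, ¬ ((x ∈ D t ↔ y ∈ D t) ∧ (x ∈ U t ↔ y ∈ U t)) := by
    by_contra hcon
    push Not at hcon
    exact hxy hcon
  obtain ⟨t, ht, hne⟩ := this
  rcases hx t ht with h1 | h1 <;> rcases hy t ht with h2 | h2
  · refine absurd ⟨iff_of_true h1 h2, iff_of_false (fun h3 => ?_) fun h3 => ?_⟩ hne
    · exact lt_irrefl _ (h.lt ht h1 h3)
    · exact lt_irrefl _ (h.lt ht h2 h3)
  · exact .inl (h.lt ht h1 h2)
  · exact .inr (h.lt ht h2 h1)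
  · refine absurd ⟨iff_of_false (fun h3 => ?_) fun h3 => ?_, iff_of_true h1 h2⟩ hne
    · exact lt_irrefl _ (h.lt ht h3 h1)
    · exact lt_irrefl _ (h.lt ht h3 h2)

/-- In a scattered order, between separated cuts there is an uncrossed point. -/
theorem CutFamily.exists_uncrossed (h : CutFamily D U A B) (hsc : Scattered β) {s t : τ}
    (hs : s ∈ A ∪ B) (ht : t ∈ A ∪ B) (hst : CutSep D U s t) :
    ∃ p ∈ Uncrossed D U (A ∪ B), p ∈ U s ∧ p ∈ D t := by
  by_contra hcon
  push Not at hcon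
  let I : Set τ := {r | r ∈ A ∪ B ∧ CutLE D U s r ∧ CutLE D U r t}
  have cross : ∀ s' ∈ I, ∀ t' ∈ I, CutSep D U s' t' →
      ∃ r ∈ I, CutLE D U s' r ∧ s' ≠ r ∧ CutLE D U r t' ∧ r ≠ t' := by
    rintro s' ⟨hs', hs1, hs2⟩ t' ⟨ht', ht1, ht2⟩ ⟨z, hz1, hz2⟩
    have hz : z ∉ Uncrossed D U (A ∪ B) := fun hz => hcon z hz (hs1.2 hz1) (ht2.1 hz2)
    have : ∃ r ∈ A ∪ B, ¬ (z ∈ D r ∨ z ∈ U r) := by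
      by_contra hc
      push Not at hc
      exact hz hc
    obtain ⟨r, hr, hzr⟩ := this
    have h1 : CutLE D U s' r := (h.total _ hs' _ hr).resolve_right fun h' => hzr (.inr (h'.2 hz1))
    have h2 : CutLE D U r t' := (h.total _ hr _ ht').resolve_right fun h' => hzr (.inl (h'.1 hz2))
    refine ⟨r, ⟨hr, ⟨hs1.1.trans h1.1, h1.2.trans hs1.2⟩, h2.1.trans ht2.1, ht2.2.trans h2.2⟩, h1,
      ?_, h2, ?_⟩
    · rintro rfl; exact hzr (.inr hz1)
    · rintro rfl; exact hzr (.inl hz2)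
  have split : ∀ s' ∈ I, ∀ t' ∈ I, CutSep D U s' t' →
      ∃ r ∈ I, CutSep D U s' r ∧ CutSep D U r t' := by
    intro s' hs' t' ht' hsep
    have left : ∀ {r r' : τ}, CutLE D U s' r → CutSep D U r r' → CutSep D U s' r' :=
      fun h1 ⟨z, hz, hz'⟩ => ⟨z, h1.2 hz, hz'⟩
    have right : ∀ {r r' : τ}, CutLE D U r' t' → CutSep D U r r' → CutSep D U r t' :=
      fun h1 ⟨z, hz, hz'⟩ => ⟨z, hz, h1.1 hz'⟩
    obtain ⟨r, hr, h1, h2, h3, h4⟩ := cross s' hs' t' ht' hsep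
    rcases hr.1 with hrA | hrB
    · have hsr := h.upSep r hrA s' hs'.1 h1 h2
      obtain ⟨r2, hr2, k1, k2, k3, k4⟩ := cross s' hs' r hr hsr
      rcases hr2.1 with hA | hB
      · exact ⟨r2, hr2, h.upSep _ hA _ hs'.1 k1 k2, right h3 (h.upSep _ hrA _ hr2.1 k3 k4)⟩
      · obtain ⟨r3, hr3, l1, l2, l3, l4⟩ :=
          cross r2 hr2 r hr (h.downSep _ hB _ hr.1 k3 (Ne.symm k4))
        exact ⟨r3, hr3, left k1 (h.downSep _ hB _ hr3.1 l1 (Ne.symm l2)),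
          right h3 (h.upSep _ hrA _ hr3.1 l3 l4)⟩
    · have hrt := h.downSep r hrB t' ht'.1 h3 (Ne.symm h4)
      obtain ⟨r2, hr2, k1, k2, k3, k4⟩ := cross r hr t' ht' hrt
      rcases hr2.1 with hA | hB
      · obtain ⟨r3, hr3, l1, l2, l3, l4⟩ := cross r hr r2 hr2 (h.upSep _ hA _ hr.1 k1 k2)
        exact ⟨r3, hr3, left h1 (h.downSep _ hrB _ hr3.1 l1 (Ne.symm l2)),
          right k3 (h.upSep _ hA _ hr3.1 l3 l4)⟩
      · exact ⟨r2, hr2, left h1 (h.downSep _ hrB _ hr2.1 k1 (Ne.symm k2)),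
          h.downSep _ hB _ ht'.1 k3 (Ne.symm k4)⟩
  have hle : CutLE D U s t := by
    refine (h.total s hs t ht).elim id fun h' => ?_
    obtain ⟨z, h1, h2⟩ := hst
    exact absurd (h.lt hs (h'.1 h2) h1) (lt_irrefl z)
  have hsI : s ∈ I := ⟨hs, ⟨Set.Subset.rfl, Set.Subset.rfl⟩, hle⟩
  have htI : t ∈ I := ⟨ht, hle, ⟨Set.Subset.rfl, Set.Subset.rfl⟩⟩
  obtain ⟨r, hr, hsr, y, hy, -⟩ := split s hsI t htI hst
  obtain ⟨r1, hr1, ⟨x, -, hx⟩, hr1r⟩ := split s hsI r hr hsr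
  refine hsc (fun x y => ∃ s' ∈ I, ∃ t' ∈ I, CutSep D U s' t' ∧ x ∈ D s' ∧ y ∈ U t') ?_ ?_ x y
    ⟨r1, hr1, r, hr, hr1r, hx, hy⟩
  · rintro x y ⟨s', hs', t', ht', ⟨z, hz, hz'⟩, hx, hy⟩
    exact (h.lt hs'.1 hx hz).trans (h.lt ht'.1 hz' hy)
  · rintro x y ⟨s', hs', t', ht', hsep, hx, hy⟩
    obtain ⟨r, hr, h1, h2⟩ := split s' hs' t' ht' hsep
    obtain ⟨r1, hr1, h3, w, hw, hw'⟩ := split s' hs' r hr h1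
    exact ⟨w, ⟨s', hs', r1, hr1, h3, hx, hw⟩, r, hr, t', ht', h2, hw', hy⟩

theorem SpineOn.not_lt_apply {S : Set β} {f : β → β} (hf : SpineOn S f) {y : β} (hy : y ∈ S) :
    ¬ y < f y := fun h => hf.ne y hy _ (hf.maps y hy) h (hf.idem y hy).symm

theorem CutFamily.infinite_fibres_of_up (h : CutFamily D U A B) (hfac : FAC β)
    (hsc : Scattered β) {f : β → β} (hf : SpineOn (Uncrossed D U (A ∪ B)) f)
    (hr : ∀ y ∈ Uncrossed D U (A ∪ B), cutSetoid D U (A ∪ B) y (f y)) {t : τ} (ht : t ∈ A)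
    {x : β} (hxD : x ∉ D t) (hxU : x ∉ U t) :
    {c | c ∈ f '' Uncrossed D U (A ∪ B) ∧
      ∀ y ∈ Uncrossed D U (A ∪ B), f y = c → Incomp x y}.Infinite := by
  set P := Uncrossed D U (A ∪ B) with hP
  have htT : t ∈ A ∪ B := .inl ht
  obtain ⟨a, ha, hDa, hUa, L, hLT, hLa, hnice⟩ := h.up t ht
  have haD : ∀ n, a n ∈ D t := fun n => by rw [hDa]; exact ⟨n, le_rfl⟩
  have cofinal : ∀ y : ℕ → β, (∀ n, y n ∈ D t) → (∀ l ∈ L, ∀ n, y n ∈ U l) →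
      (∀ n, ¬ y n ≤ a n) → ∃ φ : ℕ → ℕ, StrictMono (y ∘ φ) ∧ ∀ m, ∃ n, a m ≤ y (φ n) := by
    intro y hy hyL hya
    obtain ⟨φ, hφ, hyφ⟩ := hfac.exists_strictMono_of_not_le ha (fun n => hDa ▸ hy n) hya
    refine ⟨φ, hyφ, ?_⟩
    by_contra hcon
    push Not at hcon
    refine hnice (y ∘ φ) (fun l hl n => hyL l hl _) ⟨hyφ, fun n => ?_, fun m => ⟨m, fun hm => ?_⟩,
      hcon⟩
    · have := hy (φ n); rw [hDa] at this; exact this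
    · exact hya _ (hm.trans (ha.monotone (hφ.id_le m)))
  have key : ∀ n, ∃ c ∈ P, f c = c ∧ c ∈ D t ∧ ¬ c ≤ a n ∧
      ∀ y ∈ P, f y = c → y ∈ D t ∧ ∀ l ∈ L, y ∈ U l := by
    intro n
    by_cases hV : ∃ z ∈ D t, ∀ s ∈ A ∪ B, CutLE D U s t → s ≠ t → z ∈ U s
    · obtain ⟨z, hz, hzV⟩ := hV
      rw [hDa] at hz
      obtain ⟨k, hk⟩ := hz
      have hmP : a (max n k + 1) ∈ P := by
        intro s hs
        have hza : z ≤ a (max n k + 1) := hk.trans (ha.monotone (by omega))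
        by_cases hst : s = t
        · exact .inl (hst ▸ haD _)
        rcases h.total s hs t htT with h1 | h1
        · exact .inr (h.upper hs hza (hzV s hs h1 hst))
        · exact .inl (h1.1 (haD _))
      have hr' := hr _ hmP
      refine ⟨f (a (max n k + 1)), hf.maps _ hmP, hf.idem _ hmP, (hr' t htT).1.1 (haD _),
        fun hle => ?_, fun y hy hyc => ⟨?_, fun l hl => ?_⟩⟩
      · exact hf.ne _ (hf.maps _ hmP) _ hmP (hle.trans_lt (ha (by omega))) (hf.idem _ hmP)
      · exact (hr y hy t htT).1.2 (hyc ▸ (hr' t htT).1.1 (haD _))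
      · exact (hr y hy l (hLT hl)).2.2 (hyc ▸ (hr' l (hLT hl)).2.1 (hLa l hl _))
    · push Not at hV
      obtain ⟨s, hs, hst, hne, hsa⟩ := hV (a n) (haD n)
      obtain ⟨p, hp, hps, hpt⟩ := h.exists_uncrossed hsc hs htT (h.upSep t ht s hs hst hne)
      have hr' := hr _ hp
      have hcs := (hr' s hs).2.1 hps
      refine ⟨f p, hf.maps _ hp, hf.idem _ hp, (hr' t htT).1.1 hpt, fun hle => ?_,
        fun y hy hyc => ⟨?_, fun l hl => ?_⟩⟩
      · exact hsa (h.upper hs hle hcs)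
      · exact (hr y hy t htT).1.2 (hyc ▸ (hr' t htT).1.1 hpt)
      · have hys : y ∈ U s := (hr y hy s hs).2.2 (hyc ▸ hcs)
        rcases h.total l (hLT hl) s hs with h1 | h1
        · exact h1.2 hys
        · exact absurd (h1.2 (hLa l hl n)) hsa
  choose c hcP hcf hcD hca hcy using key
  obtain ⟨φ, hφ, hcof⟩ := cofinal c hcD
    (fun l hl n => (hcy n (c n) (hcP n) (hcf n)).2 l hl) hca
  intro hfin
  have hex : ∃ N, ∀ n ≥ N, ∃ y ∈ P, f y = c (φ n) ∧ ¬ Incomp x y := by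
    obtain ⟨N, hN⟩ := (hfin.preimage hφ.injective.injOn).bddAbove
    refine ⟨N + 1, fun n hn => ?_⟩
    by_contra hcon
    push Not at hcon
    have : n ≤ N := hN ⟨⟨_, hcP _, hcf _⟩, hcon⟩
    omega
  obtain ⟨N, hN⟩ := hex
  have hy : ∀ n, ∃ y, y ∈ D t ∧ (∀ l ∈ L, y ∈ U l) ∧ ¬ y ≤ a n ∧ y ≤ x := by
    intro n
    obtain ⟨k, hk⟩ := hcof n
    obtain ⟨y, hyP, hfy, hxy⟩ := hN (max N (k + 1)) (le_max_left _ _)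
    obtain ⟨h1, h2⟩ := hcy _ y hyP hfy
    refine ⟨y, h1, h2, fun hya => hf.not_lt_apply hyP ?_, ?_⟩
    · rw [hfy]
      exact (hya.trans hk).trans_lt (hφ (by omega))
    · by_contra hyx
      exact hxy ⟨fun hle => hxD (h.lower htT hle h1), hyx⟩
  choose y hyD hyL hya hyx using hy
  obtain ⟨ψ, -, hψ⟩ := cofinal y hyD (fun l hl n => hyL n l hl) hya
  refine hxU ?_
  rw [hUa]
  intro n
  obtain ⟨k, hk⟩ := hψ (n + 1)
  exact (ha (Nat.lt_succ_self n)).trans_le (hk.trans (hyx _))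

theorem CutFamily.ordConnected_cutCell (h : CutFamily D U A B) (x0 : β) :
    (CutCell D U (A ∪ B) x0).OrdConnected :=
  ⟨fun _ hx _ hy _ hz t ht =>
    ⟨fun h0 => h.lower ht hz.2 ((hy t ht).1 h0), fun h0 => h.upper ht hz.1 ((hx t ht).2 h0)⟩⟩

/-- The cut `t` is generated from below by a sequence in `Q`. -/
def GenIn (D U : τ → Set β) (Q : Set β) (t : τ) : Prop :=
  ∃ a, StrictMono a ∧ (∀ n, a n ∈ Q) ∧ D t = Below a ∧ U t = Above a

theorem GenIn.mono {Q Q' : Set β} {t : τ} (h : GenIn D U Q t) (hQ : Q ⊆ Q') : GenIn D U Q' t := by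
  obtain ⟨a, h1, h2, h3⟩ := h
  exact ⟨a, h1, fun n => hQ (h2 n), h3⟩

theorem CutFamily.le_of_genIn (h : CutFamily D U A B) {x0 : β} {s t : τ}
    (hs : GenIn D U (CutCell D U (A ∪ B) x0) s) (ht : t ∈ A ∪ B) :
    (x0 ∈ U t → CutLE D U t s) ∧ (x0 ∈ D t → CutLE D U s t) := by
  obtain ⟨a, ha, haQ, hDa, hUa⟩ := hs
  rw [CutLE, CutLE, hDa, hUa]
  refine ⟨fun h0 => ⟨fun y hy => ⟨0, (h.lt ht hy ((haQ 0 t ht).2 h0)).le⟩,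
    fun z hz => h.upper ht (hz 0).le ((haQ 0 t ht).2 h0)⟩, fun h0 => ⟨?_, ?_⟩⟩
  · rintro y ⟨n, hn⟩
    exact h.lower ht hn ((haQ n t ht).1 h0)
  · exact fun z hz n => h.lt ht ((haQ n t ht).1 h0) hz

theorem CutFamily.le_of_genIn_dual (h : CutFamily D U A B) {x0 : β} {s t : τ}
    (hs : GenIn (β := βᵒᵈ) U D (CutCell D U (A ∪ B) x0) s) (ht : t ∈ A ∪ B) :
    (x0 ∈ U t → CutLE D U t s) ∧ (x0 ∈ D t → CutLE D U s t) := by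
  have := h.dual.le_of_genIn (hs.mono (cutCell_dual D U A B x0).ge) ht.symm
  exact ⟨fun h0 => (this.2 h0).dual, fun h0 => (this.1 h0).dual⟩

theorem CutFamily.upSep_insert (h : CutFamily D U A B) {x0 : β}
    (hx0 : x0 ∈ Uncrossed D U (A ∪ B)) {A1 B1 : Set τ}
    (hA1 : ∀ t ∈ A1, GenIn D U (CutCell D U (A ∪ B) x0) t)
    (hB1 : ∀ t ∈ B1, GenIn (β := βᵒᵈ) U D (CutCell D U (A ∪ B) x0) t)
    (hsep : ∀ t ∈ A1, ∀ s ∈ A1 ∪ B1, s ≠ t → CutSep D U s t) :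
    ∀ t ∈ A ∪ A1, ∀ s ∈ (A ∪ A1) ∪ (B ∪ B1), CutLE D U s t → s ≠ t → CutSep D U s t := by
  intro t ht s hs hle hne
  have hs' : s ∈ A ∪ B ∨ s ∈ A1 ∪ B1 := by
    rcases hs with (h | h) | (h | h)
    exacts [.inl (.inl h), .inr (.inl h), .inl (.inr h), .inr (.inr h)]
  rcases ht with ht | ht
  · rcases hs' with hs | hs
    · exact h.upSep t ht s hs hle hne
    have htT : t ∈ A ∪ B := .inl ht
    have h0 : x0 ∈ D t := by
      refine (hx0 t htT).resolve_right fun h0 => hne (h.inj _ _ hle ?_)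
      rcases hs with hs | hs
      · exact (h.le_of_genIn (hA1 s hs) htT).1 h0
      · exact (h.le_of_genIn_dual (hB1 s hs) htT).1 h0
    rcases hs with hs | hs
    · obtain ⟨a, ha, haQ, hDa, hUa⟩ := hA1 s hs
      obtain ⟨b, hb, hDb, hUb, L, hLT, hLb, hnice⟩ := h.up t ht
      by_cases hbd : ∃ m, ∀ n, a n ≤ b m
      · obtain ⟨m, hm⟩ := hbd
        refine ⟨b (m + 1), ?_, ?_⟩
        · rw [hUa]; exact fun n => (hm n).trans_lt (hb (Nat.lt_succ_self m))
        · rw [hDb]; exact ⟨m + 1, le_rfl⟩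
      · have hbel : ∀ n, a n ∈ Below b := fun n => hDb ▸ (haQ n t htT).1 h0
        exfalso
        push Not at hbd
        refine hnice a (fun l hl n => ?_) ⟨ha, hbel, hbd, ?_⟩
        · refine (haQ n l (hLT hl)).2 ((hx0 l (hLT hl)).resolve_left fun h1 => ?_)
          obtain ⟨n, hn⟩ := hbd 0
          exact hn (h.lt (hLT hl) ((haQ n l (hLT hl)).1 h1) (hLb l hl 0)).le
        · by_contra hcon
          push Not at hcon
          refine hne (h.inj _ _ hle ⟨?_, ?_⟩)
          · rw [hDa, hDb]
            rintro y ⟨m, hm⟩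
            obtain ⟨n, hn⟩ := hcon m
            exact ⟨n, hm.trans hn⟩
          · rw [hUa, hUb]
            intro z hz m
            obtain ⟨n, hn⟩ := hcon m
            exact hn.trans_lt (hz n)
    · obtain ⟨d, hd, hdQ, hUd, -⟩ := hB1 s hs
      exact ⟨d 0, by rw [hUd]; exact ⟨0, le_rfl⟩, (hdQ 0 t htT).1 h0⟩
  · rcases hs' with hs | hs
    · have h0 : x0 ∈ U s := (hx0 s hs).resolve_left fun h0 =>
        hne (h.inj _ _ hle ((h.le_of_genIn (hA1 t ht) hs).2 h0))
      obtain ⟨a, ha, haQ, hDa, hUa⟩ := hA1 t ht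
      exact ⟨a 0, (haQ 0 s hs).2 h0, by rw [hDa]; exact ⟨0, le_rfl⟩⟩
    · exact hsep t ht s hs hne

/-- Cuts generated within a cell of a family can be added to the family. -/
theorem CutFamily.insert (h : CutFamily D U A B) {x0 : β}
    (hx0 : x0 ∈ Uncrossed D U (A ∪ B)) {A1 B1 : Set τ}
    (hA1 : ∀ t ∈ A1, GenIn D U (CutCell D U (A ∪ B) x0) t)
    (hB1 : ∀ t ∈ B1, GenIn (β := βᵒᵈ) U D (CutCell D U (A ∪ B) x0) t)
    (hup : ∀ t ∈ A1, UpCut D U ((A ∪ A1) ∪ (B ∪ B1)) t)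
    (hdown : ∀ t ∈ B1, UpCut (β := βᵒᵈ) U D ((B ∪ B1) ∪ (A ∪ A1)) t)
    (htot : ∀ s ∈ A1 ∪ B1, ∀ t ∈ A1 ∪ B1, CutLE D U s t ∨ CutLE D U t s)
    (hupSep : ∀ t ∈ A1, ∀ s ∈ A1 ∪ B1, s ≠ t → CutSep D U s t)
    (hdownSep : ∀ t ∈ B1, ∀ s ∈ A1 ∪ B1, s ≠ t → CutSep D U t s) :
    CutFamily D U (A ∪ A1) (B ∪ B1) where
  inj := h.inj
  up t ht := ht.elim (fun ht => (h.up t ht).mono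
    (Set.union_subset_union Set.subset_union_left Set.subset_union_left)) (hup t)
  down t ht := ht.elim (fun ht => (h.down t ht).mono
    (Set.union_subset_union Set.subset_union_left Set.subset_union_left)) (hdown t)
  total := by
    have hs' : ∀ s ∈ (A ∪ A1) ∪ (B ∪ B1), s ∈ A ∪ B ∨ s ∈ A1 ∪ B1 := by
      rintro s ((h | h) | (h | h))
      exacts [.inl (.inl h), .inr (.inl h), .inl (.inr h), .inr (.inr h)]
    have mixed : ∀ s ∈ A ∪ B, ∀ t ∈ A1 ∪ B1, CutLE D U s t ∨ CutLE D U t s := by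
      intro s hs t ht
      have : (x0 ∈ U s → CutLE D U s t) ∧ (x0 ∈ D s → CutLE D U t s) :=
        ht.elim (fun ht => h.le_of_genIn (hA1 t ht) hs)
          fun ht => h.le_of_genIn_dual (hB1 t ht) hs
      exact (hx0 s hs).symm.imp this.1 this.2
    intro s hs t ht
    rcases hs' s hs with hs | hs <;> rcases hs' t ht with ht | ht
    · exact h.total s hs t ht
    · exact mixed s hs t ht
    · exact (mixed t ht s hs).symm
    · exact htot s hs t ht
  upSep := h.upSep_insert hx0 hA1 hB1 hupSep
  downSep := by
    rw [← uncrossed_dual] at hx0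
    intro t ht s hs hle hne
    exact (h.dual.upSep_insert hx0
      (fun t ht => (hB1 t ht).mono (cutCell_dual D U A B x0).ge)
      (fun t ht => (hA1 t ht).mono (cutCell_dual D U A B x0).ge)
      (fun t ht s hs hne => (hdownSep t ht s hs.symm hne).dual) t ht s hs.symm hle.dual hne).dual

/-- A maximal separated family of cuts. -/
def MaxCutFamily (D U : τ → Set β) (A B : Set τ) : Prop :=
  CutFamily D U A B ∧ ∀ A' B', CutFamily D U (A ∪ A') (B ∪ B') → A' ⊆ A ∧ B' ⊆ B

theorem MaxCutFamily.dual (h : MaxCutFamily D U A B) : MaxCutFamily (β := βᵒᵈ) U D B A :=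
  ⟨h.1.dual, fun B' A' h' => (h.2 A' B' h'.dual).symm⟩

theorem MaxCutFamily.mem_of_nice (h : MaxCutFamily D U A B) {x0 : β}
    (hx0 : x0 ∈ Uncrossed D U (A ∪ B)) {a0 a : ℕ → β} (ha : StrictMono a)
    (haQ : ∀ n, a n ∈ CutCell D U (A ∪ B) x0 ∩ Below a0)
    (hnice : ∀ a', (∀ n, a' n ∈ CutCell D U (A ∪ B) x0 ∩ Below a0) → ¬ Defect a' a)
    {t : τ} (hD : D t = Below a) (hU : U t = Above a) : t ∈ A := by
  have hins : CutFamily D U (A ∪ {t}) (B ∪ ∅) := by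
    refine h.1.insert hx0 ?_ (by simp) ?_ (by simp) ?_ ?_ (by simp)
    · rintro _ rfl
      exact ⟨a, ha, fun n => (haQ n).1, hD, hU⟩
    · rintro _ rfl
      refine ⟨a, ha, hD, hU, {l | l ∈ A ∪ B ∧ x0 ∈ U l},
        fun l hl => hl.1.imp .inl .inl, fun l hl n => ((haQ n).1 l hl.1).2 hl.2, ?_⟩
      refine fun a' ha' hdef => hnice a' (fun n => ?_) hdef
      obtain ⟨m, hm⟩ := hdef.2.1 n
      obtain ⟨k, hk⟩ := (haQ m).2
      exact ⟨fun s hs => ⟨fun h0 => h.1.lower hs hm (((haQ m).1 s hs).1 h0),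
        fun h0 => ha' s ⟨hs, h0⟩ n⟩, k, hm.trans hk⟩
    · rintro s hs t' ht'
      simp only [Set.union_empty, Set.mem_singleton_iff] at hs ht'
      subst hs ht'
      exact .inl ⟨Set.Subset.rfl, Set.Subset.rfl⟩
    · rintro t' rfl s hs hne
      simp at hs
      exact absurd hs hne
  exact (h.2 _ _ hins).1 rfl

theorem MaxCutFamily.mem_of_mutualPair (h : MaxCutFamily D U A B) {x0 : β}
    (hx0 : x0 ∈ Uncrossed D U (A ∪ B)) {d a : ℕ → β}
    (hp : MutualPair (CutCell D U (A ∪ B) x0) d a) {s t : τ}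
    (hDs : D s = Above (β := βᵒᵈ) d) (hUs : U s = Below (β := βᵒᵈ) d)
    (hD : D t = Below a) (hU : U t = Above a) : t ∈ A := by
  have hsep : CutSep D U s t :=
    ⟨d 0, by rw [hUs]; exact ⟨0, le_rfl⟩, by rw [hD]; exact ⟨0, hp.le⟩⟩
  have hle : CutLE D U s t := by
    rw [CutLE, hDs, hUs, hD, hU]
    exact ⟨fun y hy => ⟨0, (show y < d 0 from hy 0).le.trans hp.le⟩,
      fun z hz => ⟨0, (show d 0 ≤ z from hp.le.trans (hz 0).le)⟩⟩
  have hins : CutFamily D U (A ∪ {t}) (B ∪ {s}) := by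
    refine h.1.insert hx0 ?_ ?_ ?_ ?_ ?_ ?_ ?_
    · rintro _ rfl
      exact ⟨a, hp.mono, hp.amem, hD, hU⟩
    · rintro _ rfl
      exact ⟨d, fun _ _ hmn => hp.anti hmn, hp.dmem, hUs, hDs⟩
    · rintro _ rfl
      refine ⟨a, hp.mono, hD, hU, {s}, ?_, ?_, ?_⟩
      · rintro _ rfl; exact .inr (.inr rfl)
      · rintro _ rfl n
        rw [hUs]
        exact ⟨0, (show d 0 ≤ a n from hp.le.trans (hp.mono.monotone (Nat.zero_le n)))⟩
      · intro a' ha' hdef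
        refine hp.adef a' (fun n => ⟨?_, hdef.2.1 n⟩) hdef
        have := ha' s rfl n
        rw [hUs] at this
        exact this
    · rintro _ rfl
      refine ⟨d, fun _ _ hmn => hp.anti hmn, hUs, hDs, {t}, ?_, ?_, ?_⟩
      · rintro _ rfl; exact .inr (.inr rfl)
      · rintro _ rfl n
        rw [hD]
        exact ⟨0, (show d n ≤ a 0 from (hp.anti.antitone (Nat.zero_le n)).trans hp.le)⟩
      · intro d' hd' hdef
        refine hp.ddef d' (fun n => ⟨hdef.2.1 n, ?_⟩) hdef
        have := hd' t rfl n
        rw [hD] at this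
        exact this
    · rintro _ (rfl | rfl) _ (rfl | rfl)
      · exact .inl ⟨Set.Subset.rfl, Set.Subset.rfl⟩
      · exact .inr hle
      · exact .inl hle
      · exact .inl ⟨Set.Subset.rfl, Set.Subset.rfl⟩
    · rintro _ rfl _ (rfl | rfl) hne
      · exact absurd rfl hne
      · exact hsep
    · rintro _ rfl _ (rfl | rfl) hne
      · exact hsep
      · exact absurd rfl hne
  exact (h.2 _ _ hins).1 rfl

theorem MaxCutFamily.exists_not_incomp (h : MaxCutFamily D U A B) (hβ : Tame β)
    (hsurj : ∀ p q, ∃ t, D t = p ∧ U t = q) {x0 x : β}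
    (hx0 : x0 ∈ Uncrossed D U (A ∪ B)) (hx : x ∈ CutCell D U (A ∪ B) x0) {a0 : ℕ → β}
    (ha0 : StrictMono a0) (ha0Q : ∀ n, a0 n ∈ CutCell D U (A ∪ B) x0) :
    ∃ n, ¬ Incomp x (a0 n) := by
  have hconn : (CutCell D U (A ∪ B) x0 ∩ Below a0).OrdConnected := by
    refine ⟨fun y hy z hz w hw => ⟨(h.1.ordConnected_cutCell x0).out hy.1 hz.1 hw, ?_⟩⟩
    obtain ⟨n, hn⟩ := hz.2
    exact ⟨n, hw.2.trans hn⟩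
  obtain ⟨a, haQ, t, htA, hD⟩ : ∃ a : ℕ → β,
      (∀ n, a n ∈ CutCell D U (A ∪ B) x0 ∩ Below a0) ∧ ∃ t ∈ A, D t = Below a := by
    rcases hβ.exists_nice hconn ha0 (fun n => ⟨ha0Q n, n, le_rfl⟩) with
      ⟨a, ha, haQ, hnice⟩ | ⟨d, a, hp⟩
    · obtain ⟨t, hD, hU⟩ := hsurj (Below a) (Above a)
      exact ⟨a, haQ, t, h.mem_of_nice hx0 ha haQ hnice hD hU, hD⟩
    · obtain ⟨t, hD, hU⟩ := hsurj (Below a) (Above a)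
      obtain ⟨s, hDs, hUs⟩ := hsurj (Above (β := βᵒᵈ) d) (Below (β := βᵒᵈ) d)
      refine ⟨a, hp.amem, t, h.mem_of_mutualPair hx0 (d := d) (a := a) ?_ hDs hUs hD hU, hD⟩
      exact ⟨hp.anti, hp.mono, fun n => (hp.dmem n).1, fun n => (hp.amem n).1, hp.le, hp.adef,
        hp.ddef⟩
  have ht : t ∈ A ∪ B := .inl htA
  have ha : a 0 ∈ D t := by rw [hD]; exact ⟨0, le_rfl⟩
  have h0 : x0 ∈ D t := (hx0 t ht).resolve_right fun h0 =>
    lt_irrefl _ (h.1.lt ht ha (((haQ 0).1 t ht).2 h0))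
  have hxD := (hx t ht).1 h0
  rw [hD] at hxD
  obtain ⟨n, hn⟩ := hxD
  obtain ⟨m, hm⟩ := (haQ n).2
  exact ⟨m, fun hinc => hinc.1 (hn.trans hm)⟩

theorem MaxCutFamily.finite_incomp (h : MaxCutFamily D U A B) (hβ : Tame β)
    (hsurj : ∀ p q, ∃ t, D t = p ∧ U t = q) {x0 x : β}
    (hx0 : x0 ∈ Uncrossed D U (A ∪ B)) (hx : x ∈ CutCell D U (A ∪ B) x0) :
    {y | y ∈ CutCell D U (A ∪ B) x0 ∧ Incomp x y}.Finite := by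
  by_contra hinf
  let y := (Set.Infinite.natEmbedding _ hinf)
  have hy : ∀ n, (y n : β) ∈ CutCell D U (A ∪ B) x0 ∧ Incomp x (y n : β) := fun n => (y n).2
  obtain ⟨φ, hφ, hmono | hanti⟩ := hβ.fac.exists_strictMono_or_antitone (fun n => (y n : β))
  · obtain ⟨n, hn⟩ := h.exists_not_incomp hβ hsurj hx0 hx hmono fun n => (hy _).1
    exact hn (hy _).2
  · have hanti' : StrictAnti ((fun n => (y n : β)) ∘ φ) :=
      hanti.strictAnti_of_injective
        ((Subtype.val_injective.comp y.injective).comp hφ.injective)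
    rw [← uncrossed_dual] at hx0
    obtain ⟨n, hn⟩ := h.dual.exists_not_incomp hβ.dual
      (fun p q => (hsurj q p).imp fun _ h => h.symm) hx0 (by rw [cutCell_dual]; exact hx)
      (a0 := (fun n => (y n : β)) ∘ φ) (fun _ _ hmn => hanti' hmn)
      (fun n => by rw [cutCell_dual]; exact (hy _).1)
    exact hn (hy _).2.symm

theorem exists_maxCutFamily (β : Type*) [PartialOrder β] :
    ∃ A B : Set (Set β × Set β), MaxCutFamily Prod.fst Prod.snd A B := by
  obtain ⟨⟨A, B⟩, hmax⟩ := zorn_le₀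
    {p : Set (Set β × Set β) × Set (Set β × Set β) | CutFamily Prod.fst Prod.snd p.1 p.2} (by
    intro c hc hch
    refine ⟨(⋃ p ∈ c, p.1, ⋃ p ∈ c, p.2), ?_, fun p hp =>
      ⟨Set.subset_biUnion_of_mem (u := fun p => p.1) hp,
        Set.subset_biUnion_of_mem (u := fun p => p.2) hp⟩⟩
    have hsub : ∀ p ∈ c, p.1 ∪ p.2 ⊆ (⋃ p ∈ c, p.1) ∪ ⋃ p ∈ c, p.2 := fun p hp =>
      Set.union_subset_union (Set.subset_biUnion_of_mem (u := fun p => p.1) hp)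
        (Set.subset_biUnion_of_mem (u := fun p => p.2) hp)
    have hex : ∀ s ∈ (⋃ p ∈ c, p.1) ∪ ⋃ p ∈ c, p.2, ∃ p ∈ c, s ∈ p.1 ∪ p.2 := by
      rintro s (hs | hs) <;> simp only [Set.mem_iUnion] at hs <;> obtain ⟨p, hp, hs⟩ := hs
      exacts [⟨p, hp, .inl hs⟩, ⟨p, hp, .inr hs⟩]
    have hle : ∀ p ∈ c, ∀ q ∈ c, ∃ r ∈ c, p ≤ r ∧ q ≤ r := fun p hp q hq =>
      (hch.total hp hq).elim (fun h => ⟨q, hq, h, le_rfl⟩) fun h => ⟨p, hp, le_rfl, h⟩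
    constructor
    · exact fun s t h1 h2 => Prod.ext (h1.1.antisymm h2.1) (h2.2.antisymm h1.2)
    · intro t ht
      simp only [Set.mem_iUnion] at ht
      obtain ⟨p, hp, ht⟩ := ht
      exact ((hc hp).up t ht).mono (hsub p hp)
    · intro t ht
      simp only [Set.mem_iUnion] at ht
      obtain ⟨p, hp, ht⟩ := ht
      refine ((hc hp).down t ht).mono ?_
      rw [Set.union_comm, Set.union_comm (⋃ p ∈ c, p.2)]
      exact hsub p hp
    · intro s hs t ht
      obtain ⟨p, hp, hs⟩ := hex s hs
      obtain ⟨q, hq, ht⟩ := hex t ht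
      obtain ⟨r, hr, hpr, hqr⟩ := hle p hp q hq
      exact (hc hr).total s (Set.union_subset_union hpr.1 hpr.2 hs) t
        (Set.union_subset_union hqr.1 hqr.2 ht)
    · intro t ht s hs hst hne
      simp only [Set.mem_iUnion] at ht
      obtain ⟨p, hp, ht⟩ := ht
      obtain ⟨q, hq, hs⟩ := hex s hs
      obtain ⟨r, hr, hpr, hqr⟩ := hle p hp q hq
      exact (hc hr).upSep t (hpr.1 ht) s (Set.union_subset_union hqr.1 hqr.2 hs) hst hne
    · intro t ht s hs hst hne
      simp only [Set.mem_iUnion] at ht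
      obtain ⟨p, hp, ht⟩ := ht
      obtain ⟨q, hq, hs⟩ := hex s hs
      obtain ⟨r, hr, hpr, hqr⟩ := hle p hp q hq
      exact (hc hr).downSep t (hpr.2 ht) s (Set.union_subset_union hqr.1 hqr.2 hs) hst hne)
  refine ⟨A, B, hmax.prop, fun A' B' h' => ?_⟩
  have := hmax.le_of_ge (y := (A ∪ A', B ∪ B')) h' ⟨Set.subset_union_left, Set.subset_union_left⟩
  exact ⟨Set.subset_union_right.trans this.1, Set.subset_union_right.trans this.2⟩

theorem Tame.exists_spineOn_univ [Countable β] (hβ : Tame β) :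
    ∃ f : β → β, SpineOn Set.univ f := by
  obtain ⟨A, B, h⟩ := exists_maxCutFamily β
  have hsurj : ∀ p q : Set β, ∃ t : Set β × Set β, t.1 = p ∧ t.2 = q := fun p q =>
    ⟨(p, q), rfl, rfl⟩
  obtain ⟨f, hf, hr⟩ := exists_spineOn_of_classes (cutSetoid Prod.fst Prod.snd (A ∪ B))
    (Q := Uncrossed Prod.fst Prod.snd (A ∪ B)) (fun x hx y hy hxy => h.1.lt_or_lt hx hy hxy) (by
      intro x0 hx0
      have hsub : {y | y ∈ Uncrossed Prod.fst Prod.snd (A ∪ B) ∧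
          cutSetoid Prod.fst Prod.snd (A ∪ B) x0 y} ⊆
          CutCell Prod.fst Prod.snd (A ∪ B) x0 :=
        fun y hy t ht => ⟨(hy.2 t ht).1.1, (hy.2 t ht).2.1⟩
      exact exists_spineOn_of_finite_incomp fun x hx =>
        (h.finite_incomp hβ hsurj hx0 (hsub hx)).subset fun y hy => ⟨hsub hy.1, hy.2⟩)
  refine hf.exists_extend (Set.subset_univ _) fun x _ hx => ?_
  have : ∃ t ∈ A ∪ B, ¬ (x ∈ t.1 ∨ x ∈ t.2) := by
    by_contra hc
    push Not at hc
    exact hx hc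
  obtain ⟨t, ht | ht, hxt⟩ := this
  · exact h.1.infinite_fibres_of_up hβ.fac hβ.scattered hf hr ht (fun h => hxt (.inl h))
      fun h => hxt (.inr h)
  · have hf' : SpineOn (α := βᵒᵈ) (Uncrossed (β := βᵒᵈ) Prod.snd Prod.fst (B ∪ A)) f := by
      exact hf.dual (uncrossed_dual Prod.fst Prod.snd A B)
    have := h.1.dual.infinite_fibres_of_up hβ.fac.dual hβ.scattered.dual hf' (fun y hy t ht => by
      rw [uncrossed_dual] at hy
      exact (hr y hy t ht.symm).symm) ht (fun h => hxt (.inr h)) fun h => hxt (.inl h)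
    rw [uncrossed_dual] at this
    exact this.mono fun c hc => ⟨hc.1, fun y hy hyc => (hc.2 y hy hyc).symm⟩

end Cuts

section DenseReduction

variable {α : Type*} [PartialOrder α]

/-- The largest dense relation contained in the strict order. -/
def DenseLT (x y : α) : Prop :=
  ∃ R : α → α → Prop, (∀ x y, R x y → x < y) ∧ (∀ x y, R x y → ∃ z, R x z ∧ R z y) ∧ R x y

theorem DenseLT.lt {x y : α} (h : DenseLT x y) : x < y := by
  obtain ⟨R, h1, -, h⟩ := h
  exact h1 _ _ h

theorem DenseLT.exists_between {x y : α} (h : DenseLT x y) : ∃ z, DenseLT x z ∧ DenseLT z y := by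
  obtain ⟨R, h1, h2, h⟩ := h
  obtain ⟨z, hz, hz'⟩ := h2 _ _ h
  exact ⟨z, ⟨R, h1, h2, hz⟩, R, h1, h2, hz'⟩

theorem DenseLT.mono {x y x' y' : α} (h : DenseLT x y) (hx : x' ≤ x) (hy : y ≤ y') :
    DenseLT x' y' := by
  obtain ⟨R, h1, h2, h⟩ := h
  refine ⟨fun a b => ∃ x y, a ≤ x ∧ R x y ∧ y ≤ b, ?_, ?_, x, y, hx, h, hy⟩
  · rintro a b ⟨x, y, hax, hxy, hyb⟩
    exact (hax.trans_lt (h1 _ _ hxy)).trans_le hyb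
  · rintro a b ⟨x, y, hax, hxy, hyb⟩
    obtain ⟨z, hz, hz'⟩ := h2 _ _ hxy
    exact ⟨z, ⟨x, z, hax, hz, le_rfl⟩, z, y, le_rfl, hz', hyb⟩

/-- No dense pair between `a` and `b` is incomparable to `y`. -/
def Tight (a y b : α) : Prop :=
  ¬ ∃ z z', a < z ∧ z' < b ∧ Incomp z y ∧ Incomp z' y ∧ DenseLT z z'

theorem Tight.mono {a y b a' b' : α} (h : Tight a y b) (ha : a ≤ a') (hb : b' ≤ b) :
    Tight a' y b' :=
  fun ⟨z, z', h1, h2, h3⟩ => h ⟨z, z', ha.trans_lt h1, h2.trans_le hb, h3⟩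

/-- Triples `(a, y, b)` with `y` tight and densely between `a` and `b`. -/
structure TightTriple (α : Type*) [PartialOrder α] where
  a : α
  y : α
  b : α
  left : DenseLT a y
  right : DenseLT y b
  tight : Tight a y b

theorem FAC.exists_tightTriple (hfac : FAC α) {u v : α} (huv : DenseLT u v) :
    ∃ t : TightTriple α, u ≤ t.a ∧ t.b ≤ v := by
  by_contra hcon
  push Not at hcon
  let T := {p : α × α × α // u ≤ p.1 ∧ p.2.2 ≤ v ∧ DenseLT p.1 p.2.1 ∧ DenseLT p.2.1 p.2.2}
  have step : ∀ p : T, ∃ q : T, p.1.1 < q.1.1 ∧ q.1.2.2 < p.1.2.2 ∧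
      Incomp q.1.1 p.1.2.1 ∧ Incomp q.1.2.2 p.1.2.1 := by
    rintro ⟨⟨a, y, b⟩, h1, h2, h3, h4⟩
    have : ¬ Tight a y b := fun ht => hcon ⟨a, y, b, h3, h4, ht⟩ h1 h2
    obtain ⟨z, z', k1, k2, k3, k4, k5⟩ := not_not.1 this
    obtain ⟨y', hy, hy'⟩ := k5.exists_between
    exact ⟨⟨(z, y', z'), h1.trans k1.le, k2.le.trans h2, hy, hy'⟩, k1, k2, k3, k4⟩
  choose next h1 h2 h3 h4 using step
  obtain ⟨y0, hy0, hy0'⟩ := huv.exists_between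
  let p : ℕ → T := fun n => next^[n] ⟨(u, y0, v), le_rfl, le_rfl, hy0, hy0'⟩
  have hp : ∀ n, p (n + 1) = next (p n) := fun n => Function.iterate_succ_apply' _ _ _
  have hmono : StrictMono fun n => (p n).1.1 := strictMono_nat_of_lt_succ fun n => by
    rw [hp]; exact h1 _
  have hanti : StrictAnti fun n => (p n).1.2.2 := strictAnti_nat_of_succ_lt fun n => by
    rw [hp]; exact h2 _
  refine hfac (fun n => (p n).1.2.1) fun i j hij => ⟨fun hle => ?_, fun hle => ?_⟩
  · have := hle.trans ((p j).2.2.2.2.lt.le.trans (hanti.antitone (Nat.succ_le_of_lt hij)))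
    simp only [hp] at this
    exact (h4 (p i)).2 this
  · have := ((hmono.monotone (Nat.succ_le_of_lt hij)).trans (p j).2.2.2.1.lt.le).trans hle
    simp only [hp] at this
    exact (h3 (p i)).1 this

/-- A chain of tight points, any two of which are densely related. -/
structure DenseChain (E : Set α) : Prop where
  dense : ∀ e ∈ E, ∀ e' ∈ E, e ≠ e' → DenseLT e e' ∨ DenseLT e' e
  tight : ∀ e ∈ E, ∃ a ∈ E, ∃ b ∈ E, a < e ∧ e < b ∧ Tight a e b

theorem FAC.exists_denseChain (hfac : FAC α) {u v : α} (huv : DenseLT u v) :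
    ∃ E : Set α, E.Nonempty ∧ DenseChain E ∧ ∀ e ∈ E, DenseLT u e ∧ DenseLT e v := by
  choose lc hl1 hl2 using fun t : TightTriple α => hfac.exists_tightTriple t.left
  choose rc hr1 hr2 using fun t : TightTriple α => hfac.exists_tightTriple t.right
  let child : TightTriple α → Bool → TightTriple α := fun t c => bif c then rc t else lc t
  let tr : TightTriple α → List Bool → TightTriple α := fun t w => w.foldl child t
  have htr : ∀ t c w, tr t (c :: w) = tr (child t c) w := fun t c w => rfl
  have hsnoc : ∀ t w c, tr t (w ++ [c]) = child (tr t w) c := fun t w c => by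
    simp [tr, List.foldl_append]
  have hchild : ∀ t c, t.a ≤ (child t c).a ∧ (child t c).b ≤ t.b := by
    rintro t (_ | _)
    · exact ⟨hl1 t, (hl2 t).trans t.right.lt.le⟩
    · exact ⟨t.left.lt.le.trans (hr1 t), hr2 t⟩
  have hbd : ∀ w t, t.a ≤ (tr t w).a ∧ (tr t w).b ≤ t.b := by
    intro w
    induction w with
    | nil => exact fun t => ⟨le_rfl, le_rfl⟩
    | cons c w ih =>
      intro t
      rw [htr]
      exact ⟨(hchild t c).1.trans (ih _).1, (ih _).2.trans (hchild t c).2⟩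
  have hleft : ∀ w t, DenseLT (tr t (false :: w)).y t.y := fun w t =>
    (tr t (false :: w)).right.mono le_rfl ((hbd w (lc t)).2.trans (hl2 t))
  have hright : ∀ w t, DenseLT t.y (tr t (true :: w)).y := fun w t =>
    (tr t (true :: w)).left.mono ((hr1 t).trans (hbd w (rc t)).1) le_rfl
  have hpair : ∀ w w' t, (tr t w).y = (tr t w').y ∨ DenseLT (tr t w).y (tr t w').y ∨
      DenseLT (tr t w').y (tr t w).y := by
    intro w
    induction w with
    | nil =>
      rintro (_ | ⟨_ | _, w'⟩) t
      · exact .inl rfl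
      · exact .inr (.inr (hleft w' t))
      · exact .inr (.inl (hright w' t))
    | cons c w ih =>
      rintro (_ | ⟨c', w'⟩) t
      · cases c
        · exact .inr (.inl (hleft w t))
        · exact .inr (.inr (hright w t))
      · cases c <;> cases c'
        · exact ih w' _
        · exact .inr (.inl ((hleft w t).mono le_rfl (hright w' t).lt.le))
        · exact .inr (.inr ((hleft w' t).mono le_rfl (hright w t).lt.le))
        · exact ih w' _
  obtain ⟨t, htu, htv⟩ := hfac.exists_tightTriple huv
  refine ⟨Set.range fun w => (tr t w).y, ⟨_, [], rfl⟩, ⟨?_, ?_⟩, ?_⟩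
  · rintro _ ⟨w, rfl⟩ _ ⟨w', rfl⟩ hne
    exact (hpair w w' t).resolve_left hne
  · rintro _ ⟨w, rfl⟩
    have h1 := hsnoc t w false
    have h2 := hsnoc t w true
    refine ⟨_, ⟨w ++ [false], rfl⟩, _, ⟨w ++ [true], rfl⟩, ?_, ?_, ?_⟩
    · simp only [h1]; exact (hleft [] (tr t w)).lt
    · simp only [h2]; exact (hright [] (tr t w)).lt
    · simp only [h1, h2]
      exact (tr t w).tight.mono ((hl1 _).trans (lc (tr t w)).left.lt.le)
        ((rc (tr t w)).right.lt.le.trans (hr2 _))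
  · rintro _ ⟨w, rfl⟩
    exact ⟨(tr t w).left.mono (htu.trans (hbd w t).1) le_rfl,
      (tr t w).right.mono le_rfl ((hbd w t).2.trans htv)⟩

theorem FAC.exists_maximal_denseChain (hfac : FAC α) :
    ∃ E : Set α, DenseChain E ∧ ∀ p q, DenseLT p q → ∃ e ∈ E, ¬ e ≤ p ∧ ¬ q ≤ e := by
  obtain ⟨E, hE⟩ := zorn_subset {E : Set α | DenseChain E} fun c hc hch => by
    refine ⟨⋃₀ c, ⟨?_, ?_⟩, fun s hs => Set.subset_sUnion_of_mem hs⟩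
    · rintro e ⟨s, hs, he⟩ e' ⟨s', hs', he'⟩ hne
      rcases hch.total hs hs' with h | h
      · exact (hc hs').dense e (h he) e' he' hne
      · exact (hc hs).dense e he e' (h he') hne
    · rintro e ⟨s, hs, he⟩
      obtain ⟨a, ha, b, hb, h⟩ := (hc hs).tight e he
      exact ⟨a, ⟨s, hs, ha⟩, b, ⟨s, hs, hb⟩, h⟩
  refine ⟨E, hE.prop, fun p q hpq => ?_⟩
  by_contra hcon
  push Not at hcon
  obtain ⟨F, ⟨y, hy⟩, hF, hFpq⟩ := hfac.exists_denseChain hpq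
  have mixed : ∀ e ∈ E, ∀ f ∈ F, DenseLT e f ∨ DenseLT f e := by
    intro e he f hf
    by_cases hep : e ≤ p
    · exact .inl ((hFpq f hf).1.mono hep le_rfl)
    · exact .inr ((hFpq f hf).2.mono le_rfl (hcon e he hep))
  have hEF : DenseChain (E ∪ F) := by
    constructor
    · rintro e (he | he) e' (he' | he') hne
      · exact hE.prop.dense e he e' he' hne
      · exact mixed e he e' he'
      · exact (mixed e' he' e he).symm
      · exact hF.dense e he e' he' hne
    · rintro e (he | he)
      · obtain ⟨a, ha, b, hb, h⟩ := hE.prop.tight e he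
        exact ⟨a, .inl ha, b, .inl hb, h⟩
      · obtain ⟨a, ha, b, hb, h⟩ := hF.tight e he
        exact ⟨a, .inr ha, b, .inr hb, h⟩
  have hyE : y ∈ E := hE.le_of_ge (y := E ∪ F) hEF Set.subset_union_left (.inr hy)
  exact (hFpq y hy).2.lt.not_ge (hcon y hyE (hFpq y hy).1.lt.not_ge)

variable {E : Set α}

theorem DenseChain.lt_or_lt (hE : DenseChain E) {e e' : α} (he : e ∈ E) (he' : e' ∈ E)
    (hne : e ≠ e') : e < e' ∨ e' < e :=
  (hE.dense e he e' he' hne).imp DenseLT.lt DenseLT.lt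

theorem DenseChain.exists_between (hE : DenseChain E)
    (hmax : ∀ p q, DenseLT p q → ∃ e ∈ E, ¬ e ≤ p ∧ ¬ q ≤ e) {e e' : α} (he : e ∈ E)
    (he' : e' ∈ E) (h : e < e') : ∃ f ∈ E, e < f ∧ f < e' := by
  have hd : DenseLT e e' :=
    (hE.dense e he e' he' h.ne).resolve_right fun h' => h.not_gt h'.lt
  obtain ⟨f, hf, h1, h2⟩ := hmax e e' hd
  refine ⟨f, hf, ?_, ?_⟩
  · refine (hE.lt_or_lt he hf ?_).resolve_right fun h => h1 h.le
    rintro rfl; exact h1 le_rfl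
  · refine (hE.lt_or_lt hf he' ?_).resolve_right fun h => h2 h.le
    rintro rfl; exact h2 le_rfl

/-- The points incomparable to at most one point of `E`. -/
def Aligned (E : Set α) : Set α :=
  {x | ∀ e ∈ E, ∀ e' ∈ E, e < e' → Incomp x e → ¬ Incomp x e'}

/-- The points of `E` below `x`, not counting the largest one. -/
def InnerBelow (E : Set α) (x : α) : Set α := {e | e ∈ E ∧ ∃ e' ∈ E, e < e' ∧ e' < x}

/-- The points of `E` above `x`, not counting the least one. -/
def InnerAbove (E : Set α) (x : α) : Set α := {e | e ∈ E ∧ ∃ e' ∈ E, x < e' ∧ e' < e}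

/-- Having the same inner sections in `E`. -/
def sectionSetoid (E : Set α) : Setoid α where
  r x y := InnerBelow E x = InnerBelow E y ∧ InnerAbove E x = InnerAbove E y
  iseqv := ⟨fun _ => ⟨rfl, rfl⟩, fun h => ⟨h.1.symm, h.2.symm⟩,
    fun h h' => ⟨h.1.trans h'.1, h.2.trans h'.2⟩⟩

/-- The hypotheses on the chain `E` used for the decomposition. -/
structure MaxDenseChain (E : Set α) : Prop extends DenseChain E where
  max : ∀ p q, DenseLT p q → ∃ e ∈ E, ¬ e ≤ p ∧ ¬ q ≤ e

theorem MaxDenseChain.between (hE : MaxDenseChain E) {e e' : α} (he : e ∈ E)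
    (he' : e' ∈ E) (h : e < e') : ∃ f ∈ E, e < f ∧ f < e' :=
  hE.toDenseChain.exists_between hE.max he he' h

theorem MaxDenseChain.lt_of_innerBelow (hE : MaxDenseChain E) {x y e : α} (hy : y ∈ Aligned E)
    (hx : e ∈ InnerBelow E x) (hye : e ∉ InnerBelow E y) : y < x := by
  obtain ⟨he, e', he', h1, h2⟩ := hx
  obtain ⟨g, hg, hg1, hg2⟩ := hE.between he he' h1
  obtain ⟨f, hf, hf1, hf2⟩ := hE.between he hg hg1
  have hn : ∀ k ∈ E, e < k → k ≤ e' → ¬ Incomp y k → y < x := by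
    intro k hk hek hke hinc
    rcases eq_or_lt_or_gt_of_not_incomp hinc with rfl | h | h
    · exact hke.trans_lt h2
    · exact (h.trans_le hke).trans h2
    · exact absurd ⟨he, k, hk, hek, h⟩ hye
  by_cases h : Incomp y f
  · exact hn g hg hg1 hg2.le (hy f hf g hg hf2 h)
  · exact hn f hf hf1 (hf2.trans hg2).le h

theorem MaxDenseChain.lt_of_innerAbove (hE : MaxDenseChain E) {x y e : α} (hy : y ∈ Aligned E)
    (hx : e ∈ InnerAbove E x) (hye : e ∉ InnerAbove E y) : x < y := by
  obtain ⟨he, e', he', h1, h2⟩ := hx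
  obtain ⟨g, hg, hg1, hg2⟩ := hE.between he' he h2
  obtain ⟨f, hf, hf1, hf2⟩ := hE.between he' hg hg1
  have hn : ∀ k ∈ E, e' ≤ k → k < e → ¬ Incomp y k → x < y := by
    intro k hk hek hke hinc
    rcases eq_or_lt_or_gt_of_not_incomp hinc with rfl | h | h
    · exact h1.trans_le hek
    · exact absurd ⟨he, k, hk, h, hke⟩ hye
    · exact (h1.trans_le hek).trans h
  by_cases h : Incomp y f
  · exact hn g hg hg1.le hg2 (hy f hf g hg hf2 h)
  · exact hn f hf hf1.le (hf2.trans hg2) h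

theorem MaxDenseChain.lt_or_lt_of_not_rel (hE : MaxDenseChain E) {x y : α} (hx : x ∈ Aligned E)
    (hy : y ∈ Aligned E) (hxy : ¬ sectionSetoid E x y) : x < y ∨ y < x := by
  by_contra hcon
  push Not at hcon
  refine hxy ⟨Set.ext fun e => ⟨fun h => ?_, fun h => ?_⟩,
    Set.ext fun e => ⟨fun h => ?_, fun h => ?_⟩⟩ <;> by_contra h'
  · exact hcon.2 (hE.lt_of_innerBelow hy h h')
  · exact hcon.1 (hE.lt_of_innerBelow hx h h')
  · exact hcon.1 (hE.lt_of_innerAbove hy h h')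
  · exact hcon.2 (hE.lt_of_innerAbove hx h h')

theorem MaxDenseChain.subsingleton_gap (hE : MaxDenseChain E) {u v : α} (hu : u ∈ Aligned E)
    (huv : sectionSetoid E u v) : ∀ e ∈ E, ∀ e' ∈ E, ¬ e < u → ¬ v < e' → ¬ e < e' := by
  intro e he e' he' heu hve hlt
  obtain ⟨f4, h4, h4l, h4r⟩ := hE.between he he' hlt
  obtain ⟨f3, h3, h3l, h3r⟩ := hE.between he h4 h4l
  obtain ⟨f2, h2, h2l, h2r⟩ := hE.between he h3 h3l
  obtain ⟨f1, h1, h1l, h1r⟩ := hE.between he h2 h2l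
  have hn : ∀ k ∈ E, e < k → k < f3 → ¬ Incomp u k → u < f3 := by
    intro k hk hek hk3 hinc
    rcases eq_or_lt_or_gt_of_not_incomp hinc with rfl | h | h
    · exact hk3
    · exact h.trans hk3
    · exact absurd (hek.trans h) heu
  have hu3 : u < f3 := by
    by_cases h : Incomp u f1
    · exact hn f2 h2 h2l h2r (hu f1 h1 f2 h2 h1r h)
    · exact hn f1 h1 h1l (h1r.trans h2r) h
  have : f4 ∈ InnerAbove E v := huv.2 ▸ ⟨h4, f3, h3, hu3, h3r⟩
  obtain ⟨-, k, -, hk1, hk2⟩ := this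
  exact hve (hk1.trans (hk2.trans h4r))

/-- The classes of the decomposition. -/
def SectionClass (E : Set α) (x : α) : Set α := {y | y ∈ Aligned E ∧ sectionSetoid E x y}

theorem MaxDenseChain.ordConnected_class (hE : MaxDenseChain E) (x : α) :
    (SectionClass E x).OrdConnected := by
  refine ⟨fun u hu v hv z hz => ?_⟩
  have huv : sectionSetoid E u v := (sectionSetoid E).trans ((sectionSetoid E).symm hu.2) hv.2
  refine ⟨fun e he e' he' hlt h1 h2 => ?_, (sectionSetoid E).trans hu.2 ⟨?_, ?_⟩⟩
  · exact hE.subsingleton_gap hu.1 huv e he e' he' (fun h => h1.2 (h.le.trans hz.1))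
      (fun h => h2.1 (hz.2.trans h.le)) hlt
  · ext e
    constructor
    · rintro ⟨he, e', he', h1, h2⟩
      exact ⟨he, e', he', h1, h2.trans_le hz.1⟩
    · rintro ⟨he, e', he', h1, h2⟩
      rw [huv.1]
      exact ⟨he, e', he', h1, h2.trans_le hz.2⟩
  · ext e
    constructor
    · intro he
      rw [huv.2] at he
      obtain ⟨he, e', he', h1, h2⟩ := he
      exact ⟨he, e', he', hz.2.trans_lt h1, h2⟩
    · rintro ⟨he, e', he', h1, h2⟩
      exact ⟨he, e', he', hz.1.trans_lt h1, h2⟩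

theorem MaxDenseChain.scattered_class (hE : MaxDenseChain E) (x : α) :
    Scattered (SectionClass E x) := by
  intro R h1 h2 u v huv
  obtain ⟨x1, hx1, hx1v⟩ := h2 _ _ huv
  obtain ⟨x2, hx12, hx2⟩ := h2 _ _ hx1v
  have lift : ∀ p q, R p q → DenseLT (p : α) (q : α) := by
    intro p q hpq
    refine ⟨fun a b => ∃ p q, R p q ∧ (p : α) = a ∧ (q : α) = b, ?_, ?_, p, q, hpq, rfl, rfl⟩
    · rintro _ _ ⟨p, q, hpq, rfl, rfl⟩
      exact h1 p q hpq
    · rintro _ _ ⟨p, q, hpq, rfl, rfl⟩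
      obtain ⟨r, hr, hr'⟩ := h2 p q hpq
      exact ⟨r, ⟨p, r, hr, rfl, rfl⟩, r, q, hr', rfl, rfl⟩
  have hrel : sectionSetoid E u v :=
    (sectionSetoid E).trans ((sectionSetoid E).symm u.2.2) v.2.2
  have hgap := hE.subsingleton_gap u.2.1 hrel
  have l1 := lift _ _ hx1
  have l2 := lift _ _ hx12
  have l3 := lift _ _ hx2
  obtain ⟨e1, he1, h11, h12⟩ := hE.max _ _ l1
  obtain ⟨e2, he2, h21, h22⟩ := hE.max _ _ l2
  obtain ⟨e3, he3, h31, h32⟩ := hE.max _ _ l3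
  have heq : ∀ e ∈ E, ∀ e' ∈ E, ¬ e < u → ¬ (v : α) < e → ¬ e' < u → ¬ (v : α) < e' → e = e' := by
    intro e he e' he' k1 k2 k3 k4
    by_contra hne
    rcases hE.lt_or_lt he he' hne with h | h
    · exact hgap e he e' he' k1 k4 h
    · exact hgap e' he' e he k3 k2 h
  have hu2 : ¬ e2 < (u : α) := fun h => h21 (h.trans l1.lt).le
  have hv2 : ¬ (v : α) < e2 := fun h => h22 (l3.lt.trans h).le
  obtain rfl := heq e1 he1 e2 he2 (fun h => h11 h.le)
    (fun h => h12 ((l2.lt.trans l3.lt).trans h).le) hu2 hv2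
  obtain rfl := heq e3 he3 e1 he1 (fun h => h31 (h.trans (l1.lt.trans l2.lt)).le)
    (fun h => h32 h.le) hu2 hv2
  obtain ⟨a, ha, b, hb, hae, heb, ht⟩ := hE.tight e3 he3
  refine ht ⟨x1, x2, ?_, ?_, ⟨h12, h21⟩, ⟨h22, h31⟩, l2⟩
  · by_contra hax
    exact hgap a ha e3 he3 (fun h => hax (h.trans l1.lt)) hv2 hae
  · by_contra hxb
    exact hgap e3 he3 b hb hu2 (fun h => hxb (l3.lt.trans h)) heb

theorem MaxDenseChain.infinite_fibres (hE : MaxDenseChain E) {f : α → α}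
    (hr : ∀ y ∈ Aligned E, sectionSetoid E y (f y)) {x : α} (hx : x ∉ Aligned E) :
    {c | c ∈ f '' Aligned E ∧ ∀ y ∈ Aligned E, f y = c → Incomp x y}.Infinite := by
  have : ∃ e ∈ E, ∃ e' ∈ E, e < e' ∧ Incomp x e ∧ Incomp x e' := by
    by_contra hcon
    push Not at hcon
    exact hx hcon
  obtain ⟨e, he, e', he', hlt, hxe, hxe'⟩ := this
  have hEA : E ⊆ Aligned E := by
    intro g hg k hk _ _ _ hinc
    rcases eq_or_ne g k with rfl | hne
    · exact absurd le_rfl hinc.1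
    · rcases hE.lt_or_lt hg hk hne with h | h
      · exact absurd h.le hinc.1
      · exact absurd h.le hinc.2
  have hinf : {g | g ∈ E ∧ e < g ∧ g < e'}.Infinite := by
    intro hfin
    obtain ⟨g0, hg0, h1, h2⟩ := hE.between he he' hlt
    obtain ⟨g, ⟨hg, hg1, hg2⟩, hmax⟩ := hfin.exists_maximal ⟨g0, hg0, h1, h2⟩
    obtain ⟨k, hk, hk1, hk2⟩ := hE.between hg he' hg2
    exact hk1.not_ge (hmax ⟨hk, hg1.trans hk1, hk2⟩ hk1.le)
  have hne : ∀ g ∈ E, ∀ g' ∈ E, g < g' → f g ≠ f g' := by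
    intro g hg g' hg' hlt heq
    have hrel : sectionSetoid E g g' := (sectionSetoid E).trans (hr g (hEA hg))
      (heq ▸ (sectionSetoid E).symm (hr g' (hEA hg')))
    obtain ⟨k, hk, hk1, hk2⟩ := hE.between hg hg' hlt
    have : g ∈ InnerBelow E g := hrel.1 ▸ ⟨hg, k, hk, hk1, hk2⟩
    obtain ⟨-, l, -, hl1, hl2⟩ := this
    exact hl1.not_gt hl2
  have hinj : Set.InjOn f {g | g ∈ E ∧ e < g ∧ g < e'} := by
    intro g hg g' hg' heq
    by_contra hgg
    rcases hE.lt_or_lt hg.1 hg'.1 hgg with h | h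
    · exact hne g hg.1 g' hg'.1 h heq
    · exact hne g' hg'.1 g hg.1 h heq.symm
  refine (hinf.image hinj).mono ?_
  rintro _ ⟨g, ⟨hg, hg1, hg2⟩, rfl⟩
  refine ⟨⟨g, hEA hg, rfl⟩, fun y hy hyg => ?_⟩
  have hrel : sectionSetoid E g y := (sectionSetoid E).trans (hr g (hEA hg))
    (hyg ▸ (sectionSetoid E).symm (hr y hy))
  have hey : e < y := by
    obtain ⟨k, hk, hk1, hk2⟩ := hE.between he hg hg1
    have : e ∈ InnerBelow E y := hrel.1 ▸ ⟨he, k, hk, hk1, hk2⟩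
    obtain ⟨-, l, -, hl1, hl2⟩ := this
    exact hl1.trans hl2
  have hye : y < e' := by
    obtain ⟨k, hk, hk1, hk2⟩ := hE.between hg he' hg2
    have : e' ∈ InnerAbove E y := hrel.2 ▸ ⟨he', k, hk, hk1, hk2⟩
    obtain ⟨-, l, -, hl1, hl2⟩ := this
    exact hl1.trans hl2
  exact ⟨fun h => hxe'.1 (h.trans hye.le), fun h => hxe.2 (hey.le.trans h)⟩

theorem Vacillating.of_ordConnected (h : Vacillating α) {Q : Set α} (hQ : Q.OrdConnected) :
    Vacillating Q := by
  rintro ⟨C, Ci, ⟨hC1, hC2⟩, hinf, hdis, hun, hor⟩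
  refine h ⟨Subtype.val '' C, fun i => Subtype.val '' Ci i, ⟨?_, ?_⟩,
    fun i => (hinf i).image Subtype.val_injective.injOn, fun i j hij => ?_, ?_, ?_⟩
  · rintro _ ⟨x, hx, rfl⟩ _ ⟨y, hy, rfl⟩ hne
    exact hC1 hx hy fun h => hne (congrArg _ h)
  · rintro ⟨x, hx, _, ⟨y, hy, rfl⟩, _, ⟨z, hz, rfl⟩, hyx, hxz, hch⟩
    have hxQ : x ∈ Q := hQ.out y.2 z.2 ⟨hyx.le, hxz.le⟩
    refine hC2 ⟨⟨x, hxQ⟩, fun h => hx ⟨_, h, rfl⟩, y, hy, z, hz, hyx, hxz, ?_⟩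
    have hmem : ∀ p ∈ insert (⟨x, hxQ⟩ : Q) C, (p : α) ∈ insert x (Subtype.val '' C) := by
      rintro p (rfl | hp)
      · exact Set.mem_insert _ _
      · exact Set.mem_insert_of_mem _ ⟨p, hp, rfl⟩
    exact fun p hp q hq hne => hch (hmem p hp) (hmem q hq) fun h => hne (Subtype.ext h)
  · exact (Set.disjoint_image_iff Subtype.val_injective).2 (hdis hij)
  · rw [← hun, Set.image_iUnion]
  · have pull : ∀ i, ∀ g : ℕ → α, (∀ n, g n ∈ Subtype.val '' Ci i) →
        ∃ g' : ℕ → Q, (∀ n, (g' n : α) = g n) ∧ ∀ n, g' n ∈ Ci i := by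
      intro i g hg
      choose g' h1 h2 using hg
      exact ⟨g', h2, h1⟩
    refine hor.imp (fun ⟨h1, h2⟩ => ⟨?_, ?_⟩) fun ⟨h1, h2⟩ => ⟨?_, ?_⟩
    · rintro i j hij _ ⟨x, hx, rfl⟩ _ ⟨y, hy, rfl⟩
      exact h1 i j hij x hx y hy
    · rintro i ⟨g, hg, hgi⟩
      obtain ⟨g', h3, h4⟩ := pull i g hgi
      exact h2 i ⟨g', fun m n hmn => Subtype.coe_lt_coe.1 (by rw [h3, h3]; exact hg hmn), h4⟩
    · rintro i j hij _ ⟨x, hx, rfl⟩ _ ⟨y, hy, rfl⟩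
      exact h1 i j hij x hx y hy
    · rintro i ⟨g, hg, hgi⟩
      obtain ⟨g', h3, h4⟩ := pull i g hgi
      exact h2 i ⟨g', fun m n hmn => Subtype.coe_lt_coe.1 (by rw [h3, h3]; exact hg hmn), h4⟩

theorem SpineOn.of_subtype {Q : Set α} {f : Q → Q} (hf : SpineOn Set.univ f) :
    ∃ g, SpineOn Q g := by
  classical
  let g : α → α := fun x => if h : x ∈ Q then f ⟨x, h⟩ else x
  have hg : ∀ x (hx : x ∈ Q), g x = f ⟨x, hx⟩ := fun x hx => dif_pos hx
  refine ⟨g, fun x hx => ?_, fun x hx => ?_, fun x hx y hy => ?_, fun x hx y hy hxy => ?_⟩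
  · rw [hg x hx]; exact (f _).2
  · rw [hg x hx, hg _ (f _).2]
    exact congrArg _ (hf.idem ⟨x, hx⟩ trivial)
  · rw [hg x hx, hg y hy]
    exact hf.chain _ trivial _ trivial
  · rw [hg x hx, hg y hy]
    exact fun h => hf.ne ⟨x, hx⟩ trivial ⟨y, hy⟩ trivial hxy (Subtype.ext h)

theorem exists_spineOn_univ [Countable α] (hfac : FAC α) (hvac : Vacillating α) :
    ∃ f : α → α, SpineOn Set.univ f := by
  obtain ⟨E, hE, hmax⟩ := hfac.exists_maximal_denseChain
  have hE : MaxDenseChain E := ⟨hE, hmax⟩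
  obtain ⟨f, hf, hr⟩ := exists_spineOn_of_classes (sectionSetoid E)
    (fun x hx y hy hxy => hE.lt_or_lt_of_not_rel hx hy hxy) (fun x hx => by
      have ht : Tame (SectionClass E x) :=
        ⟨fun y hy => hfac (fun n => y n) hy, hE.scattered_class x,
          hvac.of_ordConnected (hE.ordConnected_class x)⟩
      obtain ⟨g, hg⟩ := ht.exists_spineOn_univ
      exact hg.of_subtype)
  exact hf.exists_extend (Set.subset_univ _) fun x _ hx => hE.infinite_fibres hr hx

theorem SpineOn.isSpine_range {f : α → α} (hf : SpineOn Set.univ f) :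
    IsChain (· ≤ ·) (Set.range f) ∧ IsSpine (· ≤ ·) (Set.range f) := by
  refine ⟨?_, {A | ∃ z, A = {x | f x = f z}}, ?_, fun x => ?_, ?_⟩
  · rintro _ ⟨x, rfl⟩ _ ⟨y, rfl⟩ -
    exact hf.chain x trivial y trivial
  · rintro _ ⟨z, rfl⟩ x hx y hy hne hle
    exact hf.ne x trivial y trivial (lt_of_le_of_ne hle hne) (hx.trans hy.symm)
  · refine ⟨{y | f y = f x}, ⟨⟨x, rfl⟩, rfl⟩, ?_⟩
    rintro _ ⟨⟨z, rfl⟩, hz⟩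
    exact Set.ext fun y => by rw [Set.mem_ofPred_eq, Set.mem_ofPred_eq, show f x = f z from hz]
  · rintro _ ⟨z, rfl⟩
    exact ⟨f z, hf.idem z trivial, z, rfl⟩

theorem fac_of_finite_antichains (h : ∀ A : Set α, IsAntichain (· ≤ ·) A → A.Finite) : FAC α := by
  intro y hy
  have hinc : ∀ i j, i ≠ j → Incomp (y i) (y j) := fun i j hij =>
    hij.lt_or_gt.elim (hy i j) fun h => (hy j i h).symm
  have hinj : Function.Injective y := by
    intro i j hij
    by_contra hne
    exact (hinc i j hne).1 hij.le
  refine Set.infinite_range_of_injective hinj (h _ ?_)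
  rintro _ ⟨i, rfl⟩ _ ⟨j, rfl⟩ hne
  exact (hinc i j fun h => hne (congrArg y h)).1

end DenseReduction

/-- Every countable vacillating partial order with no infinite antichain
contains a spine. -/
theorem countable_vacillating_FAC_has_spine (α : Type*) [PartialOrder α]
    [Countable α] (hvac : Vacillating α)
    (hFAC : ∀ A : Set α, IsAntichain (· ≤ ·) A → A.Finite) :
    ∃ C : Set α, IsChain (· ≤ ·) C ∧ IsSpine (· ≤ ·) C := by
  obtain ⟨f, hf⟩ := exists_spineOn_univ (fac_of_finite_antichains hFAC) hvac
  exact ⟨Set.range f, hf.isSpine_range⟩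
end

section
/- Let P be a countable partial order with no infinite antichain, let F ⊆ P be a strong thick chain, let C be a maximal chain of the induced order on F, and let (A_x)_{x ∈ C} be a partition of F into antichains with x ∈ A_x for all x ∈ C. Then there is a partition (B_x)_{x ∈ C} of P into antichains with A_x ⊆ B_x for all x ∈ C. -/
/-- A countable family of infinite sets has a system of distinct representatives. -/
theorem exists_injective_forall_mem_of_infinite {ι α : Type*} [Countable ι] (f : ι → Set α)
    (hf : ∀ i, (f i).Infinite) : ∃ g : ι → α, Function.Injective g ∧ ∀ i, g i ∈ f i := by
  classical
  rcases isEmpty_or_nonempty ι with h | h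
  · exact ⟨fun i => h.elim i, fun i => h.elim i, fun i => h.elim i⟩
  obtain ⟨s, hs⟩ := exists_surjective_nat ι
  have hpick : ∀ (i : ι) (t : Finset α), ∃ a ∈ f i, a ∉ t :=
    fun i t => (hf i).exists_notMem_finset t
  choose pick hpick_mem hpick_notMem using hpick
  let used : ℕ → Finset α := fun n =>
    Nat.rec ∅ (fun k t => insert (pick (s k) t) t) n
  have hused : ∀ n, used (n + 1) = insert (pick (s n) (used n)) (used n) := fun _ => rfl
  have hmono : Monotone used :=
    monotone_nat_of_le_succ fun n => (hused n).symm ▸ Finset.subset_insert _ _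
  have hne : ∀ m n, m < n → pick (s m) (used m) ≠ pick (s n) (used n) := by
    intro m n hmn heq
    refine hpick_notMem (s n) (used n) (heq ▸ hmono (Nat.succ_le_of_lt hmn) ?_)
    rw [Nat.succ_eq_add_one, hused]
    exact Finset.mem_insert_self _ _
  obtain ⟨r, hr⟩ := hs.hasRightInverse
  refine ⟨fun i => pick (s (r i)) (used (r i)), fun i j hij => hr.injective ?_, fun i => ?_⟩
  · rcases lt_trichotomy (r i) (r j) with h | h | h
    · exact absurd hij (hne _ _ h)
    · exact h
    · exact absurd hij.symm (hne _ _ h)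
  · simpa only [hr i] using hpick_mem (s (r i)) (used (r i))


/-- Two elements of a poset are comparable. -/
def Cmp {α : Type*} [PartialOrder α] (x y : α) : Prop := x ≤ y ∨ y ≤ x

/-- A thick chain: every element of `F` is incomparable to only finitely many
elements of `F`. -/
def ThickChain {α : Type*} [PartialOrder α] (F : Set α) : Prop :=
  ∀ x ∈ F, {y ∈ F | ¬ Cmp x y}.Finite

/-- A strong thick chain: a thick chain `F` such that for every `y ∉ F`, the set
of those `x ∈ F` incomparable to `y` such that every `z ∈ F` comparable to `y`
is comparable to `x`, is infinite. -/
def StrongThickChain {α : Type*} [PartialOrder α] (F : Set α) : Prop :=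
  ThickChain F ∧
    ∀ y ∉ F, {x ∈ F | ¬ Cmp x y ∧ ∀ z ∈ F, Cmp z y → Cmp z x}.Infinite

/-- Any partition of a strong thick chain `F` into antichains indexed by a
maximal chain `C` of `F` (with `x ∈ A x`) extends to a partition of the whole
poset into antichains `B x ⊇ A x`. -/
theorem strong_thick_chain_partition_extends (α : Type*) [PartialOrder α]
    [Countable α] (hFAC : ∀ A : Set α, IsAntichain (· ≤ ·) A → A.Finite)
    (F : Set α) (hF : StrongThickChain F)
    (C : Set α) (hCF : C ⊆ F) (hC : IsChain (· ≤ ·) C)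
    (hCmax : ∀ D : Set α, IsChain (· ≤ ·) D → D ⊆ F → C ⊆ D → D = C)
    (A : α → Set α)
    (hAanti : ∀ x ∈ C, IsAntichain (· ≤ ·) (A x))
    (hAmem : ∀ x ∈ C, x ∈ A x)
    (hAdisj : ∀ x ∈ C, ∀ y ∈ C, x ≠ y → Disjoint (A x) (A y))
    (hAunion : (⋃ x ∈ C, A x) = F) :
    ∃ B : α → Set α,
      (∀ x ∈ C, IsAntichain (· ≤ ·) (B x)) ∧
      (∀ x ∈ C, A x ⊆ B x) ∧
      (∀ x ∈ C, ∀ y ∈ C, x ≠ y → Disjoint (B x) (B y)) ∧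
      (⋃ x ∈ C, B x) = Set.univ := by
  have hAF : ∀ c ∈ C, A c ⊆ F := fun c hc => hAunion ▸ Set.subset_biUnion_of_mem hc
  have hinf : ∀ y : (Fᶜ : Set α),
      {c ∈ C | ∀ z ∈ A c, ¬ Cmp z (y : α)}.Infinite := by
    intro y hfin
    refine hF.2 y y.2 ((hfin.biUnion fun c hc => hFAC _ (hAanti c hc.1)).subset ?_)
    rintro x ⟨hxF, hxy, hx⟩
    obtain ⟨c, hc, hxc⟩ := Set.mem_iUnion₂.1 (hAunion.symm ▸ hxF)
    refine Set.mem_iUnion₂.2 ⟨c, ⟨hc, fun z hz hzy => ?_⟩, hxc⟩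
    rcases eq_or_ne z x with rfl | hne
    · exact hxy hzy
    · rcases hx z (hAF c hc hz) hzy with h | h
      · exact hAanti c hc hz hxc hne h
      · exact hAanti c hc hxc hz hne.symm h
  obtain ⟨g, hg, hgmem⟩ := exists_injective_forall_mem_of_infinite _ hinf
  refine ⟨fun c => A c ∪ {y | ∃ h : y ∈ Fᶜ, g ⟨y, h⟩ = c}, ?_, fun c _ => Set.subset_union_left,
    ?_, ?_⟩
  · rintro c hc a (ha | ⟨ha, rfl⟩) b (hb | ⟨hb, hbc⟩) hab hle
    · exact hAanti c hc ha hb hab hle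
    · subst hbc
      exact (hgmem ⟨b, hb⟩).2 a ha (Or.inl hle)
    · exact (hgmem ⟨a, ha⟩).2 b hb (Or.inr hle)
    · exact hab (congrArg Subtype.val (hg hbc)).symm
  · intro c hc d hd hcd
    rw [Set.disjoint_left]
    rintro a (ha | ⟨ha, rfl⟩) (hb | ⟨hb, hbd⟩)
    · exact Set.disjoint_left.1 (hAdisj c hc d hd hcd) ha hb
    · exact hb (hAF c hc ha)
    · exact ha (hAF d hd hb)
    · exact hcd hbd
  · refine Set.eq_univ_of_forall fun y => Set.mem_iUnion₂.2 ?_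
    by_cases hy : y ∈ F
    · obtain ⟨c, hc, hyc⟩ := Set.mem_iUnion₂.1 (hAunion.symm ▸ hy)
      exact ⟨c, hc, Or.inl hyc⟩
    · exact ⟨g ⟨y, hy⟩, (hgmem ⟨y, hy⟩).1, Or.inr ⟨hy, rfl⟩⟩
end

section
/- If C is a spine of a partial order P, then C is a strongly maximal chain of P: for every chain D ⊆ P, the cardinality of C \ D is at least the cardinality of D \ C. -/
/-- A spine is a strongly maximal chain: for every chain `D`, the cardinality of
`C \ D` is at least that of `D \ C`. -/
theorem spine_is_strongly_maximal (α : Type*) [PartialOrder α] (C : Set α)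
    (hC : IsChain (· ≤ ·) C) (hspine : IsSpine (· ≤ ·) C) :
    ∀ D : Set α, IsChain (· ≤ ·) D →
      Cardinal.mk ↥(D \ C) ≤ Cardinal.mk ↥(C \ D) := by
  intro D hD
  obtain ⟨𝒜, hanti, hpart, hmeet⟩ := hspine
  have eq_of_mem : ∀ A ∈ 𝒜, ∀ E : Set α, IsChain (· ≤ ·) E →
      ∀ x ∈ A, ∀ y ∈ A, x ∈ E → y ∈ E → x = y := fun A hA E hE x hxA y hyA hxE hyE =>
    (hE.total hxE hyE).elim ((hanti A hA).eq hxA hyA) ((hanti A hA).eq' hxA hyA)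
  choose A hA using fun x => (hpart x).exists
  choose f hf using fun x => hmeet (A x) (hA x).1
  have hfC : ∀ d : ↥(D \ C), f d ∈ C \ D := fun d =>
    ⟨(hf d).2, fun hfD => d.2.2 <| by
      rw [eq_of_mem _ (hA d).1 D hD d (hA d).2 _ (hf d).1 d.2.1 hfD]
      exact (hf d).2⟩
  refine Cardinal.mk_le_of_injective (f := fun d => ⟨f d, hfC d⟩) fun d e hde => Subtype.ext ?_
  have hfe : f d = f e := congrArg Subtype.val hde
  have hAe : A d = A e :=
    (hpart (f d)).unique ⟨(hA d).1, (hf d).1⟩ ⟨(hA e).1, hfe ▸ (hf e).1⟩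
  exact eq_of_mem _ (hA d).1 D hD d (hA d).2 e (hAe ▸ (hA e).2) d.2.1 e.2.1
end

section
/- There exists a countable partial order P with no infinite antichain and a chain C ⊆ P such that C is a strongly maximal chain of P but C is not a spine of P. -/
/-- The poset formed by a chain `low 0 < low 1 < ⋯` and a chain `high 0 < high 1 < ⋯ < high ⊤`,
in which `high x < low n` exactly when `x < n`, and no `low n` lies below any `high x`. -/
inductive TwoChains : Type
  | low (n : ℕ)
  | high (x : ℕ∞)

namespace TwoChains

/-- The embedding into `ℕ∞ × Bool` which induces the order. -/
def toProd : TwoChains → ℕ∞ × Bool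
  | low n => (n, true)
  | high x => (x + 1, false)

theorem toProd_injective : Function.Injective toProd := by
  rintro (m | x) (n | y) h <;> simp_all [toProd]

noncomputable instance : PartialOrder TwoChains := PartialOrder.lift toProd toProd_injective

instance : Countable TwoChains :=
  have : Countable ℕ∞ := inferInstanceAs (Countable (Option ℕ))
  toProd_injective.countable

@[simp]
theorem low_le_low {m n : ℕ} : low m ≤ low n ↔ m ≤ n := by
  change toProd _ ≤ toProd _ ↔ _
  simp [toProd]

@[simp]
theorem high_le_high {x y : ℕ∞} : high x ≤ high y ↔ x ≤ y := by
  change toProd _ ≤ toProd _ ↔ _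
  simp [toProd]

@[simp]
theorem high_le_low {x : ℕ∞} {n : ℕ} : high x ≤ low n ↔ x < n := by
  change toProd _ ≤ toProd _ ↔ _
  cases x <;> simp [toProd, ENat.add_one_le_iff]

@[simp]
theorem not_low_le_high {n : ℕ} {x : ℕ∞} : ¬ low n ≤ high x := by
  change ¬ toProd _ ≤ toProd _
  simp [toProd]

theorem finite_of_isAntichain {A : Set TwoChains} (hA : IsAntichain (· ≤ ·) A) : A.Finite := by
  have hlow : (low ⁻¹' A).Subsingleton := fun m hm n hn => by
    rcases le_total m n with h | h
    · exact low.inj (hA.eq hm hn (low_le_low.2 h))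
    · exact low.inj (hA.eq' hm hn (low_le_low.2 h))
  have hhigh : (high ⁻¹' A).Subsingleton := fun x hx y hy => by
    rcases le_total x y with h | h
    · exact high.inj (hA.eq hx hy (high_le_high.2 h))
    · exact high.inj (hA.eq' hx hy (high_le_high.2 h))
  refine ((hlow.finite.image low).union (hhigh.finite.image high)).subset ?_
  rintro (n | x) h
  · exact Or.inl ⟨n, h, rfl⟩
  · exact Or.inr ⟨x, h, rfl⟩

theorem isChain_range_low : IsChain (· ≤ ·) (Set.range low) := by
  rintro _ ⟨m, rfl⟩ _ ⟨n, rfl⟩ -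
  simpa using le_total m n

theorem lt_of_isChain {D : Set TwoChains} (hD : IsChain (· ≤ ·) D) {x : ℕ∞} {n : ℕ}
    (hx : high x ∈ D) (hn : low n ∈ D) : x < n := by
  simpa using hD.total hx hn

theorem mk_diff_range_low_le {D : Set TwoChains} (hD : IsChain (· ≤ ·) D) :
    Cardinal.mk ↥(D \ Set.range low) ≤ Cardinal.mk ↥(Set.range low \ D) := by
  by_cases htop : high ⊤ ∈ D
  · have hsub : Set.range low ⊆ Set.range low \ D := by
      rintro _ ⟨n, rfl⟩
      exact ⟨⟨n, rfl⟩, fun hn => not_top_lt (lt_of_isChain hD htop hn)⟩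
    have hinf : (Set.range low \ D).Infinite :=
      (Set.infinite_range_of_injective fun _ _ => low.inj).mono hsub
    have := hinf.to_subtype
    exact Cardinal.mk_le_aleph0.trans (Cardinal.aleph0_le_mk _)
  · have hsub : D \ Set.range low ⊆
        (fun p => high (toProd p).1) '' (Set.range low \ D) := by
      rintro (n | x) ⟨hxD, hx⟩
      · exact absurd ⟨n, rfl⟩ hx
      · lift x to ℕ using fun h => htop (h ▸ hxD)
        exact ⟨low x, ⟨⟨x, rfl⟩, fun hn => (lt_of_isChain hD hxD hn).false⟩, rfl⟩
    exact (Cardinal.mk_le_mk_of_subset hsub).trans Cardinal.mk_image_le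

/-- Regressiveness on the naturals forces an injection to be the identity there, leaving no value
for `⊤`. -/
theorem not_injective_of_regressive {g : ℕ∞ → ℕ} (hg : ∀ x, (g x : ℕ∞) ≤ x) :
    ¬ Function.Injective g := by
  intro hinj
  have hid : ∀ n : ℕ, g n = n := by
    intro n
    induction n using Nat.strong_induction_on with
    | _ n ih =>
      refine (Nat.cast_le.1 (hg n)).eq_of_not_lt fun hlt => hlt.ne ?_
      exact Nat.cast_injective (hinj (ih _ hlt))
  exact ENat.natCast_ne_top _ (hinj (hid (g ⊤)))

theorem not_isSpine_range_low : ¬ IsSpine (· ≤ ·) (Set.range low) := by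
  rintro ⟨𝒜, hanti, hpart, hmeet⟩
  have hex : ∀ x : ℕ∞, ∃ n : ℕ, ∃ A ∈ 𝒜, high x ∈ A ∧ low n ∈ A := by
    intro x
    obtain ⟨A, ⟨hA, hx⟩, -⟩ := hpart (high x)
    obtain ⟨_, hn, n, rfl⟩ := hmeet A hA
    exact ⟨n, A, hA, hx, hn⟩
  choose g A hA hx hn using hex
  refine not_injective_of_regressive (g := g) (fun x => not_lt.1 fun h => ?_) fun x y hxy => ?_
  · cases (hanti _ (hA x)).eq (hx x) (hn x) (high_le_low.2 h)
  · have hAxy : A x = A y := (hpart (low (g x))).unique ⟨hA x, hn x⟩ ⟨hA y, hxy ▸ hn y⟩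
    have hy : high y ∈ A x := hAxy ▸ hx y
    rcases le_total x y with h | h
    · exact high.inj ((hanti _ (hA x)).eq (hx x) hy (high_le_high.2 h))
    · exact high.inj ((hanti _ (hA x)).eq' (hx x) hy (high_le_high.2 h))

end TwoChains

/-- There is a countable partial order with no infinite antichain containing a
strongly maximal chain which is not a spine. -/
theorem exists_strongly_maximal_chain_not_spine :
    ∃ (α : Type) (inst : PartialOrder α), Countable α ∧
      (∀ A : Set α, IsAntichain inst.le A → A.Finite) ∧
      ∃ C : Set α, IsChain inst.le C ∧
        (∀ D : Set α, IsChain inst.le D →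
          Cardinal.mk ↥(D \ C) ≤ Cardinal.mk ↥(C \ D)) ∧
        ¬ IsSpine inst.le C :=
  ⟨TwoChains, inferInstance, inferInstance, fun _ => TwoChains.finite_of_isAntichain,
    Set.range TwoChains.low, TwoChains.isChain_range_low,
    fun _ => TwoChains.mk_diff_range_low_le, TwoChains.not_isSpine_range_low⟩
end

section
/- There exists a countably infinite partial order P in which every antichain has at most 2 elements, such that no finite subset of P intersects every maximal chain of P; in fact, P can be partitioned into infinitely many pairwise disjoint maximal chains. -/
/-- Two copies (`upper = false` and `upper = true`) of the lexicographic product `ℤ ×ₗ ℕ`, whose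
elements are a level in `ℤ` and a colour in `ℕ`. -/
@[ext]
structure ColouredLadder where
  level : ℤ
  colour : ℕ
  upper : Bool

namespace ColouredLadder

/-- Each copy is ordered lexicographically. An element `(i, c)` of the lower copy lies below `(j, d)`
in the upper copy iff `(i + 1, c) ≤ (j, d)`; an element of the upper copy lies below those of the
lower copy that are lexicographically at least as large. -/
instance : PartialOrder ColouredLadder where
  le x y :=
    x.level + (!x.upper && y.upper).toInt < y.level ∨
      x.level + (!x.upper && y.upper).toInt = y.level ∧ x.colour ≤ y.colour
  le_refl x := by cases h : x.upper <;> simp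
  le_trans := by
    rintro ⟨i, c, s⟩ ⟨j, d, t⟩ ⟨k, e, u⟩
    cases s <;> cases t <;> cases u <;> simp <;> omega
  le_antisymm := by
    rintro ⟨i, c, s⟩ ⟨j, d, t⟩
    cases s <;> cases t <;> simp <;> omega

theorem le_def {x y : ColouredLadder} :
    x ≤ y ↔ x.level + (!x.upper && y.upper).toInt < y.level ∨
      x.level + (!x.upper && y.upper).toInt = y.level ∧ x.colour ≤ y.colour :=
  Iff.rfl

theorem le_total_of_upper_eq {x y : ColouredLadder} (h : x.upper = y.upper) : x ≤ y ∨ y ≤ x := by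
  simp only [le_def, h, Bool.not_and_self, Bool.toInt_false]
  omega

theorem le_total_of_colour_eq {x y : ColouredLadder} (h : x.colour = y.colour) :
    x ≤ y ∨ y ≤ x := by
  obtain ⟨i, c, s⟩ := x
  obtain ⟨j, d, t⟩ := y
  cases s <;> cases t <;> simp [le_def] at * <;> omega

theorem exists_incomparable (x : ColouredLadder) {n : ℕ} (h : x.colour ≠ n) :
    ∃ y : ColouredLadder, y.colour = n ∧ ¬ x ≤ y ∧ ¬ y ≤ x := by
  obtain ⟨i, c, s⟩ := x
  rcases Nat.lt_or_gt_of_ne h with h | h <;> cases s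
  · exact ⟨⟨i, n, true⟩, rfl, by simp [le_def] at *; omega⟩
  · exact ⟨⟨i - 1, n, false⟩, rfl, by simp [le_def] at *; omega⟩
  · exact ⟨⟨i + 1, n, true⟩, rfl, by simp [le_def] at *; omega⟩
  · exact ⟨⟨i, n, false⟩, rfl, by simp [le_def] at *; omega⟩

theorem isMaxChain_colour (n : ℕ) :
    IsMaxChain (· ≤ ·) {x : ColouredLadder | x.colour = n} := by
  refine ⟨fun x hx y hy _ ↦ le_total_of_colour_eq (hx.trans hy.symm), fun t ht hsub ↦ ?_⟩
  refine hsub.antisymm fun x hx ↦ ?_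
  by_contra hne
  obtain ⟨y, hy, hxy, hyx⟩ := x.exists_incomparable hne
  exact (ht.total hx (hsub hy)).elim hxy hyx

theorem subset_pair_of_isAntichain {A : Set ColouredLadder} (hA : IsAntichain (· ≤ ·) A) :
    ∃ a b, A ⊆ {a, b} := by
  have eq_of_upper {x y} (hx : x ∈ A) (hy : y ∈ A) (h : x.upper = y.upper) : x = y :=
    (le_total_of_upper_eq h).elim (hA.eq hx hy) (hA.eq' hx hy)
  have cover (s : Bool) : ∃ a, ∀ x ∈ A, x.upper = s → x = a := by
    by_cases h : ∃ a ∈ A, a.upper = s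
    · obtain ⟨a, ha, rfl⟩ := h
      exact ⟨a, fun x hx hxa ↦ eq_of_upper hx ha hxa⟩
    · exact ⟨⟨0, 0, s⟩, fun x hx hxs ↦ (h ⟨x, hx, hxs⟩).elim⟩
  obtain ⟨a, ha⟩ := cover false
  obtain ⟨b, hb⟩ := cover true
  refine ⟨a, b, fun x hx ↦ ?_⟩
  cases hs : x.upper
  · exact Or.inl (ha x hx hs)
  · exact Or.inr (hb x hx hs)

instance : Countable ColouredLadder :=
  Function.Injective.countable (f := fun x ↦ (x.level, x.colour, x.upper)) fun x y h ↦ by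
    simpa [ColouredLadder.ext_iff] using h

instance : Infinite ColouredLadder :=
  Infinite.of_injective (fun n : ℕ ↦ (⟨0, n, false⟩ : ColouredLadder)) fun m n h ↦ by
    simpa using h

end ColouredLadder

/-- There is a countably infinite partial order in which every antichain has at
most two elements, having no finite cutset (no finite set meets every maximal
chain); indeed it can be partitioned into infinitely many pairwise disjoint
maximal chains. -/
theorem exists_width_two_poset_without_finite_cutset :
    ∃ (α : Type) (inst : PartialOrder α), Countable α ∧ Infinite α ∧
      (∀ A : Set α, IsAntichain inst.le A → ∃ a b : α, A ⊆ {a, b}) ∧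
      (¬ ∃ S : Set α, S.Finite ∧
        ∀ C : Set α, IsMaxChain inst.le C → (S ∩ C).Nonempty) ∧
      (∃ 𝒞 : ℕ → Set α, (∀ n, IsMaxChain inst.le (𝒞 n)) ∧
        Pairwise (Function.onFun Disjoint 𝒞) ∧ (⋃ n, 𝒞 n) = Set.univ) := by
  refine ⟨ColouredLadder, inferInstance, inferInstance, inferInstance,
    fun A hA ↦ ColouredLadder.subset_pair_of_isAntichain hA, ?_,
    fun n ↦ {x | x.colour = n}, ColouredLadder.isMaxChain_colour, ?_, ?_⟩
  · rintro ⟨S, hS, hcut⟩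
    refine Set.infinite_univ (α := ℕ) ((hS.image ColouredLadder.colour).subset fun n _ ↦ ?_)
    exact hcut _ (ColouredLadder.isMaxChain_colour n)
  · exact fun m n hmn ↦ Set.disjoint_left.2 fun x hm hn ↦ hmn (hm.symm.trans hn)
  · exact Set.eq_univ_of_forall fun x ↦ Set.mem_iUnion.2 ⟨x.colour, rfl⟩
end

section
/- Let s be the relation on ℕ × ℕ consisting of the steps (x,y) → (x, y+1) and (x,y) → (x+y+1, y), and let ≤ be the reflexive-transitive closure of s. Then every subset A of ℕ × ℕ whose elements are pairwise incomparable with respect to ≤ (i.e., for distinct a, b ∈ A neither a ≤ b nor b ≤ a) is finite. -/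
/-- The step relation on `ℕ × ℕ`: from `(x, y)` one may step to `(x, y + 1)`
or to `(x + y + 1, y)`. -/
def P3step : ℕ × ℕ → ℕ × ℕ → Prop := fun p q =>
  (q.1 = p.1 ∧ q.2 = p.2 + 1) ∨ (q.1 = p.1 + p.2 + 1 ∧ q.2 = p.2)

/-- The order on `ℕ × ℕ` generated by `P3step`: its reflexive-transitive
closure. -/
def P3le : ℕ × ℕ → ℕ × ℕ → Prop := Relation.ReflTransGen P3step

theorem P3le_add_snd (x y k : ℕ) : P3le (x, y) (x, y + k) := by
  induction k with
  | zero => exact .refl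
  | succ k ih => exact ih.tail (.inl ⟨rfl, rfl⟩)

theorem P3le_of_snd_le (x : ℕ) {y z : ℕ} (h : y ≤ z) : P3le (x, y) (x, z) := by
  obtain ⟨k, rfl⟩ := Nat.exists_eq_add_of_le h
  exact P3le_add_snd x y k

theorem P3le_add_mul_fst (x y k : ℕ) : P3le (x, y) (x + k * (y + 1), y) := by
  induction k with
  | zero => simpa using P3le_add_snd x y 0
  | succ k ih => exact ih.tail (.inr ⟨by simp only; ring, rfl⟩)

theorem P3le_of_modEq {x z y : ℕ} (h : x ≤ z) (hmod : x ≡ z [MOD y + 1]) :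
    P3le (x, y) (z, y) := by
  obtain ⟨k, hk⟩ := (Nat.modEq_iff_dvd' h).1 hmod
  obtain rfl : z = x + k * (y + 1) := by rw [mul_comm]; omega
  exact P3le_add_mul_fst x y k

/-- Everything sufficiently far up and to the right of a point lies above it. -/
theorem P3le_of_add_lt {a b c d : ℕ} (hc : a + b < c) (hd : 2 * b ≤ d) :
    P3le (a, b) (c, d) := by
  obtain ⟨m, rfl⟩ := Nat.exists_eq_add_of_lt hc
  have hr : m % (b + 1) < b + 1 := Nat.mod_lt _ b.succ_pos
  have hm := Nat.div_add_mod' m (b + 1)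
  set q := m / (b + 1)
  set r := m % (b + 1)
  have hstep : P3step (a + q * (b + 1), b + r) (a + b + m + 1, b + r) :=
    .inr ⟨by simp only; omega, rfl⟩
  exact (((P3le_add_mul_fst a b q).trans (P3le_add_snd _ b r)).tail hstep).trans
    (P3le_of_snd_le _ (by omega))

/-- Every set of pairwise `P3le`-incomparable elements of `ℕ × ℕ` is finite. -/
theorem P3_no_infinite_antichain (A : Set (ℕ × ℕ))
    (hA : ∀ a ∈ A, ∀ b ∈ A, a ≠ b → ¬ P3le a b ∧ ¬ P3le b a) : A.Finite := by
  have eq_of_le {p q : ℕ × ℕ} (hp : p ∈ A) (hq : q ∈ A) (h : P3le p q) : p = q := by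
    by_contra hne
    exact (hA p hp q hq hne).1 h
  obtain rfl | ⟨⟨a, b⟩, hab⟩ := A.eq_empty_or_nonempty
  · exact Set.finite_empty
  have left_finite : (A ∩ {p | p.1 ≤ a + b}).Finite := by
    refine Set.Finite.of_injOn (f := Prod.fst) (t := Set.Iic (a + b)) (fun p hp => hp.2) ?_
      (Set.finite_Iic _)
    rintro ⟨x, y⟩ ⟨hp, -⟩ ⟨x', z⟩ ⟨hq, -⟩ (rfl : x = x')
    rcases le_total y z with h | h
    · exact eq_of_le hp hq (P3le_of_snd_le x h)
    · exact (eq_of_le hq hp (P3le_of_snd_le x h)).symm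
  have bottom_finite : (A ∩ {p | p.2 ≤ 2 * b}).Finite := by
    refine Set.Finite.of_injOn (f := fun p : ℕ × ℕ => (p.1 % (p.2 + 1), p.2))
      (t := Set.Iic (2 * b) ×ˢ Set.Iic (2 * b)) ?_ ?_ ((Set.finite_Iic _).prod (Set.finite_Iic _))
    · rintro ⟨x, y⟩ ⟨-, hy⟩
      exact ⟨(Nat.lt_succ_iff.1 (Nat.mod_lt x y.succ_pos)).trans hy, hy⟩
    · rintro ⟨x, y⟩ ⟨hp, -⟩ ⟨z, y'⟩ ⟨hq, -⟩ h
      obtain ⟨hmod, rfl⟩ := Prod.mk.inj h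
      rcases le_total x z with h | h
      · exact eq_of_le hp hq (P3le_of_modEq h hmod)
      · exact (eq_of_le hq hp (P3le_of_modEq h hmod.symm)).symm
  refine (left_finite.union bottom_finite).subset ?_
  rintro ⟨c, d⟩ hcd
  by_contra hout
  simp only [Set.mem_union, Set.mem_inter_iff, Set.mem_ofPred_eq, hcd, true_and, not_or,
    not_le] at hout
  have heq := eq_of_le hab hcd (P3le_of_add_lt hout.1 hout.2.le)
  have : a = c := congrArg Prod.fst heq
  omega
end
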